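/- arXiv:1203.1960 — 2 statements merged into one kernel-verified Lean document; each statement's English description precedes it below -/
import Mathlib

section
/- Let k be a field, let m ≥ 1, and let φ : Alt_m → GL_n(k) be a faithful irreducible representation with n ≥ 8. Then |Alt_m| ≤ (n+2)!/2. -/
/-- A representation `φ : H → GL_n(k)` is irreducible: `k^n` is a nonzero module whose only
`H`-invariant submodules are `⊥` and `⊤` (i.e. `k^n` is a simple `k[H]`-module). -/
def IrreducibleRep {k : Type*} [Field k] {H : Type*} [Group H] {n : ℕ}
    (φ : H →* Matrix.GeneralLinearGroup (Fin n) k) : Prop :=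
  (⊥ : Submodule k (Fin n → k)) ≠ ⊤ ∧
    ∀ W : Submodule k (Fin n → k),
      (∀ g : H, ∀ v ∈ W, Matrix.mulVec ((φ g : Matrix (Fin n) (Fin n) k)) v ∈ W) →
      W = ⊥ ∨ W = ⊤

section Idempotents

variable {K V : Type*} [Field K] [AddCommGroup V] [Module K V] [FiniteDimensional K V]

theorem sum_finrank_range_le_of_orthogonal {ι : Type*} [Fintype ι] {e : ι → Module.End K V}
    (he : ∀ i, e i * e i = e i) (horth : ∀ i j, i ≠ j → e i * e j = 0) {W : Submodule K V}
    (hW : ∀ i, LinearMap.range (e i) ≤ W) :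
    ∑ i, Module.finrank K (LinearMap.range (e i)) ≤ Module.finrank K W := by
  classical
  let f : (∀ i, LinearMap.range (e i)) →ₗ[K] W :=
    LinearMap.lsum K _ K fun i => Submodule.inclusion (hW i)
  have hf : Function.Injective f := by
    refine (injective_iff_map_eq_zero f).2 fun w hw => ?_
    have h0 : ∑ i, (w i : V) = 0 := by
      have := congrArg Subtype.val hw
      simpa [f, LinearMap.lsum_apply] using this
    funext j
    obtain ⟨v, hv⟩ := (w j).2
    have h1 : e j (∑ i, (w i : V)) = w j := by
      rw [map_sum, Finset.sum_eq_single j]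
      · rw [← hv, ← Module.End.mul_apply, he]
      · intro i _ hij
        obtain ⟨u, hu⟩ := (w i).2
        rw [← hu, ← Module.End.mul_apply, horth j i hij.symm, LinearMap.zero_apply]
      · simp
    rw [h0, map_zero] at h1
    exact Subtype.ext h1.symm
  rw [← Module.finrank_pi_fintype K]
  exact LinearMap.finrank_le_finrank_of_injective hf

theorem finrank_range_mul_mul_le (g e h : Module.End K V) :
    Module.finrank K (LinearMap.range (g * e * h)) ≤ Module.finrank K (LinearMap.range e) := by
  have h1 : LinearMap.range (g * e * h) ≤ (LinearMap.range e).map g := by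
    rintro _ ⟨v, rfl⟩
    exact ⟨e (h v), ⟨h v, rfl⟩, rfl⟩
  exact (Submodule.finrank_mono h1).trans (Submodule.finrank_map_le _ _)

theorem finrank_range_conj {G : Type*} [Group G] (ρ : G →* Module.End K V) (g : G)
    (e : Module.End K V) :
    Module.finrank K (LinearMap.range (ρ g * e * ρ g⁻¹)) =
      Module.finrank K (LinearMap.range e) := by
  refine le_antisymm (finrank_range_mul_mul_le _ _ _) ?_
  have h : e = ρ g⁻¹ * (ρ g * e * ρ g⁻¹) * ρ g := by
    simp only [mul_assoc, ← map_mul, inv_mul_cancel, map_one, mul_one]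
    simp only [← mul_assoc, ← map_mul, inv_mul_cancel, map_one, one_mul]
  conv_lhs => rw [h]
  exact finrank_range_mul_mul_le _ _ _

theorem exists_mul_eq_smul_of_finrank_range_eq_one {g e : Module.End K V} (he : e * e = e)
    (hge : g * e = e * g) (h1 : Module.finrank K (LinearMap.range e) = 1) :
    ∃ c : K, g * e = c • e := by
  obtain ⟨w, -, hw⟩ := finrank_eq_one_iff'.1 h1
  have hmem (v : V) : ∃ c : K, e v = c • (w : V) := by
    obtain ⟨c, hc⟩ := hw ⟨e v, v, rfl⟩
    exact ⟨c, by simpa using (congrArg Subtype.val hc).symm⟩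
  obtain ⟨c, hc⟩ := hmem (g w)
  have hew : e w = w := by
    obtain ⟨v, hv⟩ := w.2
    rw [← hv, ← Module.End.mul_apply, he]
  have hgw : g w = c • (w : V) := by
    rw [← hc, ← Module.End.mul_apply, ← hge, Module.End.mul_apply, hew]
  refine ⟨c, LinearMap.ext fun v => ?_⟩
  obtain ⟨d, hd⟩ := hmem v
  rw [Module.End.mul_apply, LinearMap.smul_apply, hd, map_smul, hgw, smul_comm]

theorem finrank_range_pos {e : Module.End K V} (he : e ≠ 0) :
    1 ≤ Module.finrank K (LinearMap.range e) := by
  rw [Nat.one_le_iff_ne_zero, Ne, Submodule.finrank_eq_zero, LinearMap.range_eq_bot]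
  exact he

end Idempotents

section Chain

variable {K V α ι : Type*} [Field K] [AddCommGroup V] [Module K V] [FiniteDimensional K V]
  [Fintype α] [DecidableEq α]

theorem card_le_finrank_add_two_of_blocks {b : ℕ} (hb : 1 ≤ b) (hcard : 2 * b ≤ Fintype.card α)
    (s : ι → Finset α) (p : ι → Module.End K V)
    (hs : ∀ T : Finset α, T.card = b → ∃ i, s i = T)
    (hdisj : ∀ i j, Disjoint (s i) (s j) → p i * p j = 0)
    (hmeet : ∀ (A B : Finset α) (a : α), A.card + 1 = b → B.card + 1 = b → Disjoint A B →
      a ∉ A → a ∉ B → ∃ i j, s i = insert a A ∧ s j = insert a B ∧ p i * p j ≠ 0)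
    (hrank : ∀ i, b ≤ Module.finrank K (LinearMap.range (p i)) + 1) :
    Fintype.card α ≤ Module.finrank K V + 2 := by
  classical
  let U (S : Finset α) : Submodule K V := ⨆ (i) (_ : s i ⊆ S), LinearMap.range (p i)
  have hle (S : Finset α) (i) (h : s i ⊆ S) : LinearMap.range (p i) ≤ U S :=
    le_iSup₂_of_le i h le_rfl
  have hker (S : Finset α) (i) (h : Disjoint (s i) S) : U S ≤ LinearMap.ker (p i) := by
    refine iSup₂_le fun j hj => ?_
    rintro _ ⟨v, rfl⟩
    rw [LinearMap.mem_ker, ← Module.End.mul_apply, hdisj i j (h.mono_right hj),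
      LinearMap.zero_apply]
  have hmono {S S' : Finset α} (h : S ⊆ S') : U S ≤ U S' :=
    iSup₂_le fun i hi => hle S' i (hi.trans h)
  have key (j : ℕ) (hj : 2 * b + j ≤ Fintype.card α) :
      ∃ S : Finset α, S.card = b + j ∧ b + j ≤ Module.finrank K (U S) + 1 := by
    induction j with
    | zero =>
      obtain ⟨S, -, hS⟩ := Finset.exists_subset_card_eq (s := (Finset.univ : Finset α)) (n := b)
        (by rw [Finset.card_univ]; lia)
      obtain ⟨i, rfl⟩ := hs S hS
      exact ⟨s i, hS, (hrank i).trans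
        (Nat.add_le_add_right (Submodule.finrank_mono (hle _ i subset_rfl)) 1)⟩
    | succ j ih =>
      obtain ⟨S, hS, hU⟩ := ih (by lia)
      obtain ⟨x, hx⟩ : ∃ x, x ∉ S := by
        by_contra! h
        have := Finset.card_eq_iff_eq_univ S |>.2 (Finset.eq_univ_iff_forall.2 h)
        lia
      have hSx : (insert x S).card = b + j + 1 := by rw [Finset.card_insert_of_notMem hx, hS]
      obtain ⟨A, hA, hAc⟩ := Finset.exists_subset_card_eq (s := S) (n := b - 1) (by lia)
      obtain ⟨B, hB, hBc⟩ := Finset.exists_subset_card_eq (s := (insert x S)ᶜ) (n := b - 1)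
        (by rw [Finset.card_compl]; lia)
      have hBS : Disjoint B (insert x S) :=
        (Finset.disjoint_left.2 fun y hy => Finset.mem_compl.1 (hB hy))
      obtain ⟨i, k, hi, hk, hik⟩ := hmeet B A x (by lia) (by lia)
        (hBS.mono_right (hA.trans (Finset.subset_insert _ _)))
        (fun h => Finset.disjoint_left.1 hBS h (Finset.mem_insert_self _ _)) (fun h => hx (hA h))
      refine ⟨insert x S, by lia, ?_⟩
      have hlt : U S < U (insert x S) := by
        refine lt_of_le_of_ne (hmono (Finset.subset_insert _ _)) fun heq => hik ?_
        have h1 : LinearMap.range (p k) ≤ LinearMap.ker (p i) := by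
          refine ((hle (insert x S) k ?_).trans heq.ge).trans (hker S i ?_)
          · rw [hk]; exact Finset.insert_subset_insert _ hA
          · rw [hi, Finset.disjoint_insert_left]
            exact ⟨hx, hBS.mono_right (Finset.subset_insert _ _)⟩
        exact LinearMap.range_le_ker_iff.1 h1
      have := Submodule.finrank_lt_finrank_of_lt hlt
      lia
  obtain ⟨S, hS, hU⟩ := key (Fintype.card α - 2 * b) (by lia)
  obtain ⟨i, hi⟩ := hs Sᶜ (by rw [Finset.card_compl]; lia)
  have h1 := Submodule.finrank_mono (hker S i (hi ▸ disjoint_compl_left))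
  have h2 := LinearMap.finrank_range_add_finrank_ker (p i)
  have h3 := hrank i
  lia

end Chain

section OmegaProj

variable {K R : Type*} [Field K] [Ring R] [Algebra K R] {ω : K}

/-- The polynomial in `A` which, when `A ^ 3 = 1`, projects onto the `ω`-eigenspace of `A`. -/
def omegaProj (ω : K) (A : R) : R :=
  (3 : K)⁻¹ • (1 + ω ^ 2 • A + ω • A ^ 2)

theorem mul_omegaProj (hω : ω ^ 2 + ω + 1 = 0) {A : R} (hA : A ^ 3 = 1) :
    A * omegaProj ω A = ω • omegaProj ω A := by
  have hA' : A * A ^ 2 = 1 := by rw [← pow_succ', hA]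
  simp only [omegaProj, mul_smul_comm, mul_add, mul_one, hA', ← sq]
  linear_combination (norm := module) -((3⁻¹ : K) * (ω - 1) * hω) • A

theorem sq_mul_omegaProj (hω : ω ^ 2 + ω + 1 = 0) {A : R} (hA : A ^ 3 = 1) :
    A ^ 2 * omegaProj ω A = ω ^ 2 • omegaProj ω A := by
  rw [sq A, mul_assoc, mul_omegaProj hω hA, mul_smul_comm, mul_omegaProj hω hA, smul_smul, sq]

theorem omegaProj_mul_self (hω : ω ^ 2 + ω + 1 = 0) (h3 : (3 : K) ≠ 0) {A : R} (hA : A ^ 3 = 1) :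
    omegaProj ω A * omegaProj ω A = omegaProj ω A := by
  conv_lhs => enter [1]; rw [omegaProj]
  rw [smul_mul_assoc, add_mul, add_mul, smul_mul_assoc, smul_mul_assoc, mul_omegaProj hω hA,
    sq_mul_omegaProj hω hA, one_mul]
  have h : (3 : K)⁻¹ * 3 = 1 := inv_mul_cancel₀ h3
  linear_combination (norm := module)
    (h + 2 * (3⁻¹ : K) * (ω - 1) * hω) • omegaProj ω A

theorem omegaProj_mul_omegaProj (hω : ω ^ 2 + ω + 1 = 0) {A B : R} (hA : A ^ 3 = 1)
    (hAB : A * B = 1) : omegaProj ω A * omegaProj ω B = 0 := by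
  have hB : B = A ^ 2 := by
    calc B = A ^ 3 * B := by rw [hA, one_mul]
      _ = A ^ 2 * (A * B) := by noncomm_ring
      _ = A ^ 2 := by rw [hAB, mul_one]
  have hB3 : B ^ 3 = 1 := by rw [hB, ← pow_mul, mul_comm, pow_mul, hA, one_pow]
  have hA2 : A = B ^ 2 := by
    rw [hB, ← pow_mul, show 2 * 2 = 3 + 1 from rfl, pow_succ, hA, one_mul]
  conv_lhs => enter [1]; rw [omegaProj, ← hB, hA2]
  rw [smul_mul_assoc, add_mul, add_mul, smul_mul_assoc, smul_mul_assoc, mul_omegaProj hω hB3,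
    sq_mul_omegaProj hω hB3, one_mul]
  linear_combination (norm := module)
    ((3⁻¹ : K) * (ω ^ 2 - ω + 1) * hω) • omegaProj ω B

theorem omegaProj_one (hω : ω ^ 2 + ω + 1 = 0) : omegaProj ω (1 : R) = 0 := by
  rw [omegaProj, one_pow]
  linear_combination (norm := module) ((3⁻¹ : K) * hω) • (1 : R)

theorem sub_one_mul_omegaProj_add (hω : ω ^ 2 + ω + 1 = 0) (h3 : (3 : K) ≠ 0) {A B : R}
    (hA : A ^ 3 = 1) (hAB : A * B = 1) :
    (A - 1) * (omegaProj ω A + omegaProj ω B) = A - 1 := by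
  have hB : B = A ^ 2 := by
    calc B = A ^ 3 * B := by rw [hA, one_mul]
      _ = A ^ 2 * (A * B) := by noncomm_ring
      _ = A ^ 2 := by rw [hAB, mul_one]
  have hA' : A * A ^ 2 = 1 := by rw [← pow_succ', hA]
  have h4 : (A ^ 2) ^ 2 = A := by rw [← pow_mul, show 2 * 2 = 3 + 1 from rfl, pow_succ, hA, one_mul]
  have h : (3 : K)⁻¹ * 3 = 1 := inv_mul_cancel₀ h3
  rw [hB, sub_mul, one_mul]
  simp only [omegaProj, mul_smul_comm, mul_add, mul_one, hA', h4, ← sq]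
  linear_combination (norm := module) h • A - h • (1 : R) +
    ((3⁻¹ : K) * hω) • (1 - A : R)

theorem Commute.omegaProj {A B : R} (h : Commute A B) :
    Commute (omegaProj ω A) (omegaProj ω B) := by
  have key {A B : R} (h : Commute A B) : Commute A (_root_.omegaProj ω B) :=
    ((((Commute.one_right A).add_right (h.smul_right _)).add_right
      ((h.pow_right 2).smul_right _)).smul_right _)
  exact (key (key h).symm).symm

end OmegaProj

section OmegaProjRep

variable {K V G : Type*} [Field K] [AddCommGroup V] [Module K V] [Group G] {ω : K}
  (ρ : G →* Module.End K V)

theorem conj_omegaProj (g c : G) :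
    ρ g * omegaProj ω (ρ c) * ρ g⁻¹ = omegaProj ω (ρ (g * c * g⁻¹)) := by
  have h (x : G) : ρ g * ρ x * ρ g⁻¹ = ρ (g * x * g⁻¹) := by rw [map_mul, map_mul]
  have h2 : (g * c * g⁻¹) ^ 2 = g * c ^ 2 * g⁻¹ := by rw [conj_pow]
  rw [omegaProj, omegaProj, ← map_pow, ← map_pow, h2, ← h, ← h]
  simp only [mul_smul_comm, smul_mul_assoc, mul_add, add_mul, mul_one]
  rw [← map_mul, mul_inv_cancel, map_one]

theorem conj_mul_end (g : G) (a b : Module.End K V) :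
    ρ g * (a * b) * ρ g⁻¹ = ρ g * a * ρ g⁻¹ * (ρ g * b * ρ g⁻¹) := by
  have h : ρ g⁻¹ * ρ g = 1 := by rw [← map_mul, inv_mul_cancel, map_one]
  calc ρ g * (a * b) * ρ g⁻¹ = ρ g * a * 1 * b * ρ g⁻¹ := by noncomm_ring
    _ = _ := by rw [← h]; noncomm_ring

theorem mul_end_eq_conj_mul (g : G) (a : Module.End K V) : ρ g * a = ρ g * a * ρ g⁻¹ * ρ g := by
  rw [mul_assoc _ (ρ g⁻¹), ← map_mul, inv_mul_cancel, map_one, mul_one]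

theorem map_pow_three_eq_one {c : G} (hc : c ^ 3 = 1) : ρ c ^ 3 = 1 := by
  rw [← map_pow, hc, map_one]

variable [FiniteDimensional K V]

theorem two_mul_finrank_range_omegaProj_le (hω : ω ^ 2 + ω + 1 = 0) (h3 : (3 : K) ≠ 0) {c u : G}
    (hc : c ^ 3 = 1) (hu : u * c * u⁻¹ = c⁻¹) {W : Submodule K V}
    (hW : LinearMap.range (omegaProj ω (ρ c)) ≤ W)
    (hW' : LinearMap.range (omegaProj ω (ρ c⁻¹)) ≤ W) :
    2 * Module.finrank K (LinearMap.range (omegaProj ω (ρ c))) ≤ Module.finrank K W := by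
  have hc' : c⁻¹ ^ 3 = 1 := by rw [inv_pow, hc, inv_one]
  have h1 := sum_finrank_range_le_of_orthogonal (W := W)
    (e := ![omegaProj ω (ρ c), omegaProj ω (ρ c⁻¹)])
    (by
      intro i
      fin_cases i
      · exact omegaProj_mul_self hω h3 (map_pow_three_eq_one ρ hc)
      · exact omegaProj_mul_self hω h3 (map_pow_three_eq_one ρ hc'))
    (by
      intro i j hij
      fin_cases i <;> fin_cases j
      · exact absurd rfl hij
      · exact omegaProj_mul_omegaProj hω (map_pow_three_eq_one ρ hc)
          (by rw [← map_mul, mul_inv_cancel, map_one])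
      · exact omegaProj_mul_omegaProj hω (map_pow_three_eq_one ρ hc')
          (by rw [← map_mul, inv_mul_cancel, map_one])
      · exact absurd rfl hij)
    (by
      intro i
      fin_cases i
      · exact hW
      · exact hW')
  have h2 := finrank_range_conj ρ u (omegaProj ω (ρ c))
  rw [conj_omegaProj, hu] at h2
  have h3 : Module.finrank K (LinearMap.range (omegaProj ω (ρ c))) +
      Module.finrank K (LinearMap.range (omegaProj ω (ρ c⁻¹))) ≤ Module.finrank K W := by
    rw [Fin.sum_univ_two] at h1
    exact h1
  lia

theorem four_mul_finrank_range_omegaProj_le (hω : ω ^ 2 + ω + 1 = 0) (h3 : (3 : K) ≠ 0)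
    {c d u : G} (hc : c ^ 3 = 1) (hcd : Commute c d) (huc : u * c * u⁻¹ = d)
    (hud : u * d * u⁻¹ = c⁻¹) :
    4 * Module.finrank K (LinearMap.range (omegaProj ω (ρ c) * omegaProj ω (ρ d))) ≤
      Module.finrank K V := by
  have huc' : u * c⁻¹ * u⁻¹ = d⁻¹ := by rw [← huc]; group
  have hud' : u * d⁻¹ * u⁻¹ = c := by rw [← inv_inv c, ← hud]; group
  have hd : d ^ 3 = 1 := by rw [← huc, conj_pow, hc, mul_one, mul_inv_cancel]
  have hcomm : Commute (ρ c) (ρ d) := hcd.map ρ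
  have hinv {x : G} (hx : x ^ 3 = 1) : x⁻¹ ^ 3 = 1 := by rw [inv_pow, hx, inv_one]
  let e : Bool × Bool → Module.End K V := fun i =>
    omegaProj ω (ρ (bif i.1 then c else c⁻¹)) * omegaProj ω (ρ (bif i.2 then d else d⁻¹))
  have hcomm (i j : Bool) : Commute (omegaProj ω (ρ (bif i then c else c⁻¹)))
      (omegaProj ω (ρ (bif j then d else d⁻¹))) := by
    refine Commute.omegaProj (Commute.map ?_ ρ)
    cases i <;> cases j
    exacts [hcd.inv_inv, hcd.inv_left, hcd.inv_right, hcd]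
  have hidem {x : G} (hx : x ^ 3 = 1) (i : Bool) :
      omegaProj ω (ρ (bif i then x else x⁻¹)) * omegaProj ω (ρ (bif i then x else x⁻¹)) =
        omegaProj ω (ρ (bif i then x else x⁻¹)) := by
    refine omegaProj_mul_self hω h3 (map_pow_three_eq_one ρ ?_)
    cases i
    exacts [hinv hx, hx]
  have horth {x : G} (hx : x ^ 3 = 1) (i j : Bool) (hij : i ≠ j) :
      omegaProj ω (ρ (bif i then x else x⁻¹)) * omegaProj ω (ρ (bif j then x else x⁻¹)) = 0 := by
    refine omegaProj_mul_omegaProj hω (map_pow_three_eq_one ρ ?_) ?_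
    · cases i
      exacts [hinv hx, hx]
    · rw [← map_mul]
      cases i <;> cases j <;> simp at hij ⊢
  have hmul (i j : Bool × Bool) : e i * e j =
      omegaProj ω (ρ (bif i.1 then c else c⁻¹)) * omegaProj ω (ρ (bif j.1 then c else c⁻¹)) *
      (omegaProj ω (ρ (bif i.2 then d else d⁻¹)) * omegaProj ω (ρ (bif j.2 then d else d⁻¹))) :=
    (hcomm j.1 i.2).symm.mul_mul_mul_comm _ _
  have hsum := sum_finrank_range_le_of_orthogonal (e := e) (W := ⊤)
    (fun i => by rw [hmul, hidem hc, hidem hd])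
    (fun i j hij => by
      rw [hmul]
      by_cases h : i.1 = j.1
      · rw [horth hd i.2 j.2 fun h' => hij (Prod.ext h h'), mul_zero]
      · rw [horth hc i.1 j.1 h, zero_mul])
    (fun _ => le_top)
  have hrank (i : Bool × Bool) (j : Bool × Bool) (h : ρ u * e i * ρ u⁻¹ = e j) :
      Module.finrank K (LinearMap.range (e j)) = Module.finrank K (LinearMap.range (e i)) := by
    rw [← h, finrank_range_conj]
  have h1 := hrank (true, true) (false, true) (by
    simp only [e, cond_true, cond_false]
    rw [conj_mul_end, conj_omegaProj, conj_omegaProj, huc, hud]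
    exact (hcomm false true).symm)
  have h2 := hrank (false, true) (false, false) (by
    simp only [e, cond_true, cond_false]
    rw [conj_mul_end, conj_omegaProj, conj_omegaProj, huc', hud]
    exact (hcomm false false).symm)
  have h3 := hrank (false, false) (true, false) (by
    simp only [e, cond_true, cond_false]
    rw [conj_mul_end, conj_omegaProj, conj_omegaProj, huc', hud']
    exact (hcomm true false).symm)
  rw [Fintype.sum_prod_type, Fintype.sum_bool, Fintype.sum_bool, Fintype.sum_bool,
    finrank_top] at hsum
  have h4 : e (true, true) = omegaProj ω (ρ c) * omegaProj ω (ρ d) := rfl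
  rw [← h4]
  lia

/-- If the joint `ω`-eigenspace of `c` and `d` meets that of a third element `t`, then it has
dimension at least `3`, provided that there are enough elements permuting `c`, `d`, `t`, `t⁻¹`. -/
theorem three_le_finrank_range_omegaProj_mul (hω : ω ^ 2 + ω + 1 = 0) (h3 : (3 : K) ≠ 0)
    {c d t g h r : G} (hc : c ^ 3 = 1) (hd : d ^ 3 = 1) (ht : t ^ 3 = 1) (hcd : Commute c d)
    (hct : Commute c t) (hdt : Commute d t) (hgc : g * c * g⁻¹ = d) (hgd : g * d * g⁻¹ = c)
    (hgt : g * t * g⁻¹ = t) (hhc : h * c * h⁻¹ = d) (hhd : h * d * h⁻¹ = c)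
    (hht : h * t * h⁻¹ = t⁻¹) (hgh : Commute g h) (hrc : r * c * r⁻¹ = c)
    (hrd : r * d * r⁻¹ = d) (hrg : r * g * r⁻¹ = h)
    (hne : omegaProj ω (ρ c) * omegaProj ω (ρ d) * omegaProj ω (ρ t) ≠ 0) :
    3 ≤ Module.finrank K (LinearMap.range (omegaProj ω (ρ c) * omegaProj ω (ρ d))) := by
  by_contra! hlt
  have ht' : t⁻¹ ^ 3 = 1 := by rw [inv_pow, ht, inv_one]
  obtain ⟨F, hF⟩ : ∃ F, F = omegaProj ω (ρ c) * omegaProj ω (ρ d) := ⟨_, rfl⟩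
  obtain ⟨P, hP⟩ : ∃ P, P = omegaProj ω (ρ t) := ⟨_, rfl⟩
  obtain ⟨Q, hQ⟩ : ∃ Q, Q = omegaProj ω (ρ t⁻¹) := ⟨_, rfl⟩
  rw [← hF] at hlt
  rw [← hF, ← hP] at hne
  have hcdP : Commute (omegaProj ω (ρ c)) (omegaProj ω (ρ d)) := (hcd.map ρ).omegaProj
  have hFF : F * F = F := by
    rw [hF, hcdP.symm.mul_mul_mul_comm, omegaProj_mul_self hω h3 (map_pow_three_eq_one ρ hc),
      omegaProj_mul_self hω h3 (map_pow_three_eq_one ρ hd)]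
  have hPP : P * P = P := hP ▸ omegaProj_mul_self hω h3 (map_pow_three_eq_one ρ ht)
  have hQQ : Q * Q = Q := hQ ▸ omegaProj_mul_self hω h3 (map_pow_three_eq_one ρ ht')
  have hPQ : P * Q = 0 := by
    rw [hP, hQ]
    exact omegaProj_mul_omegaProj hω (map_pow_three_eq_one ρ ht)
      (by rw [← map_mul, mul_inv_cancel, map_one])
  have hQP : Q * P = 0 := by
    rw [hP, hQ]
    exact omegaProj_mul_omegaProj hω (map_pow_three_eq_one ρ ht')
      (by rw [← map_mul, inv_mul_cancel, map_one])
  have hFP : Commute F P := by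
    rw [hF, hP]; exact ((hct.map ρ).omegaProj).mul_left ((hdt.map ρ).omegaProj)
  have hFQ : Commute F Q := by
    rw [hF, hQ]
    exact ((hct.inv_right.map ρ).omegaProj).mul_left ((hdt.inv_right.map ρ).omegaProj)
  have hgF : ρ g * F * ρ g⁻¹ = F := by
    rw [hF, conj_mul_end, conj_omegaProj, conj_omegaProj, hgc, hgd, hcdP.eq]
  have hhF : ρ h * F * ρ h⁻¹ = F := by
    rw [hF, conj_mul_end, conj_omegaProj, conj_omegaProj, hhc, hhd, hcdP.eq]
  have hrF : ρ r * F * ρ r⁻¹ = F := by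
    rw [hF, conj_mul_end, conj_omegaProj, conj_omegaProj, hrc, hrd]
  have hhP : ρ h * P * ρ h⁻¹ = Q := by rw [hP, hQ, conj_omegaProj, hht]
  have hgP : ρ g * P * ρ g⁻¹ = P := by rw [hP, conj_omegaProj, hgt]
  have hhE : ρ h * (F * P) * ρ h⁻¹ = F * Q := by rw [conj_mul_end, hhF, hhP]
  have hgE : ρ g * (F * P) * ρ g⁻¹ = F * P := by rw [conj_mul_end, hgF, hgP]
  have hEE : F * P * (F * P) = F * P := by rw [hFP.symm.mul_mul_mul_comm, hFF, hPP]
  have hrank : Module.finrank K (LinearMap.range (F * Q)) =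
      Module.finrank K (LinearMap.range (F * P)) := by rw [← hhE, finrank_range_conj]
  have hpos := finrank_range_pos hne
  have hFE : F * (F * P) = F * P := by rw [← mul_assoc, hFF]
  have hFE' : F * (F * Q) = F * Q := by rw [← mul_assoc, hFF]
  have hEF : F * P * F = F * P := by rw [mul_assoc, ← hFP.eq, hFE]
  have hEF' : F * Q * F = F * Q := by rw [mul_assoc, ← hFQ.eq, hFE']
  have hEE' : F * Q * (F * Q) = F * Q := by rw [hFQ.symm.mul_mul_mul_comm, hFF, hQQ]
  have h12 : F * P * (F * Q) = 0 := by rw [hFP.symm.mul_mul_mul_comm, hPQ, mul_zero]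
  have h21 : F * Q * (F * P) = 0 := by rw [hFQ.symm.mul_mul_mul_comm, hQP, mul_zero]
  obtain ⟨E, hE⟩ : ∃ E, E = F * P := ⟨_, rfl⟩
  obtain ⟨E', hE'⟩ : ∃ E', E' = F * Q := ⟨_, rfl⟩
  rw [← hE, ← hE'] at hhE hrank h12 h21
  rw [← hE] at hgE hEE hpos hFE hEF hne
  rw [← hE'] at hEE' hFE' hEF'
  have hle {X : Module.End K V} (hX : F * X = X) : LinearMap.range X ≤ LinearMap.range F := by
    rw [← hX]; exact LinearMap.range_comp_le_range X F
  have hsum := sum_finrank_range_le_of_orthogonal (e := ![E, E', F - E - E'])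
    (W := LinearMap.range F)
    (by
      intro i
      fin_cases i
      · exact hEE
      · exact hEE'
      · change (F - E - E') * (F - E - E') = F - E - E'
        simp only [sub_mul, mul_sub, hFF, hFE, hFE', hEF, hEF', hEE, hEE', h12, h21]
        abel)
    (by
      intro i j hij
      fin_cases i <;> fin_cases j <;>
        simp [sub_mul, mul_sub, hFE, hFE', hEF, hEF', hEE, hEE', h12, h21] at hij ⊢)
    (by
      intro i
      fin_cases i
      · exact hle hFE
      · exact hle hFE'
      · refine hle ?_
        change F * (F - E - E') = F - E - E'
        simp only [mul_sub, hFF, hFE, hFE'])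
  replace hsum : Module.finrank K (LinearMap.range E) + Module.finrank K (LinearMap.range E') +
      Module.finrank K (LinearMap.range (F - E - E')) ≤ Module.finrank K (LinearMap.range F) := by
    rw [Fin.sum_univ_three] at hsum
    exact hsum
  have hzero : F - E - E' = 0 := by
    by_contra h0
    have := finrank_range_pos h0
    lia
  have hFsum : F = E + E' := by rw [sub_sub, sub_eq_zero] at hzero; exact hzero
  obtain ⟨a, ha⟩ := exists_mul_eq_smul_of_finrank_range_eq_one (g := ρ g) hEE
    (by rw [mul_end_eq_conj_mul, hgE]) (by lia)
  have ha' : ρ g * E' = a • E' := by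
    rw [← hhE, ← mul_assoc, ← mul_assoc, ← map_mul, hgh.eq, map_mul, mul_assoc (ρ h), ha]
    simp only [mul_smul_comm, smul_mul_assoc]
  have hgF' : ρ g * F = a • F := by rw [hFsum, mul_add, ha, ha', smul_add]
  have hhF' : ρ h * F = a • F := by
    have h1 : ρ r * (ρ g * F) * ρ r⁻¹ = a • F := by
      rw [hgF', mul_smul_comm, smul_mul_assoc, hrF]
    have h2 : ρ r * ρ g * ρ r⁻¹ = ρ h := by rw [← map_mul, ← map_mul, hrg]
    rwa [conj_mul_end, h2, hrF] at h1
  have hhE2 : ρ h * E = a • E := by rw [← hFE, ← mul_assoc, hhF', smul_mul_assoc]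
  have h0 : E' * ρ h = 0 := by
    rw [mul_end_eq_conj_mul, hhE] at hhE2
    rw [← hEE', mul_assoc, hhE2, mul_smul_comm, h21, smul_zero]
  have h1 : E' = 0 := by
    have h2 : ρ h * ρ h⁻¹ = 1 := by rw [← map_mul, mul_inv_cancel, map_one]
    rw [← mul_one E', ← h2, ← mul_assoc, h0, zero_mul]
  rw [h1, LinearMap.range_zero, finrank_bot] at hrank
  lia

end OmegaProjRep

section AltMap

open Equiv

variable {α β γ : Type*} [Fintype α] [DecidableEq α] [Fintype β] [DecidableEq β] [Fintype γ]
  [DecidableEq γ]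

/-- The homomorphism of alternating groups induced by an embedding of the underlying sets. -/
noncomputable def altMap (x : β ↪ α) : alternatingGroup β →* alternatingGroup α :=
  ((Perm.viaEmbeddingHom x).comp (alternatingGroup β).subtype).codRestrict _ fun π => by
    have h := Equiv.Perm.mem_alternatingGroup.1 π.2
    rw [Equiv.Perm.mem_alternatingGroup]
    classical
    rw [← h]
    simp only [MonoidHom.comp_apply, Perm.viaEmbeddingHom_apply, Perm.viaEmbedding]
    convert Perm.sign_extendDomain _ _
    rfl

theorem altMap_apply (x : β ↪ α) (π : alternatingGroup β) (b : β) :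
    (altMap x π : Perm α) (x b) = x ((π : Perm β) b) :=
  Perm.viaEmbedding_apply _ x b

theorem altMap_apply_of_notMem (x : β ↪ α) (π : alternatingGroup β) {a : α} (h : ∀ b, x b ≠ a) :
    (altMap x π : Perm α) a = a :=
  Perm.viaEmbedding_apply_of_notMem _ x a (by simpa using h)

theorem alternatingGroup_ext {g h : alternatingGroup α}
    (hgh : ∀ a, (g : Perm α) a = (h : Perm α) a) : g = h :=
  Subtype.ext (Equiv.ext hgh)

theorem mul_altMap_mul_inv {x y : β ↪ α} {g : alternatingGroup α} {σ : Perm β}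
    (h : ∀ b, (g : Perm α) (x b) = y (σ b)) {π τ : alternatingGroup β}
    (hσ : σ * π = τ * σ) : g * altMap x π * g⁻¹ = altMap y τ := by
  rw [mul_inv_eq_iff_eq_mul]
  refine alternatingGroup_ext fun a => ?_
  simp only [Subgroup.coe_mul, Perm.mul_apply]
  by_cases ha : ∃ b, x b = a
  · obtain ⟨b, rfl⟩ := ha
    rw [altMap_apply, h, h, altMap_apply]
    exact congrArg y (DFunLike.congr_fun hσ b)
  · push Not at ha
    rw [altMap_apply_of_notMem x π ha, altMap_apply_of_notMem]
    intro b hb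
    refine ha (σ⁻¹ b) ((g : Perm α).injective ?_)
    rw [h, ← hb, Perm.coe_inv, apply_symm_apply]

theorem altMap_trans (x : γ ↪ β) (y : β ↪ α) (π : alternatingGroup γ) :
    altMap (x.trans y) π = altMap y (altMap x π) := by
  refine alternatingGroup_ext fun a => ?_
  by_cases ha : ∃ b, y b = a
  · obtain ⟨b, rfl⟩ := ha
    rw [altMap_apply]
    by_cases hb : ∃ c, x c = b
    · obtain ⟨c, rfl⟩ := hb
      rw [altMap_apply]
      exact altMap_apply (x.trans y) π c
    · push Not at hb
      rw [altMap_apply_of_notMem x π hb, altMap_apply_of_notMem]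
      intro c hc
      exact hb c (y.injective hc)
  · push Not at ha
    rw [altMap_apply_of_notMem y _ ha, altMap_apply_of_notMem]
    exact fun c => ha _

theorem altMap_commute {x : β ↪ α} {y : γ ↪ α} (h : ∀ b c, x b ≠ y c) (π : alternatingGroup β)
    (τ : alternatingGroup γ) : Commute (altMap x π) (altMap y τ) := by
  have h1 := mul_altMap_mul_inv (x := y) (y := y) (g := altMap x π) (σ := 1) (π := τ) (τ := τ)
    (fun c => altMap_apply_of_notMem x π fun b => h b c) (by simp)
  rwa [mul_inv_eq_iff_eq_mul] at h1

theorem not_commute_altMap {x y : β ↪ α} {π : alternatingGroup β} {b : β} (hxy : x b = y b)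
    (hb : (π : Perm β) b ≠ b) (h : ∀ c d, c ≠ b → x c ≠ y d) :
    ¬ Commute (altMap x π) (altMap y π) := by
  intro hc
  have hc := congrArg (fun g : alternatingGroup α => (g : Perm α) (x b)) hc.eq
  simp only [Subgroup.coe_mul, Perm.mul_apply] at hc
  rw [altMap_apply, hxy, altMap_apply, altMap_apply_of_notMem y] at hc
  · rw [altMap_apply_of_notMem] at hc
    · exact h _ _ hb hc.symm
    · intro d hd
      by_cases hdb : d = b
      · rw [hdb, hxy] at hd
        exact hb (y.injective hd).symm
      · exact h _ _ hdb hd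
  · exact fun d hd => h _ d hb hd.symm

end AltMap

theorem exists_embedding_map_eq {α : Type*} {b : ℕ} {T : Finset α} (hT : T.card = b) :
    ∃ x : Fin b ↪ α, Finset.univ.map x = T := by
  refine ⟨(T.equivFinOfCardEq hT).symm.toEmbedding.trans (Function.Embedding.subtype _), ?_⟩
  ext a
  simp only [Finset.mem_map, Finset.mem_univ, true_and]
  constructor
  · rintro ⟨i, rfl⟩
    exact Subtype.prop _
  · intro ha
    exact ⟨T.equivFinOfCardEq hT ⟨a, ha⟩, by simp⟩

theorem exists_embedding_cons {α : Type*} [DecidableEq α] {k : ℕ} {A : Finset α} {a : α}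
    (hA : A.card + 1 = k + 1)
    (ha : a ∉ A) : ∃ x : Fin (k + 1) ↪ α, Finset.univ.map x = insert a A ∧ x 0 = a ∧
      ∀ c, c ≠ 0 → x c ∈ A := by
  obtain ⟨e, he⟩ := exists_embedding_map_eq (b := k) (T := A) (by lia)
  have hmem (i : Fin k) : e i ∈ A := by rw [← he]; exact Finset.mem_map_of_mem _ (Finset.mem_univ _)
  refine ⟨⟨Fin.cons a e, Fin.cons_injective_iff.2 ⟨?_, e.injective⟩⟩, ?_, rfl, ?_⟩
  · rintro ⟨i, hi⟩
    exact ha (hi ▸ hmem i)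
  · apply Finset.coe_injective
    have hA' : (A : Set α) = Set.range e := by
      rw [← he, Finset.coe_map, Finset.coe_univ, Set.image_univ]
    rw [Finset.coe_map, Finset.coe_univ, Set.image_univ, Finset.coe_insert, hA']
    exact Fin.range_cons _ _
  · intro c hc
    obtain ⟨i, rfl⟩ := Fin.exists_succ_eq.2 hc
    exact hmem i

section Dichotomy

variable {K V α : Type*} [Field K] [AddCommGroup V] [Module K V] [Fintype α] [DecidableEq α]

theorem alternatingGroup_injective_of_ne_one {M : Type*} [Monoid M] (hα : 5 ≤ Fintype.card α)
    (ρ : alternatingGroup α →* M) {g : alternatingGroup α} (hg : ρ g ≠ 1) :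
    Function.Injective ρ := by
  have := alternatingGroup.isSimpleGroup (α := α) (by rwa [Nat.card_eq_fintype_card])
  rw [injective_iff_map_eq_one]
  intro a ha
  have h := (MonoidHom.normal_ker ρ).eq_bot_or_eq_top
  rcases h with h | h
  · rw [← Subgroup.mem_bot, ← h]
    exact ha
  · exact absurd (h ▸ Subgroup.mem_top g : g ∈ ρ.ker) hg

theorem commute_of_sub_one_mul {R : Type*} [Ring R] {X Y p q : R} (hX : (X - 1) * p = X - 1)
    (hX' : p * (X - 1) = X - 1) (hY : (Y - 1) * q = Y - 1) (hY' : q * (Y - 1) = Y - 1)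
    (hpq : p * q = 0) (hqp : q * p = 0) : Commute X Y := by
  have h1 : (X - 1) * (Y - 1) = 0 := by
    rw [← hX, ← hY', mul_assoc, ← mul_assoc p, hpq, zero_mul, mul_zero]
  have h2 : (Y - 1) * (X - 1) = 0 := by
    rw [← hY, ← hX', mul_assoc, ← mul_assoc q, hqp, zero_mul, mul_zero]
  have h3 : X * Y - Y * X = (X - 1) * (Y - 1) - (Y - 1) * (X - 1) := by noncomm_ring
  rw [h1, h2, sub_zero, sub_eq_zero] at h3
  exact h3

theorem card_le_finrank_add_two_or_exists_mul_ne_zero [FiniteDimensional K V] {k : ℕ}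
    (hcard : 2 * (k + 1) ≤ Fintype.card α) {ρ : alternatingGroup α →* Module.End K V}
    (hρ : Function.Injective ρ) {τ : alternatingGroup (Fin (k + 1))}
    (hτ : (τ : Equiv.Perm (Fin (k + 1))) 0 ≠ 0) (p : (Fin (k + 1) ↪ α) → Module.End K V)
    (hl : ∀ x, (ρ (altMap x τ) - 1) * p x = ρ (altMap x τ) - 1)
    (hr : ∀ x, p x * (ρ (altMap x τ) - 1) = ρ (altMap x τ) - 1)
    (hrank : ∀ x, k ≤ Module.finrank K (LinearMap.range (p x)))
    (hswap : ∀ x y : Fin (k + 1) ↪ α, x 0 = y 0 → (∀ c d, c ≠ 0 → x c ≠ y d) →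
      ∃ g, ρ g * p x * ρ g⁻¹ = p y ∧ ρ g * p y * ρ g⁻¹ = p x) :
    Fintype.card α ≤ Module.finrank K V + 2 ∨ ∃ x y, (∀ c d, x c ≠ y d) ∧ p x * p y ≠ 0 := by
  refine or_iff_not_imp_right.2 fun hne => ?_
  push Not at hne
  refine card_le_finrank_add_two_of_blocks (b := k + 1) (by lia) hcard
    (fun x : Fin (k + 1) ↪ α => Finset.univ.map x) p
    (fun T hT => exists_embedding_map_eq hT) ?_ ?_ (fun x => Nat.add_le_add_right (hrank x) 1)
  · intro x y hxy
    refine hne x y fun c d hcd => Finset.disjoint_left.1 hxy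
      (Finset.mem_map_of_mem x (Finset.mem_univ c)) ?_
    rw [hcd]
    exact Finset.mem_map_of_mem y (Finset.mem_univ d)
  · intro A B a hA hB hAB haA haB
    obtain ⟨x, hx, hx0, hxA⟩ := exists_embedding_cons hA haA
    obtain ⟨y, hy, hy0, hyB⟩ := exists_embedding_cons hB haB
    have hxy : ∀ c d, c ≠ 0 → x c ≠ y d := by
      intro c d hc hcd
      by_cases hd : d = 0
      · rw [hd, hy0, ← hx0] at hcd
        exact hc (x.injective hcd)
      · exact Finset.disjoint_left.1 hAB (hxA c hc) (hcd ▸ hyB d hd)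
    refine ⟨x, y, hx, hy, fun h0 => ?_⟩
    obtain ⟨g, hg, hg'⟩ := hswap x y (hx0.trans hy0.symm) hxy
    have h0' : p y * p x = 0 := by
      rw [← hg, ← hg', ← conj_mul_end, hg', h0, mul_zero, zero_mul]
    refine not_commute_altMap (hx0.trans hy0.symm) hτ hxy ?_
    refine hρ ?_
    rw [map_mul, map_mul]
    exact (commute_of_sub_one_mul (hl x) (hr x) (hl y) (hr y) h0 h0').eq

end Dichotomy

section ThreeCycle

open Equiv

/-- The cycle `0 ↦ 1 ↦ 2 ↦ 0`. -/
def finThreeCycle : alternatingGroup (Fin 3) :=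
  ⟨swap 0 1 * swap 1 2, Perm.mem_alternatingGroup.2 (by decide)⟩

theorem exists_pair_notMem {α : Type*} [Fintype α] [DecidableEq α] {T : Finset α}
    (hT : T.card + 2 ≤ Fintype.card α) : ∃ a b, a ∉ T ∧ b ∉ T ∧ a ≠ b := by
  obtain ⟨a, ha, b, hb, hab⟩ := Finset.one_lt_card.1
    (show 1 < Tᶜ.card by rw [Finset.card_compl]; lia)
  exact ⟨a, b, Finset.mem_compl.1 ha, Finset.mem_compl.1 hb, hab⟩

variable {α : Type*} [Fintype α] [DecidableEq α]

theorem altMap_finThreeCycle_pow (x : Fin 3 ↪ α) : altMap x finThreeCycle ^ 3 = 1 := by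
  rw [← map_pow, show finThreeCycle ^ 3 = 1 by decide, map_one]

theorem conj_altMap_finThreeCycle {x y : Fin 3 ↪ α} {g : alternatingGroup α}
    (h : ∀ b, (g : Perm α) (x b) = y b) :
    g * altMap x finThreeCycle * g⁻¹ = altMap y finThreeCycle :=
  mul_altMap_mul_inv (σ := 1) h (by simp)

theorem conj_altMap_finThreeCycle_eq_inv {x y : Fin 3 ↪ α} {g : alternatingGroup α}
    (h : ∀ b, (g : Perm α) (x b) = y (swap 0 1 b)) :
    g * altMap x finThreeCycle * g⁻¹ = (altMap y finThreeCycle)⁻¹ := by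
  rw [← map_inv]
  exact mul_altMap_mul_inv (σ := swap 0 1) h (by decide)

theorem altMap_finThreeCycle_inv (x : Fin 3 ↪ α) : (altMap x finThreeCycle)⁻¹ =
    altMap ((swap 0 1 : Perm (Fin 3)).toEmbedding.trans x) finThreeCycle := by
  have h := conj_altMap_finThreeCycle_eq_inv (g := 1)
    (x := (swap 0 1 : Perm (Fin 3)).toEmbedding.trans x) (y := x) (fun b => rfl)
  rw [← h, one_mul, inv_one, mul_one]

theorem exists_conj_altMap_finThreeCycle_eq_inv (hα : 5 ≤ Fintype.card α) (x : Fin 3 ↪ α) :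
    ∃ u, u * altMap x finThreeCycle * u⁻¹ = (altMap x finThreeCycle)⁻¹ := by
  obtain ⟨a, b, ha, hb, hab⟩ := exists_pair_notMem (T := Finset.univ.map x)
    (by rw [Finset.card_map, Finset.card_univ, Fintype.card_fin]; exact hα)
  have ha : ∀ c, x c ≠ a := by simpa using ha
  have hb : ∀ c, x c ≠ b := by simpa using hb
  refine ⟨⟨swap (x 0) (x 1) * swap a b, ?_⟩, conj_altMap_finThreeCycle_eq_inv fun c => ?_⟩
  · simp [Perm.mem_alternatingGroup, Perm.sign_swap hab]
  · simp [swap_apply_of_ne_of_ne (ha c) (hb c), x.injective.map_swap]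

theorem exists_conj_altMap_finThreeCycle_swap {x y : Fin 3 ↪ α} (h0 : x 0 = y 0)
    (h : ∀ c d, c ≠ 0 → x c ≠ y d) :
    ∃ g, g * altMap x finThreeCycle * g⁻¹ = altMap y finThreeCycle ∧
      g * altMap y finThreeCycle * g⁻¹ = altMap x finThreeCycle := by
  have h' (d c) (hc : c ≠ 0) : y d ≠ x c := (h c d hc).symm
  refine ⟨⟨swap (x 1) (y 1) * swap (x 2) (y 2), ?_⟩, conj_altMap_finThreeCycle fun c => ?_,
    conj_altMap_finThreeCycle fun c => ?_⟩
  · simp [Perm.mem_alternatingGroup, Perm.sign_swap (h _ _ _)]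
  · fin_cases c <;> simp [swap_apply_def, h, h', h0]
  · fin_cases c <;> simp [swap_apply_def, h, h', h0]

theorem exists_conj_altMap_finThreeCycle_rotate {x y : Fin 3 ↪ α} (h : ∀ c d, x c ≠ y d) :
    ∃ g, g * altMap y finThreeCycle * g⁻¹ = altMap x finThreeCycle ∧
      g * altMap x finThreeCycle * g⁻¹ = (altMap y finThreeCycle)⁻¹ := by
  have h' (d c) : y d ≠ x c := (h c d).symm
  refine ⟨⟨swap (x 0) (y 0) * swap (x 1) (y 1) * swap (x 2) (y 2) * swap (x 0) (x 1), ?_⟩,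
    conj_altMap_finThreeCycle fun c => ?_, conj_altMap_finThreeCycle_eq_inv fun c => ?_⟩
  · simp [Perm.mem_alternatingGroup, Perm.sign_swap (h _ _)]
  · fin_cases c <;> simp [swap_apply_def, h, h']
  · fin_cases c <;> simp [swap_apply_def, h, h']

end ThreeCycle

section ThreeCycleRep

open Equiv

variable {K V α : Type*} [Field K] [AddCommGroup V] [Module K V] [FiniteDimensional K V]
  [Fintype α] [DecidableEq α] {ω : K} {ρ : alternatingGroup α →* Module.End K V}

/-- The projection onto the `ω`-eigenspace of the `3`-cycle with support the image of `x`. -/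
noncomputable def cycleProj (ω : K) (ρ : alternatingGroup α →* Module.End K V) (x : Fin 3 ↪ α) :
    Module.End K V :=
  omegaProj ω (ρ (altMap x finThreeCycle))

theorem two_mul_finrank_range_cycleProj_le (hω : ω ^ 2 + ω + 1 = 0) (h3 : (3 : K) ≠ 0)
    (hα : 5 ≤ Fintype.card α) (x : Fin 3 ↪ α) :
    2 * Module.finrank K (LinearMap.range (cycleProj ω ρ x)) ≤ Module.finrank K V := by
  obtain ⟨u, hu⟩ := exists_conj_altMap_finThreeCycle_eq_inv hα x
  have h := two_mul_finrank_range_omegaProj_le ρ hω h3 (altMap_finThreeCycle_pow x) hu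
    (W := ⊤) le_top le_top
  rwa [finrank_top] at h

theorem four_mul_finrank_range_cycleProj_mul_le (hω : ω ^ 2 + ω + 1 = 0) (h3 : (3 : K) ≠ 0)
    {x y : Fin 3 ↪ α} (hxy : ∀ c d, x c ≠ y d) :
    4 * Module.finrank K (LinearMap.range (cycleProj ω ρ x * cycleProj ω ρ y)) ≤
      Module.finrank K V := by
  obtain ⟨u, hu, hu'⟩ := exists_conj_altMap_finThreeCycle_rotate fun c d => (hxy d c).symm
  exact four_mul_finrank_range_omegaProj_le ρ hω h3 (altMap_finThreeCycle_pow x)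
    (altMap_commute hxy _ _) hu hu'

theorem card_le_or_exists_cycleProj_mul_ne_zero (hω : ω ^ 2 + ω + 1 = 0) (h3 : (3 : K) ≠ 0)
    (hα : 6 ≤ Fintype.card α) (hρ : Function.Injective ρ) :
    Fintype.card α ≤ Module.finrank K V + 2 ∨
      ∃ x y : Fin 3 ↪ α, (∀ c d, x c ≠ y d) ∧ cycleProj ω ρ x * cycleProj ω ρ y ≠ 0 := by
  let c (x : Fin 3 ↪ α) := altMap x finThreeCycle
  let p (x : Fin 3 ↪ α) := omegaProj ω (ρ (c x)) + omegaProj ω (ρ (c x)⁻¹)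
  have hc (x) : c x ^ 3 = 1 := altMap_finThreeCycle_pow x
  have hc' (x) : (c x)⁻¹ ^ 3 = 1 := by rw [inv_pow, hc, inv_one]
  have hcc (x) : ρ (c x) * ρ (c x)⁻¹ = 1 := by rw [← map_mul, mul_inv_cancel, map_one]
  have hcc' (x) : ρ (c x)⁻¹ * ρ (c x) = 1 := by rw [← map_mul, inv_mul_cancel, map_one]
  have hl (x) : (ρ (c x) - 1) * p x = ρ (c x) - 1 :=
    sub_one_mul_omegaProj_add hω h3 (map_pow_three_eq_one ρ (hc x)) (hcc x)
  have hcomm (x) : Commute (p x) (ρ (c x) - 1) := by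
    refine Commute.sub_right ?_ (Commute.one_right _)
    have key {A B : Module.End K V} (h : Commute A B) : Commute (omegaProj ω A) B :=
      ((((Commute.one_left B).add_left (h.smul_left _)).add_left
        ((h.pow_left 2).smul_left _)).smul_left _)
    exact (key (Commute.refl _)).add_left (key ((hcc' x).trans (hcc x).symm))
  refine (card_le_finrank_add_two_or_exists_mul_ne_zero (k := 2) hα hρ (τ := finThreeCycle)
    (by decide) p hl (fun x => (hcomm x).eq.trans (hl x)) (fun x => ?_)
    (fun x y h0 hxy => ?_)).imp_right ?_
  · obtain ⟨u, hu⟩ := exists_conj_altMap_finThreeCycle_eq_inv (by lia) x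
    have h12 := omegaProj_mul_omegaProj hω (map_pow_three_eq_one ρ (hc x)) (hcc x)
    have h21 := omegaProj_mul_omegaProj hω (map_pow_three_eq_one ρ (hc' x)) (hcc' x)
    have h := two_mul_finrank_range_omegaProj_le ρ hω h3 (hc x) hu
      (W := LinearMap.range (p x)) ?_ ?_
    · refine le_trans ?_ h
      have := finrank_range_pos (e := omegaProj ω (ρ (c x))) (K := K) ?_
      · lia
      · intro h0
        have h1 : omegaProj ω (ρ (c x)⁻¹) = 0 := by
          rw [← hu, ← conj_omegaProj, h0, mul_zero, zero_mul]
        have h2 := hl x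
        rw [show p x = 0 by simp only [p]; rw [h0, h1, add_zero], mul_zero, eq_comm, sub_eq_zero,
          ← map_one ρ] at h2
        have h3 : c x = 1 := hρ h2
        have h4 := altMap_apply x finThreeCycle 0
        change ((c x : alternatingGroup α) : Perm α) _ = _ at h4
        rw [h3] at h4
        exact absurd (x.injective h4) (by decide)
    · rintro _ ⟨v, rfl⟩
      refine ⟨omegaProj ω (ρ (c x)) v, ?_⟩
      rw [← Module.End.mul_apply, add_mul, h21, add_zero,
        omegaProj_mul_self hω h3 (map_pow_three_eq_one ρ (hc x))]
    · rintro _ ⟨v, rfl⟩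
      refine ⟨omegaProj ω (ρ (c x)⁻¹) v, ?_⟩
      rw [← Module.End.mul_apply, add_mul, h12, zero_add,
        omegaProj_mul_self hω h3 (map_pow_three_eq_one ρ (hc' x))]
  · obtain ⟨g, hg, hg'⟩ := exists_conj_altMap_finThreeCycle_swap h0 hxy
    have hinv {a b : alternatingGroup α} (h : g * a * g⁻¹ = b) : g * a⁻¹ * g⁻¹ = b⁻¹ := by
      rw [← h, conj_inv]
    have key {a b : alternatingGroup α} (h : g * a * g⁻¹ = b) :
        ρ g * (omegaProj ω (ρ a) + omegaProj ω (ρ a⁻¹)) * ρ g⁻¹ =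
          omegaProj ω (ρ b) + omegaProj ω (ρ b⁻¹) := by
      rw [mul_add, add_mul, conj_omegaProj, conj_omegaProj, h, hinv h]
    exact ⟨g, key hg, key hg'⟩
  · rintro ⟨x, y, hxy, hne⟩
    by_contra! h
    refine hne ?_
    have hp (x) : p x = cycleProj ω ρ x +
        cycleProj ω ρ ((swap 0 1 : Perm (Fin 3)).toEmbedding.trans x) := by
      simp only [p, c, cycleProj, altMap_finThreeCycle_inv]
    have h' (σ τ : Perm (Fin 3)) :
        cycleProj ω ρ (σ.toEmbedding.trans x) * cycleProj ω ρ (τ.toEmbedding.trans y) = 0 :=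
      h _ _ fun c d => hxy _ _
    rw [hp, hp, add_mul, mul_add, mul_add, h']
    erw [h' 1 1, h' 1, h' _ 1]
    simp

theorem twelve_le_finrank_of_cycleProj_mul_ne_zero (hω : ω ^ 2 + ω + 1 = 0) (h3 : (3 : K) ≠ 0)
    (hα : 11 ≤ Fintype.card α) {x y z : Fin 3 ↪ α} (hxy : ∀ c d, x c ≠ y d)
    (hxz : ∀ c d, x c ≠ z d) (hyz : ∀ c d, y c ≠ z d)
    (hne : cycleProj ω ρ x * cycleProj ω ρ y * cycleProj ω ρ z ≠ 0) :
    12 ≤ Module.finrank K V := by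
  obtain ⟨a, b, ha, hb, hab⟩ := exists_pair_notMem
    (T := Finset.univ.map x ∪ (Finset.univ.map y ∪ Finset.univ.map z)) (by
      refine le_trans (Nat.add_le_add_right ((Finset.card_union_le _ _).trans
        (Nat.add_le_add_left (Finset.card_union_le _ _) _)) 2) ?_
      simpa using hα)
  simp only [Finset.mem_union, Finset.mem_map, Finset.mem_univ, true_and, not_or, not_exists]
    at ha hb
  let w : (Fin 3 ⊕ Fin 3) ⊕ Fin 3 ⊕ Fin 2 ↪ α :=
    ⟨Sum.elim (Sum.elim x y) (Sum.elim z ![a, b]), by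
      refine (x.injective.sumElim y.injective hxy).sumElim (z.injective.sumElim ?_ ?_) ?_
      · intro i j hij
        fin_cases i <;> fin_cases j <;> simp_all
      · intro i j
        fin_cases j
        exacts [ha.2.2 i, hb.2.2 i]
      · rintro (i | i) (j | j)
        · exact hxz i j
        · fin_cases j
          exacts [ha.1 i, hb.1 i]
        · exact hyz i j
        · fin_cases j
          exacts [ha.2.1 i, hb.2.1 i]⟩
  let s : Perm ((Fin 3 ⊕ Fin 3) ⊕ Fin 3 ⊕ Fin 2) := (sumComm (Fin 3) (Fin 3)).sumCongr 1
  let g : alternatingGroup ((Fin 3 ⊕ Fin 3) ⊕ Fin 3 ⊕ Fin 2) :=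
    ⟨s * swap (.inr (.inr 0)) (.inr (.inr 1)), Perm.mem_alternatingGroup.2 (by decide)⟩
  let h : alternatingGroup ((Fin 3 ⊕ Fin 3) ⊕ Fin 3 ⊕ Fin 2) :=
    ⟨s * swap (.inr (.inl 0)) (.inr (.inl 1)), Perm.mem_alternatingGroup.2 (by decide)⟩
  let r : alternatingGroup ((Fin 3 ⊕ Fin 3) ⊕ Fin 3 ⊕ Fin 2) :=
    ⟨swap (.inr (.inl 0)) (.inr (.inr 0)) * swap (.inr (.inl 1)) (.inr (.inr 1)),
      Perm.mem_alternatingGroup.2 (by decide)⟩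
  have hw (π : alternatingGroup ((Fin 3 ⊕ Fin 3) ⊕ Fin 3 ⊕ Fin 2)) (i j)
      (hij : (π : Perm _) i = j) : (altMap w π : Perm α) (w i) = w j := by
    rw [altMap_apply, hij]
  have h12 := three_le_finrank_range_omegaProj_mul ρ hω h3 (g := altMap w g) (h := altMap w h)
    (r := altMap w r) (altMap_finThreeCycle_pow x) (altMap_finThreeCycle_pow y)
    (altMap_finThreeCycle_pow z) (altMap_commute hxy _ _) (altMap_commute hxz _ _)
    (altMap_commute hyz _ _)
    (conj_altMap_finThreeCycle fun c => hw g (.inl (.inl c)) (.inl (.inr c))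
      (by decide +revert))
    (conj_altMap_finThreeCycle fun c => hw g (.inl (.inr c)) (.inl (.inl c))
      (by decide +revert))
    (conj_altMap_finThreeCycle fun c => hw g (.inr (.inl c)) (.inr (.inl c))
      (by decide +revert))
    (conj_altMap_finThreeCycle fun c => hw h (.inl (.inl c)) (.inl (.inr c))
      (by decide +revert))
    (conj_altMap_finThreeCycle fun c => hw h (.inl (.inr c)) (.inl (.inl c))
      (by decide +revert))
    (conj_altMap_finThreeCycle_eq_inv fun c =>
      hw h (.inr (.inl c)) (.inr (.inl (swap 0 1 c))) (by decide +revert))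
    (Commute.map (show g * h = h * g by decide) (altMap w))
    (conj_altMap_finThreeCycle fun c => hw r (.inl (.inl c)) (.inl (.inl c))
      (by decide +revert))
    (conj_altMap_finThreeCycle fun c => hw r (.inl (.inr c)) (.inl (.inr c))
      (by decide +revert))
    (by rw [← map_inv, ← map_mul, ← map_mul, show r * g * r⁻¹ = h by decide]) hne
  have h4 := four_mul_finrank_range_cycleProj_mul_le (ρ := ρ) hω h3 hxy
  exact (Nat.mul_le_mul_left 4 h12).trans h4

end ThreeCycleRep

section Restriction

universe u

theorem exists_monoidHom_range {K V H : Type*} [Field K] [AddCommGroup V] [Module K V] [Group H]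
    (σ : H →* Module.End K V) {e : Module.End K V} (h : ∀ g, Commute e (σ g)) :
    ∃ σ' : H →* Module.End K (LinearMap.range e), ∀ g v, (σ' g v : V) = σ g v := by
  have hmem (g : H) : ∀ v ∈ LinearMap.range e, σ g v ∈ LinearMap.range e := by
    rintro _ ⟨v, rfl⟩
    exact ⟨σ g v, LinearMap.congr_fun (h g).eq v⟩
  refine ⟨{ toFun := fun g => (σ g).restrict (hmem g), map_one' := ?_, map_mul' := ?_ }, ?_⟩
  · ext v; simp
  · intro a b; ext v; simp
  · intro g v; rfl

theorem exists_embedding_compl {α : Type u} [Fintype α] [DecidableEq α] {k : ℕ} (x : Fin k ↪ α) :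
    ∃ (β : Type u) (_ : Fintype β) (_ : DecidableEq β) (j : β ↪ α),
      Fintype.card β + k = Fintype.card α ∧ (∀ c d, x c ≠ j d) ∧
      ∀ y : Fin k ↪ α, (∀ c d, x c ≠ y d) → ∃ y' : Fin k ↪ β, y'.trans j = y := by
  refine ⟨((Finset.univ.map x)ᶜ : Finset α), inferInstance, inferInstance,
    Function.Embedding.subtype _, ?_, ?_, ?_⟩
  · have h := Finset.card_le_univ (Finset.univ.map x)
    rw [Finset.card_map, Finset.card_univ, Fintype.card_fin] at h
    rw [Fintype.card_coe, Finset.card_compl, Finset.card_map, Finset.card_univ, Fintype.card_fin]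
    lia
  · rintro c ⟨d, hd⟩ rfl
    exact Finset.mem_compl.1 hd (Finset.mem_map_of_mem x (Finset.mem_univ c))
  · intro y hxy
    exact ⟨⟨fun d => ⟨y d, by simpa using fun c => hxy c d⟩, fun c d hcd =>
      y.injective (congrArg Subtype.val hcd)⟩, rfl⟩

end Restriction

section ThreeCycleBound

universe u v

variable {K : Type*} [Field K] {ω : K}

theorem coe_omegaProj_apply {V : Type*} [AddCommGroup V] [Module K V] {W : Submodule K V}
    {A : Module.End K W} {B : Module.End K V} (h : ∀ v, (A v : V) = B v) (v : W) :
    (omegaProj ω A v : V) = omegaProj ω B v := by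
  simp [omegaProj, pow_two, h]

theorem injective_of_cycleProj_ne_zero {α V : Type*} [Fintype α] [DecidableEq α] [AddCommGroup V]
    [Module K V] (hω : ω ^ 2 + ω + 1 = 0) (hα : 5 ≤ Fintype.card α)
    {ρ : alternatingGroup α →* Module.End K V} {x : Fin 3 ↪ α} (hx : cycleProj ω ρ x ≠ 0) :
    Function.Injective ρ :=
  alternatingGroup_injective_of_ne_one hα ρ (g := altMap x finThreeCycle) fun h =>
    hx (by rw [cycleProj, h, omegaProj_one hω])

/-- The `ω`-eigenspace of a `3`-cycle, as a representation of the alternating group on the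
complement of its support. -/
theorem exists_rep_range_cycleProj {α : Type u} {V : Type v} [Fintype α] [DecidableEq α]
    [AddCommGroup V] [Module K V] (ρ : alternatingGroup α →* Module.End K V) (x : Fin 3 ↪ α) :
    ∃ (β : Type u) (_ : Fintype β) (_ : DecidableEq β) (j : β ↪ α)
      (σ : alternatingGroup β →* Module.End K (LinearMap.range (cycleProj ω ρ x))),
      Fintype.card β + 3 = Fintype.card α ∧ (∀ c d, x c ≠ j d) ∧
      (∀ y : Fin 3 ↪ α, (∀ c d, x c ≠ y d) → ∃ y' : Fin 3 ↪ β, y'.trans j = y) ∧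
      ∀ y' v, (cycleProj ω σ y' v : V) = cycleProj ω ρ (y'.trans j) v := by
  obtain ⟨β, _, _, j, hβ, hj, hy⟩ := exists_embedding_compl x
  obtain ⟨σ, hσ⟩ := exists_monoidHom_range (ρ.comp (altMap j)) (e := cycleProj ω ρ x) (by
    intro g
    have h := (altMap_commute hj finThreeCycle g).map ρ
    exact (((Commute.one_left _).add_left (h.smul_left _)).add_left
      ((h.pow_left 2).smul_left _)).smul_left _)
  refine ⟨β, _, _, j, σ, hβ, hj, hy, fun y' v => ?_⟩
  refine coe_omegaProj_apply (fun v => ?_) v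
  rw [hσ, altMap_trans]
  rfl

theorem finrank_bound_of_cycleProj_ne_zero (hω : ω ^ 2 + ω + 1 = 0) (h3 : (3 : K) ≠ 0) (n : ℕ) :
    ∀ {α : Type u} {V : Type v} [Fintype α] [DecidableEq α] [AddCommGroup V] [Module K V]
      [FiniteDimensional K V] (ρ : alternatingGroup α →* Module.End K V) (x : Fin 3 ↪ α),
      Fintype.card α = n → 6 ≤ n → cycleProj ω ρ x ≠ 0 →
      4 ≤ Module.finrank K V ∧ (9 ≤ n → n ≤ Module.finrank K V + 2) := by
  induction n using Nat.strong_induction_on with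
  | _ n ih =>
  intro α V _ _ _ _ _ ρ x hα hn hx
  have hρ := injective_of_cycleProj_ne_zero hω (by lia) hx
  obtain h | ⟨y, x, hyx, hne⟩ := card_le_or_exists_cycleProj_mul_ne_zero hω h3 (by lia) hρ
  · lia
  have h4 := four_mul_finrank_range_cycleProj_mul_le (ρ := ρ) hω h3 hyx
  have hpos := finrank_range_pos hne
  refine ⟨by lia, fun hn9 => ?_⟩
  have h2 := two_mul_finrank_range_cycleProj_le (ρ := ρ) hω h3 (by lia) x
  obtain ⟨β, _, _, j, σ, hβ, hj, hlift, hσ⟩ := exists_rep_range_cycleProj (ω := ω) ρ x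
  obtain ⟨y', hy'⟩ := hlift y fun c d => (hyx d c).symm
  have hy0 : cycleProj ω σ y' ≠ 0 := by
    intro h0
    refine hne (LinearMap.ext fun v => ?_)
    have h := hσ y' ⟨_, LinearMap.mem_range_self _ v⟩
    rw [h0, hy'] at h
    exact h.symm
  have hrec := ih (n - 3) (by lia) σ y' (by lia) (by lia) hy0
  by_cases h11 : n = 11
  · obtain h | ⟨y, z, hyz, hne⟩ := card_le_or_exists_cycleProj_mul_ne_zero (ρ := σ) hω h3 (by lia)
      (injective_of_cycleProj_ne_zero hω (by lia) hy0)
    · lia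
    · have h12 := twelve_le_finrank_of_cycleProj_mul_ne_zero (ρ := ρ) hω h3 (by lia)
        (x := y.trans j) (y := z.trans j) (z := x)
        (fun c d h => hyz c d (j.injective h)) (fun c d => (hj d _).symm)
        (fun c d => (hj d _).symm) (fun h0 => hne (LinearMap.ext fun v => Subtype.ext ?_))
      · lia
      · obtain ⟨v, u, rfl⟩ := v
        rw [Module.End.mul_apply, hσ, hσ]
        exact LinearMap.congr_fun h0 u
  · lia

end ThreeCycleBound

section Klein

variable {K R : Type*} [Field K] [Ring R] [Algebra K R]

/-- For commuting involutions `A` and `B`, the projection onto the common eigenspace of `A` and `B`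
with eigenvalues `1` and `-1`. -/
def kleinProj (K : Type*) {R : Type*} [Field K] [Ring R] [Algebra K R] (A B : R) : R :=
  (2⁻¹ : K) • (1 + A) * (2⁻¹ : K) • (1 - B)

theorem half_one_add_mul_self (h2 : (2 : K) ≠ 0) {A : R} (hA : A * A = 1) :
    (2⁻¹ : K) • (1 + A) * (2⁻¹ : K) • (1 + A) = (2⁻¹ : K) • (1 + A) := by
  have h : (2⁻¹ : K) * 2 = 1 := inv_mul_cancel₀ h2
  simp only [smul_mul_assoc, mul_smul_comm, mul_add, add_mul, mul_one, one_mul, hA]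
  linear_combination (norm := module) (h * (2⁻¹ : K)) • (1 + A)

theorem half_one_sub_mul_half_one_add {A : R} (hA : A * A = 1) :
    (2⁻¹ : K) • (1 - A) * (2⁻¹ : K) • (1 + A) = 0 := by
  simp only [smul_mul_assoc, mul_smul_comm, mul_add, sub_mul, mul_one, one_mul, hA]
  module

theorem Commute.half_one_add_half_one_sub {A B : R} (h : Commute A B) :
    Commute ((2⁻¹ : K) • (1 + A)) ((2⁻¹ : K) • (1 - B)) :=
  ((((Commute.one_left _).add_left ((Commute.one_right A).sub_right h))).smul_left _).smul_right _

theorem kleinProj_mul_self (h2 : (2 : K) ≠ 0) {A B : R} (hA : A * A = 1) (hB : B * B = 1)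
    (hAB : Commute A B) : kleinProj K A B * kleinProj K A B = kleinProj K A B := by
  have h := half_one_add_mul_self h2 (A := -B) (by rw [neg_mul_neg, hB])
  rw [← sub_eq_add_neg] at h
  rw [kleinProj, hAB.half_one_add_half_one_sub.symm.mul_mul_mul_comm, half_one_add_mul_self h2 hA,
    h]

theorem kleinProj_mul_kleinProj {A B C : R} (hB : B * B = 1) :
    kleinProj K A B * kleinProj K B C = 0 := by
  rw [kleinProj, kleinProj, mul_assoc, ← mul_assoc _ _ ((2⁻¹ : K) • (1 - C)),
    half_one_sub_mul_half_one_add hB, zero_mul, mul_zero]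

theorem Commute.kleinProj {A B C D : R} (hAC : Commute A C) (hAD : Commute A D)
    (hBC : Commute B C) (hBD : Commute B D) :
    Commute (kleinProj K A B) (kleinProj K C D) := by
  have key {X : R} (h : Commute X C) (h' : Commute X D) : Commute X (_root_.kleinProj K C D) :=
    (((Commute.one_right X).add_right h).smul_right _).mul_right
      (((Commute.one_right X).sub_right h').smul_right _)
  exact (((Commute.one_left _).add_left (key hAC hAD)).smul_left _).mul_left
    (((Commute.one_left _).sub_left (key hBC hBD)).smul_left _)

theorem kleinProj_add_add {A B C : R} (hAB : A * B = C) (hBC : B * C = A) (hCA : C * A = B) :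
    kleinProj K A B + kleinProj K B C + kleinProj K C A =
      (2⁻¹ * 2⁻¹ : K) • (3 • 1 - A - B - C) := by
  simp only [kleinProj, smul_mul_assoc, mul_smul_comm, mul_sub, add_mul, mul_one, one_mul, hAB,
    hBC, hCA]
  module

theorem sub_one_mul_kleinProj_add_add (h2 : (2 : K) ≠ 0) {A B C : R} (hA : A * A = 1)
    (hAB : A * B = C) (hBC : B * C = A) (hCA : C * A = B) (hAC : A * C = B) :
    (A - 1) * (kleinProj K A B + kleinProj K B C + kleinProj K C A) = A - 1 := by
  rw [kleinProj_add_add hAB hBC hCA]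
  have h : (2⁻¹ : K) * 2 = 1 := inv_mul_cancel₀ h2
  simp only [mul_smul_comm, mul_sub, sub_mul, mul_one, one_mul, hA, hAB, hAC]
  linear_combination (norm := module) ((1 + (2⁻¹ : K) * 2) * h) • (A - 1)

theorem three_mul_finrank_range_kleinProj_le {V : Type*} [AddCommGroup V] [Module K V]
    [FiniteDimensional K V] (h2 : (2 : K) ≠ 0) {A B C : Module.End K V} (hA : A * A = 1)
    (hB : B * B = 1) (hC : C * C = 1) (hAB : Commute A B) (hBC : Commute B C) (hCA : Commute C A)
    (hr₂ : Module.finrank K (LinearMap.range (kleinProj K B C)) =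
      Module.finrank K (LinearMap.range (kleinProj K A B)))
    (hr₃ : Module.finrank K (LinearMap.range (kleinProj K C A)) =
      Module.finrank K (LinearMap.range (kleinProj K A B))) :
    3 * Module.finrank K (LinearMap.range (kleinProj K A B)) ≤ Module.finrank K
      (LinearMap.range (kleinProj K A B + kleinProj K B C + kleinProj K C A)) := by
  have h12 : kleinProj K A B * kleinProj K B C = 0 := kleinProj_mul_kleinProj hB
  have h23 : kleinProj K B C * kleinProj K C A = 0 := kleinProj_mul_kleinProj hC
  have h31 : kleinProj K C A * kleinProj K A B = 0 := kleinProj_mul_kleinProj hA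
  have h21 : kleinProj K B C * kleinProj K A B = 0 :=
    (Commute.kleinProj hAB.symm (Commute.refl _) hCA hBC.symm).eq.trans h12
  have h32 : kleinProj K C A * kleinProj K B C = 0 :=
    (Commute.kleinProj hBC.symm (Commute.refl _) hAB hCA.symm).eq.trans h23
  have h13 : kleinProj K A B * kleinProj K C A = 0 :=
    (Commute.kleinProj hCA.symm (Commute.refl _) hBC hAB.symm).eq.trans h31
  have h11 := kleinProj_mul_self h2 hA hB hAB
  have h22 := kleinProj_mul_self h2 hB hC hBC
  have h33 := kleinProj_mul_self h2 hC hA hCA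
  have hle {X Y : Module.End K V} (hX : Y * X = X) : LinearMap.range X ≤ LinearMap.range Y := by
    rw [← hX]; exact LinearMap.range_comp_le_range X Y
  have hle₁ : LinearMap.range (kleinProj K A B) ≤
      LinearMap.range (kleinProj K A B + kleinProj K B C + kleinProj K C A) :=
    hle (by rw [add_mul, add_mul, h11, h21, h31, add_zero, add_zero])
  have hle₂ : LinearMap.range (kleinProj K B C) ≤
      LinearMap.range (kleinProj K A B + kleinProj K B C + kleinProj K C A) :=
    hle (by rw [add_mul, add_mul, h12, h22, h32, zero_add, add_zero])
  have hle₃ : LinearMap.range (kleinProj K C A) ≤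
      LinearMap.range (kleinProj K A B + kleinProj K B C + kleinProj K C A) :=
    hle (by rw [add_mul, add_mul, h13, h23, h33, add_zero, zero_add])
  have h := sum_finrank_range_le_of_orthogonal
    (W := LinearMap.range (kleinProj K A B + kleinProj K B C + kleinProj K C A))
    (e := ![kleinProj K A B, kleinProj K B C, kleinProj K C A])
    (by
      intro i
      fin_cases i
      exacts [h11, h22, h33])
    (by
      intro i j hij
      fin_cases i <;> fin_cases j
      exacts [absurd rfl hij, h12, h13, h21, absurd rfl hij, h23, h31, h32, absurd rfl hij])
    (by
      intro i
      fin_cases i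
      exacts [hle₁, hle₂, hle₃])
  have h' : Module.finrank K (LinearMap.range (kleinProj K A B)) +
      Module.finrank K (LinearMap.range (kleinProj K B C)) +
      Module.finrank K (LinearMap.range (kleinProj K C A)) ≤ Module.finrank K
        (LinearMap.range (kleinProj K A B + kleinProj K B C + kleinProj K C A)) := by
    rw [Fin.sum_univ_three] at h
    exact h
  lia

end Klein

section KleinRep

open Equiv

/-- The double transposition `(0 1)(2 3)`. -/
def finKleinOne : alternatingGroup (Fin 4) :=
  ⟨swap 0 1 * swap 2 3, Perm.mem_alternatingGroup.2 (by decide)⟩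

/-- The double transposition `(0 2)(1 3)`. -/
def finKleinTwo : alternatingGroup (Fin 4) :=
  ⟨swap 0 2 * swap 1 3, Perm.mem_alternatingGroup.2 (by decide)⟩

/-- A `3`-cycle which permutes `finKleinOne`, `finKleinTwo` and their product cyclically. -/
def finKleinRot : alternatingGroup (Fin 4) :=
  ⟨swap 1 2 * swap 2 3, Perm.mem_alternatingGroup.2 (by decide)⟩

theorem altMap_toEmbedding_trans {α : Type*} [Fintype α] [DecidableEq α] {k : ℕ}
    (x : Fin k ↪ α) {σ : Perm (Fin k)} {π τ : alternatingGroup (Fin k)} (h : σ * π = τ * σ) :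
    altMap (σ.toEmbedding.trans x) π = altMap x τ := by
  have h' := mul_altMap_mul_inv (g := 1) (x := σ.toEmbedding.trans x) (y := x) (fun _ => rfl) h
  rwa [one_mul, inv_one, mul_one] at h'

variable {K V α : Type*} [Field K] [AddCommGroup V] [Module K V] [Fintype α] [DecidableEq α]

theorem conj_kleinProj {G : Type*} [Group G] (ρ : G →* Module.End K V) (g a b : G) :
    ρ g * kleinProj K (ρ a) (ρ b) * ρ g⁻¹ =
      kleinProj K (ρ (g * a * g⁻¹)) (ρ (g * b * g⁻¹)) := by
  have h (x : G) : ρ g * ρ x * ρ g⁻¹ = ρ (g * x * g⁻¹) := by rw [map_mul, map_mul]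
  rw [kleinProj, conj_mul_end, kleinProj, ← h, ← h]
  have h1 : ρ g * ρ g⁻¹ = 1 := by rw [← map_mul, mul_inv_cancel, map_one]
  simp only [mul_smul_comm, smul_mul_assoc, mul_add, add_mul, mul_sub, sub_mul, mul_one, h1]

/-- The `kleinProj` of the two double transpositions `(x 0 x 1)(x 2 x 3)` and
`(x 0 x 2)(x 1 x 3)`. -/
noncomputable def fourProj (ρ : alternatingGroup α →* Module.End K V) (x : Fin 4 ↪ α) :
    Module.End K V :=
  kleinProj K (ρ (altMap x finKleinOne)) (ρ (altMap x finKleinTwo))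

variable {ρ : alternatingGroup α →* Module.End K V}

theorem fourProj_rot (x : Fin 4 ↪ α) :
    fourProj ρ ((finKleinRot : Perm (Fin 4)).toEmbedding.trans x) =
      kleinProj K (ρ (altMap x finKleinTwo)) (ρ (altMap x (finKleinOne * finKleinTwo))) := by
  rw [fourProj, altMap_toEmbedding_trans x (τ := finKleinTwo) (by decide),
    altMap_toEmbedding_trans x (τ := finKleinOne * finKleinTwo) (by decide)]

theorem fourProj_rot_rot (x : Fin 4 ↪ α) :
    fourProj ρ (((finKleinRot * finKleinRot : alternatingGroup (Fin 4)) :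
      Perm (Fin 4)).toEmbedding.trans x) =
      kleinProj K (ρ (altMap x (finKleinOne * finKleinTwo))) (ρ (altMap x finKleinOne)) := by
  rw [fourProj, altMap_toEmbedding_trans x (τ := finKleinOne * finKleinTwo) (by decide),
    altMap_toEmbedding_trans x (τ := finKleinOne) (by decide)]

theorem conj_fourProj {x y : Fin 4 ↪ α} {g : alternatingGroup α}
    (h : ∀ b, (g : Perm α) (x b) = y b) : ρ g * fourProj ρ x * ρ g⁻¹ = fourProj ρ y := by
  rw [fourProj, conj_kleinProj, mul_altMap_mul_inv (σ := 1) (y := y) h (τ := finKleinOne) (by simp),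
    mul_altMap_mul_inv (σ := 1) (y := y) h (τ := finKleinTwo) (by simp), fourProj]

theorem three_mul_finrank_range_fourProj_le [FiniteDimensional K V] (h2 : (2 : K) ≠ 0)
    (x : Fin 4 ↪ α) :
    3 * Module.finrank K (LinearMap.range (fourProj ρ x)) ≤ Module.finrank K (LinearMap.range
      (fourProj ρ x + fourProj ρ ((finKleinRot : Perm (Fin 4)).toEmbedding.trans x) +
        fourProj ρ (((finKleinRot * finKleinRot : alternatingGroup (Fin 4)) :
          Perm (Fin 4)).toEmbedding.trans x))) := by
  have hr (g : alternatingGroup (Fin 4)) : Module.finrank K (LinearMap.range (fourProj ρ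
      ((g : Perm (Fin 4)).toEmbedding.trans x))) =
        Module.finrank K (LinearMap.range (fourProj ρ x)) := by
    rw [← conj_fourProj (g := altMap x g) (fun b => altMap_apply x g b), finrank_range_conj]
  have hmul (a b c : alternatingGroup (Fin 4)) (h : a * b = c) :
      ρ (altMap x a) * ρ (altMap x b) = ρ (altMap x c) := by rw [← map_mul, ← map_mul, h]
  have hone (a : alternatingGroup (Fin 4)) (h : a * a = 1) :
      ρ (altMap x a) * ρ (altMap x a) = 1 := by rw [hmul a a 1 h, map_one, map_one]
  have hcomm (a b : alternatingGroup (Fin 4)) (h : a * b = b * a) :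
      Commute (ρ (altMap x a)) (ρ (altMap x b)) := (Commute.map (Commute.map h (altMap x)) ρ)
  have hA := hone finKleinOne (by decide)
  have hB := hone finKleinTwo (by decide)
  have hC := hone (finKleinOne * finKleinTwo) (by decide)
  have hAB := hcomm finKleinOne finKleinTwo (by decide)
  have hBC := hcomm finKleinTwo (finKleinOne * finKleinTwo) (by decide)
  have hCA := hcomm (finKleinOne * finKleinTwo) finKleinOne (by decide)
  have hr1 := hr finKleinRot
  have hr2 := hr (finKleinRot * finKleinRot)
  rw [fourProj_rot] at hr1 ⊢
  rw [fourProj_rot_rot] at hr2 ⊢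
  exact three_mul_finrank_range_kleinProj_le h2 hA hB hC hAB hBC hCA hr1 hr2

end KleinRep

section FourProjBound

open Equiv

universe u v

variable {K : Type*} [Field K]

theorem card_le_or_exists_fourProj_mul_ne_zero {V α : Type*} [AddCommGroup V] [Module K V]
    [FiniteDimensional K V] [Fintype α] [DecidableEq α] {ρ : alternatingGroup α →* Module.End K V}
    (h2 : (2 : K) ≠ 0) (hα : 8 ≤ Fintype.card α) (hρ : Function.Injective ρ) :
    Fintype.card α ≤ Module.finrank K V + 2 ∨
      ∃ x y : Fin 4 ↪ α, (∀ c d, x c ≠ y d) ∧ fourProj ρ x * fourProj ρ y ≠ 0 := by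
  let e (x : Fin 4 ↪ α) (g : alternatingGroup (Fin 4)) : Module.End K V :=
    fourProj ρ ((g : Perm (Fin 4)).toEmbedding.trans x)
  let p (x : Fin 4 ↪ α) : Module.End K V :=
    e x 1 + e x finKleinRot + e x (finKleinRot * finKleinRot)
  have hmul (x : Fin 4 ↪ α) (a b c : alternatingGroup (Fin 4)) (h : a * b = c) :
      ρ (altMap x a) * ρ (altMap x b) = ρ (altMap x c) := by rw [← map_mul, ← map_mul, h]
  have hp (x) : p x = kleinProj K (ρ (altMap x finKleinOne)) (ρ (altMap x finKleinTwo)) +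
      kleinProj K (ρ (altMap x finKleinTwo)) (ρ (altMap x (finKleinOne * finKleinTwo))) +
      kleinProj K (ρ (altMap x (finKleinOne * finKleinTwo))) (ρ (altMap x finKleinOne)) := by
    rw [← fourProj_rot, ← fourProj_rot_rot]
    rfl
  have hp' (x) : p x = (2⁻¹ * 2⁻¹ : K) • (3 • 1 - ρ (altMap x finKleinOne) -
      ρ (altMap x finKleinTwo) - ρ (altMap x (finKleinOne * finKleinTwo))) := by
    rw [hp]
    exact kleinProj_add_add (hmul x _ _ _ (by decide)) (hmul x _ _ _ (by decide))
      (hmul x _ _ _ (by decide))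
  have hl (x) : (ρ (altMap x finKleinOne) - 1) * p x = ρ (altMap x finKleinOne) - 1 := by
    rw [hp]
    exact sub_one_mul_kleinProj_add_add h2 (by rw [hmul x _ _ 1 (by decide), map_one, map_one])
      (hmul x _ _ _ (by decide)) (hmul x _ _ _ (by decide)) (hmul x _ _ _ (by decide))
      (hmul x _ _ _ (by decide))
  have hcomm (x) : Commute (p x) (ρ (altMap x finKleinOne) - 1) := by
    refine Commute.sub_right ?_ (Commute.one_right _)
    have h (a : alternatingGroup (Fin 4)) (h : a * finKleinOne = finKleinOne * a) :
        Commute (ρ (altMap x a)) (ρ (altMap x finKleinOne)) :=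
      (Commute.map (Commute.map h (altMap x)) ρ)
    rw [hp']
    exact (((((Commute.one_left _).smul_left 3).sub_left (h _ rfl)).sub_left
      (h _ (by decide))).sub_left (h _ (by decide))).smul_left _
  have hconj {x y : Fin 4 ↪ α} {g : alternatingGroup α} (h : ∀ b, (g : Perm α) (x b) = y b) :
      ρ g * p x * ρ g⁻¹ = p y := by
    simp only [p, mul_add, add_mul]
    exact congrArg₂ _ (congrArg₂ _ (conj_fourProj fun b => h _) (conj_fourProj fun b => h _))
      (conj_fourProj fun b => h _)
  refine (card_le_finrank_add_two_or_exists_mul_ne_zero (k := 3) hα hρ (τ := finKleinOne)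
    (by decide) p hl (fun x => (hcomm x).eq.trans (hl x)) (fun x => ?_)
    (fun x y h0 hxy => ?_)).imp_right ?_
  · refine le_trans ?_ (three_mul_finrank_range_fourProj_le h2 x)
    have := finrank_range_pos (K := K) (e := fourProj ρ x) fun h0 => ?_
    · lia
    · have h1 (g : alternatingGroup (Fin 4)) : e x g = 0 := by
        simp only [e]
        rw [← conj_fourProj (g := altMap x g) (fun b => altMap_apply x g b), h0, mul_zero, zero_mul]
      have hl' := hl x
      rw [show p x = 0 by simp only [p, h1, add_zero], mul_zero, eq_comm, sub_eq_zero,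
        ← map_one ρ] at hl'
      have h4 := altMap_apply x finKleinOne 0
      rw [hρ hl'] at h4
      exact absurd (x.injective h4) (by decide)
  · have hyx (d c) (hc : c ≠ 0) : y d ≠ x c := (hxy c d hc).symm
    refine ⟨⟨swap (x 1) (y 1) * swap (x 2) (y 2) * swap (x 3) (y 3) * swap (x 1) (x 2), ?_⟩,
      (hconj (y := (swap 1 2 : Perm (Fin 4)).toEmbedding.trans y) fun c => ?_).trans ?_,
      hconj fun c => ?_⟩
    · simp [Perm.mem_alternatingGroup, Perm.sign_swap (hxy _ _ _)]
    · fin_cases c <;> simp [swap_apply_def, hxy, hyx, h0]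
    · rw [hp', hp', altMap_toEmbedding_trans y (τ := finKleinTwo) (by decide),
        altMap_toEmbedding_trans y (τ := finKleinOne) (by decide),
        altMap_toEmbedding_trans y (τ := finKleinOne * finKleinTwo) (by decide)]
      congr 2
      abel
    · fin_cases c <;> simp [swap_apply_def, hxy, hyx, h0]
  · rintro ⟨x, y, hxy, hne⟩
    by_contra! h
    refine hne ?_
    have h' (a b) : e x a * e y b = 0 := h _ _ fun c d => hxy _ _
    simp only [p, add_mul, mul_add, h', add_zero]

theorem exists_rep_range_fourProj {α : Type u} {V : Type v} [Fintype α] [DecidableEq α]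
    [AddCommGroup V] [Module K V] (ρ : alternatingGroup α →* Module.End K V) (x : Fin 4 ↪ α) :
    ∃ (β : Type u) (_ : Fintype β) (_ : DecidableEq β) (j : β ↪ α)
      (σ : alternatingGroup β →* Module.End K (LinearMap.range (fourProj ρ x))),
      Fintype.card β + 4 = Fintype.card α ∧
      (∀ y : Fin 4 ↪ α, (∀ c d, x c ≠ y d) → ∃ y' : Fin 4 ↪ β, y'.trans j = y) ∧
      ∀ y' v, (fourProj σ y' v : V) = fourProj ρ (y'.trans j) v := by
  obtain ⟨β, _, _, j, hβ, hj, hy⟩ := exists_embedding_compl x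
  have hcomm (g : alternatingGroup β) (a : alternatingGroup (Fin 4)) :
      Commute (ρ (altMap x a)) (ρ (altMap j g)) := (altMap_commute hj a g).map ρ
  obtain ⟨σ, hσ⟩ := exists_monoidHom_range (ρ.comp (altMap j)) (e := fourProj ρ x) fun g =>
    (((Commute.one_left _).add_left (hcomm g _)).smul_left _).mul_left
      (((Commute.one_left _).sub_left (hcomm g _)).smul_left _)
  refine ⟨β, _, _, j, σ, hβ, hy, fun y' v => ?_⟩
  have h : fourProj ρ (y'.trans j) = kleinProj K (ρ (altMap j (altMap y' finKleinOne)))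
      (ρ (altMap j (altMap y' finKleinTwo))) := by
    rw [fourProj, altMap_trans, altMap_trans]
  rw [h]
  change (kleinProj K (σ _) (σ _) v : V) = _
  simp [kleinProj, hσ]

theorem finrank_bound_of_fourProj_ne_zero (h2 : (2 : K) ≠ 0) (n : ℕ) :
    ∀ {α : Type u} {V : Type v} [Fintype α] [DecidableEq α] [AddCommGroup V] [Module K V]
      [FiniteDimensional K V] (ρ : alternatingGroup α →* Module.End K V) (x : Fin 4 ↪ α),
      Fintype.card α = n → 4 ≤ n → fourProj ρ x ≠ 0 →
      3 ≤ Module.finrank K V ∧ (8 ≤ n → n ≤ Module.finrank K V + 2) := by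
  induction n using Nat.strong_induction_on with
  | _ n ih =>
  intro α V _ _ _ _ _ ρ x hα hn hx
  have h3 (x : Fin 4 ↪ α) :
      3 * Module.finrank K (LinearMap.range (fourProj ρ x)) ≤ Module.finrank K V :=
    (three_mul_finrank_range_fourProj_le h2 x).trans (Submodule.finrank_le _)
  have hpos := finrank_range_pos hx
  refine ⟨by have := h3 x; lia, fun hn8 => ?_⟩
  have hρ : Function.Injective ρ := by
    refine alternatingGroup_injective_of_ne_one (by lia) ρ (g := altMap x finKleinTwo) fun h => ?_
    rw [fourProj, h, kleinProj, sub_self, smul_zero, mul_zero] at hx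
    exact hx rfl
  obtain h | ⟨y, x, hyx, hne⟩ := card_le_or_exists_fourProj_mul_ne_zero h2 (by lia) hρ
  · lia
  have h3x := h3 x
  obtain ⟨β, _, _, j, σ, hβ, hlift, hσ⟩ := exists_rep_range_fourProj ρ x
  obtain ⟨y', hy'⟩ := hlift y fun c d => (hyx d c).symm
  have hy0 : fourProj σ y' ≠ 0 := by
    intro h0
    refine hne (LinearMap.ext fun v => ?_)
    have h := hσ y' ⟨_, LinearMap.mem_range_self _ v⟩
    rw [h0, hy'] at h
    exact h.symm
  have hrec := ih (n - 4) (by lia) σ y' (by lia) (by lia) hy0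
  lia

end FourProjBound

theorem card_le_finrank_add_two {K V α : Type*} [Field K] [IsAlgClosed K] [AddCommGroup V]
    [Module K V] [FiniteDimensional K V] [Fintype α] [DecidableEq α]
    (ρ : alternatingGroup α →* Module.End K V) (hρ : Function.Injective ρ)
    (hα : 9 ≤ Fintype.card α) : Fintype.card α ≤ Module.finrank K V + 2 := by
  by_cases h3 : (3 : K) = 0
  · have h2 : (2 : K) ≠ 0 := fun h2 => one_ne_zero (α := K) (by linear_combination h3 - h2)
    obtain h | ⟨x, y, -, hne⟩ := card_le_or_exists_fourProj_mul_ne_zero h2 (by lia) hρ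
    · exact h
    · exact (finrank_bound_of_fourProj_ne_zero h2 _ ρ x rfl (by lia)
        (left_ne_zero_of_mul hne)).2 (by lia)
  · obtain ⟨ω, hω⟩ := IsAlgClosed.exists_root
      (Polynomial.C 1 * Polynomial.X ^ 2 + Polynomial.C 1 * Polynomial.X + Polynomial.C (1 : K))
      (by rw [Polynomial.degree_quadratic one_ne_zero]; exact two_ne_zero)
    replace hω : ω ^ 2 + ω + 1 = 0 := by simpa using hω
    obtain h | ⟨x, y, -, hne⟩ := card_le_or_exists_cycleProj_mul_ne_zero hω h3 (by lia) hρ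
    · exact h
    · exact (finrank_bound_of_cycleProj_ne_zero hω h3 _ ρ x rfl (by lia)
        (left_ne_zero_of_mul hne)).2 hα

theorem le_add_two_of_injective {k : Type*} [Field k] {m n : ℕ} (hm : 9 ≤ m)
    (φ : alternatingGroup (Fin m) →* Matrix.GeneralLinearGroup (Fin n) k)
    (hφ : Function.Injective φ) : m ≤ n + 2 := by
  let K := AlgebraicClosure k
  let ρ : alternatingGroup (Fin m) →* Module.End K (Fin n → K) :=
    ((Matrix.toLinAlgEquiv' : Matrix (Fin n) (Fin n) K ≃ₐ[K] _) : _ →* _).comp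
      ((algebraMap k K).mapMatrix.toMonoidHom.comp ((Units.coeHom _).comp φ))
  have hρ : Function.Injective ρ := Matrix.toLinAlgEquiv'.injective.comp
    ((Matrix.map_injective (algebraMap k K).injective).comp (Units.val_injective.comp hφ))
  have h := card_le_finrank_add_two ρ hρ (by rwa [Fintype.card_fin])
  rwa [Fintype.card_fin, Module.finrank_fin_fun] at h

/-- **Order bound for alternating groups with a faithful irreducible representation of
degree `n ≥ 8`:** `|Alt_m| ≤ (n+2)!/2`. -/
theorem stmt5 {k : Type*} [Field k] {m n : ℕ} (hm : 1 ≤ m) (hn : 8 ≤ n)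
    (φ : alternatingGroup (Fin m) →* Matrix.GeneralLinearGroup (Fin n) k)
    (hinj : Function.Injective φ) (hirr : IrreducibleRep φ) :
    Nat.card (alternatingGroup (Fin m)) ≤ Nat.factorial (n + 2) / 2 := by
  have hmn : m ≤ n + 2 := by
    by_contra h
    exact h (le_add_two_of_injective (by lia) φ hinj)
  obtain rfl | hm := hm.eq_or_lt
  · rw [Nat.card_unique]
    have := Nat.self_le_factorial (n + 2)
    lia
  · have : Nontrivial (Fin m) := Fin.nontrivial_iff_two_le.2 hm
    rw [nat_card_alternatingGroup, Nat.card_fin]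
    exact Nat.div_le_div_right (Nat.factorial_le hmn)
end

section
/- Let k be an algebraically closed field, let m > 7, and let φ : Alt_m → PGL_n(k) be a faithful irreducible projective representation that does not lift to a linear representation of Alt_m. Then m ≤ (81 + 32·log₂ n)/15. -/
namespace AltSpin

open Equiv Equiv.Perm

section Extension

variable {α : Type*} [Fintype α] [DecidableEq α] {E : Type*} [Group E]

/-- The three-cycle `a ↦ b ↦ c ↦ a`. -/
def tri (a b c : α) : Perm α := swap a b * swap b c

omit [Fintype α] in
lemma tri_conj (σ : Perm α) (a b c : α) : σ * tri a b c * σ⁻¹ = tri (σ a) (σ b) (σ c) := by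
  simp only [tri, swap_apply_apply]
  group

omit [Fintype α] in
lemma tri_inv (a b c : α) : (tri a b c)⁻¹ = tri c b a := by
  simp [tri, swap_comm]

omit [Fintype α] in
lemma tri_rotate {a b c : α} (hab : a ≠ b) (hac : a ≠ c) (hbc : b ≠ c) :
    tri a b c = tri b c a := by
  ext t
  simp only [tri, Perm.mul_apply, swap_apply_def]
  grind

lemma _root_.Equiv.Perm.IsThreeCycle.pow_three {σ : Perm α} (hσ : σ.IsThreeCycle) : σ ^ 3 = 1 := by
  rw [← hσ.orderOf, pow_orderOf_eq_one]

lemma isThreeCycle_tri {a b c : α} (hab : a ≠ b) (hac : a ≠ c) (hbc : b ≠ c) :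
    (tri a b c).IsThreeCycle := by
  have := isThreeCycle_swap_mul_swap_same hab.symm hbc hac
  rwa [swap_comm b a] at this

lemma eq_tri {σ : Perm α} (hσ : σ.IsThreeCycle) {a : α} (ha : σ a ≠ a) :
    σ = tri a (σ a) (σ (σ a)) ∧ a ≠ σ a ∧ a ≠ σ (σ a) ∧ σ a ≠ σ (σ a) := by
  have h := hσ.eq_swap_mul_swap_iff_mem_support.2 (mem_support.2 ha)
  have h' := hσ.nodup_iff_mem_support.2 (mem_support.2 ha)
  refine ⟨h, ?_⟩
  simp only [List.nodup_cons, List.mem_cons] at h'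
  grind

lemma exists_eq_tri {σ : Perm α} (hσ : σ.IsThreeCycle) :
    ∃ a b c, a ≠ b ∧ a ≠ c ∧ b ≠ c ∧ σ = tri a b c := by
  obtain ⟨a, ha⟩ : ∃ a, σ a ≠ a := by
    by_contra! h
    exact hσ.ne_one (Equiv.ext h)
  have := eq_tri hσ ha
  exact ⟨_, _, _, this.2.1, this.2.2.1, this.2.2.2, this.1⟩

lemma exists_pair_notMem (s : Finset α) (hs : s.card + 2 ≤ Fintype.card α) :
    ∃ e f, e ∉ s ∧ f ∉ s ∧ e ≠ f := by
  have : 1 < sᶜ.card := by rw [Finset.card_compl]; omega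
  obtain ⟨e, he, f, hf, hef⟩ := Finset.one_lt_card.1 this
  exact ⟨e, f, by simpa using he, by simpa using hf, hef⟩

/-- Even permutations supported in `B` are products of three-cycles supported in `B`. -/
lemma even_induction (B : Finset α) {P : Perm α → Prop} (one : P 1)
    (mul : ∀ σ τ, P σ → P τ → P (σ * τ))
    (three : ∀ a ∈ B, ∀ b ∈ B, ∀ c ∈ B, a ≠ b → a ≠ c → b ≠ c → P (tri a b c))
    {σ : Perm α} (hσ : ∀ x ∉ B, σ x = x) (hs : sign σ = 1) : P σ := by
  have hB : ∀ x, σ x ≠ x → x ∈ B := fun x hx => by_contra fun h => hx (hσ x h)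
  have hB' : ∀ x, σ x ∈ B ↔ x ∈ B := by
    intro x
    by_cases h : σ x = x
    · rw [h]
    · exact iff_of_true (hB _ fun h' => h (σ.injective h')) (hB _ h)
  rw [← ofSubtype_subtypePerm hB' hB] at hs ⊢
  rw [sign_ofSubtype] at hs
  generalize σ.subtypePerm hB' = τ at hs
  rw [← mem_alternatingGroup, ← closure_three_cycles_eq_alternating] at hs
  have key : ∀ g : Perm B, g.IsThreeCycle → P (ofSubtype g) := by
    intro g hg
    obtain ⟨a, b, c, hab, hac, hbc, rfl⟩ := exists_eq_tri hg
    rw [tri, map_mul, ofSubtype_swap_eq, ofSubtype_swap_eq]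
    exact three a a.2 b b.2 c c.2 (Subtype.coe_injective.ne hab)
      (Subtype.coe_injective.ne hac) (Subtype.coe_injective.ne hbc)
  induction hs using Subgroup.closure_induction_left with
  | one => simpa using one
  | mul_left x hx y _ ih => rw [map_mul]; exact mul _ _ (key _ hx) ih
  | inv_mul_cancel x hx y _ ih => rw [map_mul]; exact mul _ _ (key _ (IsThreeCycle.inv hx)) ih

/-- A central extension of the alternating group whose kernel has square roots. -/
structure IsAltExtension (π : E →* Perm α) : Prop where
  sign_map : ∀ x, sign (π x) = 1
  exists_lift : ∀ σ, sign σ = 1 → ∃ x, π x = σ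
  central : ∀ z, π z = 1 → ∀ x, z * x = x * z
  exists_root : ∀ z, π z = 1 → ∃ y, π y = 1 ∧ y * y = z

/-- A lift `x` of a three-cycle is normalized if `x ^ 3 = 1` and `x` is inverted by every
element inverting its image. -/
def IsNormalized (π : E →* Perm α) (x : E) : Prop :=
  (π x).IsThreeCycle ∧ x ^ 3 = 1 ∧
    ∀ y, π y * π x * (π y)⁻¹ = (π x)⁻¹ → y * x * y⁻¹ = x⁻¹

omit [Fintype α] [DecidableEq α] in
lemma exists_mul_eq {π : E →* Perm α} {x y : E} (hxy : π x = π y) : ∃ z, π z = 1 ∧ x = z * y :=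
  ⟨x * y⁻¹, by simp [hxy], by group⟩

lemma eq_one_of_pow {z : E} (h2 : z = z⁻¹) (h3 : z ^ 3 = 1) : z = 1 := by
  have : z * z = 1 := by nth_rw 1 [h2]; simp
  calc z = z ^ 3 * (z * z)⁻¹ := by group
    _ = 1 := by rw [this, h3]; simp

namespace IsAltExtension

variable {π : E →* Perm α} (h : IsAltExtension π)
include h

lemma conj_eq {x x' : E} (hx : π x = π x') (y : E) : x * y * x⁻¹ = x' * y * x'⁻¹ := by
  obtain ⟨z, hz, rfl⟩ := exists_mul_eq hx
  have := h.central z hz (x' * y * x'⁻¹)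
  calc z * x' * y * (z * x')⁻¹ = z * (x' * y * x'⁻¹) * z⁻¹ := by group
    _ = x' * y * x'⁻¹ := by rw [this]; group

lemma commute_tri_tri (h8 : 8 ≤ Fintype.card α) {a b d p q r : α}
    (hl : [a, b, d, p, q, r].Nodup) {x t : E} (hx : π x = tri a b d) (ht : π t = tri p q r) :
    x * t = t * x := by
  obtain ⟨e, f, he, hf, hef⟩ := exists_pair_notMem ({a, b, d, p, q, r} : Finset α)
    ((Nat.add_le_add_right Finset.card_le_six 2).trans h8)
  simp only [Finset.mem_insert, Finset.mem_singleton, not_or] at he hf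
  simp only [List.nodup_cons, List.mem_cons, List.not_mem_nil, or_false, not_or] at hl
  obtain ⟨g, hg⟩ := h.exists_lift (swap p q * swap e f) (by
    rw [map_mul, sign_swap (by tauto), sign_swap hef]; rfl)
  have hzt : π (x * t * x⁻¹ * t⁻¹) = 1 := by
    have : tri a b d * tri p q r = tri p q r * tri a b d := by
      ext u
      simp only [tri, Perm.mul_apply, swap_apply_def]
      grind
    simp [hx, ht, this]
  have hyg : π (x * g * x⁻¹ * g⁻¹) = 1 := by
    have : tri a b d * (swap p q * swap e f) = swap p q * swap e f * tri a b d := by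
      ext u
      simp only [tri, Perm.mul_apply, swap_apply_def]
      grind
    simp only [map_mul, map_inv, hx, hg, this]
    group
  have hk : π (g * t * g⁻¹ * t) = 1 := by
    have h1 : π (g * t * g⁻¹) = tri q p r := by
      simp only [map_mul, map_inv, ht, hg]
      rw [tri_conj]
      congr 1 <;> simp only [Perm.mul_apply, swap_apply_def] <;> grind
    rw [map_mul, h1, ht, tri_rotate (a := p) (by tauto) (by tauto) (by tauto),
      ← tri_inv, ← tri_rotate (by tauto) (by tauto) (by tauto), inv_mul_cancel]
  have ht3 : π (t ^ 3) = 1 := by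
    rw [map_pow, ht]
    exact (isThreeCycle_tri (by tauto) (by tauto) (by tauto)).pow_three
  obtain ⟨z, hz⟩ : ∃ z, z = x * t * x⁻¹ * t⁻¹ := ⟨_, rfl⟩
  obtain ⟨y, hy⟩ : ∃ y, y = x * g * x⁻¹ * g⁻¹ := ⟨_, rfl⟩
  obtain ⟨κ, hκ⟩ : ∃ κ, κ = g * t * g⁻¹ * t := ⟨_, rfl⟩
  rw [← hz] at hzt
  rw [← hy] at hyg
  rw [← hκ] at hk
  have hz' : x * t * x⁻¹ = z * t := by rw [hz]; group
  have hy' : x * g * x⁻¹ = y * g := by rw [hy]; group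
  have hκ' : g * t * g⁻¹ = κ * t⁻¹ := by rw [hκ]; group
  have z3 : z ^ 3 = 1 := by
    have e1 : (x * t * x⁻¹) ^ 3 = t ^ 3 := by
      rw [conj_pow, ← h.central _ ht3]; group
    rw [hz', (show Commute z t from h.central z hzt t).mul_pow] at e1
    simpa using e1
  have z2 : z = z⁻¹ := by
    have e1 : x * (g * t * g⁻¹) * x⁻¹ = z * (κ * t⁻¹) := by
      calc x * (g * t * g⁻¹) * x⁻¹ = (x * g * x⁻¹) * (x * t * x⁻¹) * (x * g * x⁻¹)⁻¹ := by group
        _ = (y * g) * (x * t * x⁻¹) * (y * g)⁻¹ := by rw [hy']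
        _ = g * (z * t) * g⁻¹ := by
          rw [hz']; exact h.conj_eq (by simp [hyg]) _
        _ = z * (g * t * g⁻¹) := by
          rw [← mul_assoc g, ← h.central z hzt g]; group
        _ = _ := by rw [hκ']
    have e2 : x * (g * t * g⁻¹) * x⁻¹ = κ * (x * t * x⁻¹)⁻¹ := by
      rw [hκ']
      calc x * (κ * t⁻¹) * x⁻¹ = (x * κ) * t⁻¹ * x⁻¹ := by group
        _ = _ := by rw [← h.central κ hk x]; group
    rw [e1, hz', h.central z hzt t, mul_inv_rev, h.central z hzt (κ * t⁻¹)] at e2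
    have := h.central z⁻¹ (by simp [hzt]) t⁻¹
    rw [this, ← mul_assoc] at e2
    exact mul_left_cancel e2
  have := eq_one_of_pow z2 z3
  rw [this, one_mul] at hz'
  exact mul_inv_eq_iff_eq_mul.mp (hz' : x * t * x⁻¹ = t)

/-- Every lift of a three-cycle commutes with all elements whose image commutes with that
three-cycle. -/
lemma commute_of_isThreeCycle (h8 : 8 ≤ Fintype.card α) {x y : E} (hx : (π x).IsThreeCycle)
    (hxy : π x * π y = π y * π x) : x * y = y * x := by
  obtain ⟨a, b, d, hab, had, hbd, hx'⟩ := exists_eq_tri hx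
  have hxa : π x a = b := by rw [hx']; simp only [tri, Perm.mul_apply, swap_apply_def]; grind
  have hxb : π x b = d := by rw [hx']; simp only [tri, Perm.mul_apply, swap_apply_def]; grind
  have hxd : π x d = a := by rw [hx']; simp only [tri, Perm.mul_apply, swap_apply_def]; grind
  have fixed : ∀ y : E, π x * π y = π y * π x → π y a = a → x * y = y * x := by
    intro y hy ha
    have hb : π y b = b := by
      have := congrArg (· a) hy
      simp only [Perm.mul_apply, ha, hxa] at this
      exact this.symm
    have hd : π y d = d := by
      have := congrArg (· b) hy
      simp only [Perm.mul_apply, hb, hxb] at this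
      exact this.symm
    have key : ∀ t, π t = π y → x * t = t * x := by
      refine (even_induction (P := fun σ => sign σ = 1 ∧ ∀ t, π t = σ → x * t = t * x)
        ({a, b, d}ᶜ : Finset α) ?_ ?_ ?_ (σ := π y) ?_ (h.sign_map y)).2
      · refine ⟨map_one _, fun t ht => ?_⟩
        exact (h.central t ht x).symm
      · rintro σ τ ⟨hσ', hσ⟩ ⟨hτ', hτ⟩
        refine ⟨by rw [map_mul, hσ', hτ', one_mul], fun t ht => ?_⟩
        obtain ⟨s, hs⟩ := h.exists_lift τ hτ'
        have h1 := hσ (t * s⁻¹) (by simp [ht, hs])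
        have h2 := hτ s hs
        calc x * t = x * (t * s⁻¹) * s := by group
          _ = _ := by rw [h1, mul_assoc, h2]; group
      · intro p hp q hq r hr hpq hpr hqr
        refine ⟨(isThreeCycle_tri hpq hpr hqr).sign, fun t ht => ?_⟩
        refine h.commute_tri_tri h8 ?_ hx' ht
        simp only [List.nodup_cons, List.mem_cons, Finset.mem_compl, Finset.mem_insert,
          Finset.mem_singleton] at hp hq hr ⊢
        grind
      · intro u hu
        simp only [Finset.mem_compl, Finset.mem_insert, Finset.mem_singleton, not_not] at hu
        rcases hu with rfl | rfl | rfl <;> assumption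
    exact key y rfl
  have hmem : π y a = a ∨ π y a = b ∨ π y a = d := by
    have h1 : π x (π y a) ≠ π y a := by
      have := congrArg (· a) hxy
      simp only [Perm.mul_apply, hxa] at this
      rw [this]
      exact fun h' => hab ((π y).injective h').symm
    rw [hx'] at h1
    simp only [tri, Perm.mul_apply, swap_apply_def] at h1
    grind
  rcases hmem with ha | ha | ha
  · exact fixed y hxy ha
  · have := fixed (x * x * y) (by
      simp only [map_mul]
      calc π x * (π x * π x * π y) = π x * π x * (π x * π y) := by group
        _ = _ := by rw [hxy]; group) (by simp [ha, hxb, hxd])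
    have h2 : x * x * (x * y) = x * x * (y * x) := by simpa [mul_assoc] using this
    exact mul_left_cancel h2
  · have := fixed (x * y) (by
      simp only [map_mul]
      rw [mul_assoc, ← hxy]) (by simp [ha, hxd])
    have h2 : x * (x * y) = x * (y * x) := by simpa [mul_assoc] using this
    exact mul_left_cancel h2

end IsAltExtension
end Extension
end AltSpin

namespace AltSpin

open Equiv Equiv.Perm

section Normalized

variable {α : Type*} [Fintype α] [DecidableEq α] {E : Type*} [Group E] {π : E →* Perm α}

open Classical in
/-- The normalized lift of a three-cycle. -/
noncomputable def lift₃ (π : E →* Perm α) (σ : Perm α) : E :=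
  if hM : ∃ M, IsNormalized π M ∧ π M = σ then hM.choose else 1

namespace IsNormalized

lemma conj {M : E} (hM : IsNormalized π M) (y : E) : IsNormalized π (y * M * y⁻¹) := by
  refine ⟨?_, by rw [conj_pow, hM.2.1]; group, fun w hw => ?_⟩
  · rw [map_mul, map_mul, map_inv]
    rw [IsThreeCycle, cycleType_conj]
    exact hM.1
  · have := hM.2.2 (y⁻¹ * w * y) (by
      simp only [map_mul, map_inv] at hw ⊢
      calc (π y)⁻¹ * π w * π y * π M * ((π y)⁻¹ * π w * π y)⁻¹
          = (π y)⁻¹ * (π w * (π y * π M * (π y)⁻¹) * (π w)⁻¹) * π y := by group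
        _ = _ := by rw [hw]; group)
    calc w * (y * M * y⁻¹) * w⁻¹ = y * (y⁻¹ * w * y * M * (y⁻¹ * w * y)⁻¹) * y⁻¹ := by group
      _ = _ := by rw [this]; group

lemma inv {M : E} (hM : IsNormalized π M) : IsNormalized π M⁻¹ := by
  refine ⟨by rw [map_inv]; exact hM.1.inv, by rw [inv_pow, hM.2.1, inv_one], fun w hw => ?_⟩
  rw [map_inv, inv_inv] at hw
  have := hM.2.2 w (by simpa [mul_assoc] using congrArg (·⁻¹) hw)
  simpa [mul_assoc] using congrArg (·⁻¹) this

end IsNormalized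

lemma exists_inverting (h8 : 8 ≤ Fintype.card α) {σ : Perm α} (hσ : σ.IsThreeCycle) :
    ∃ τ : Perm α, sign τ = 1 ∧ τ * σ * τ⁻¹ = σ⁻¹ := by
  obtain ⟨a, b, d, hab, had, hbd, rfl⟩ := exists_eq_tri hσ
  obtain ⟨e, f, he, hf, hef⟩ := exists_pair_notMem ({a, b, d} : Finset α)
    ((Nat.add_le_add_right Finset.card_le_three 2).trans (by omega))
  simp only [Finset.mem_insert, Finset.mem_singleton, not_or] at he hf
  refine ⟨swap a b * swap e f, by rw [map_mul, sign_swap hab, sign_swap hef]; rfl, ?_⟩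
  rw [tri_conj, tri_inv, tri_rotate (a := d) hbd.symm had.symm hab.symm]
  congr 1 <;> simp only [Perm.mul_apply, swap_apply_def] <;> grind

namespace IsAltExtension

variable (h : IsAltExtension π) (h8 : 8 ≤ Fintype.card α)
include h h8

lemma exists_isNormalized {σ : Perm α} (hσ : σ.IsThreeCycle) :
    ∃ M, IsNormalized π M ∧ π M = σ := by
  obtain ⟨τ, hτ, hτσ⟩ := exists_inverting h8 hσ
  obtain ⟨x, rfl⟩ := h.exists_lift σ hσ.sign
  obtain ⟨y, rfl⟩ := h.exists_lift τ hτ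
  obtain ⟨ζ, hζ⟩ : ∃ ζ, ζ = y * x * y⁻¹ * x := ⟨_, rfl⟩
  have hζ1 : π ζ = 1 := by simp [hζ, hτσ]
  obtain ⟨z, hz1, hz⟩ := h.exists_root ζ⁻¹ (by simp [hζ1])
  obtain ⟨x₁, hx₁⟩ : ∃ x₁, x₁ = z * x := ⟨_, rfl⟩
  have hπ : π x₁ = π x := by simp [hx₁, hz1]
  have hy : y * x₁ * y⁻¹ = x₁⁻¹ := by
    calc y * x₁ * y⁻¹ = y * z * x * y⁻¹ := by rw [hx₁]; group
      _ = z * (y * x * y⁻¹ * x) * x⁻¹ := by rw [← h.central z hz1]; group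
      _ = z * (z * z)⁻¹ * x⁻¹ := by rw [← hζ, hz, inv_inv]
      _ = (x * z)⁻¹ := by group
      _ = _ := by rw [hx₁, h.central z hz1]
  obtain ⟨μ, hμ⟩ : ∃ μ, μ = x₁ ^ 3 := ⟨_, rfl⟩
  have hμ1 : π μ = 1 := by rw [hμ, map_pow, hπ, hσ.pow_three]
  have hμ2 : μ = μ⁻¹ := by
    calc μ = y * μ * y⁻¹ := by rw [← h.central μ hμ1]; group
      _ = (y * x₁ * y⁻¹) ^ 3 := by rw [hμ, conj_pow]
      _ = _ := by rw [hy, hμ, inv_pow]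
  have hμ3 : μ * μ = 1 := by nth_rw 1 [hμ2]; simp
  have hy' : y * (μ * x₁) * y⁻¹ = (μ * x₁)⁻¹ := by
    calc y * (μ * x₁) * y⁻¹ = μ * (y * x₁ * y⁻¹) := by
          rw [← mul_assoc y, ← h.central μ hμ1]; group
      _ = _ := by rw [hy, h.central μ hμ1, mul_inv_rev, ← hμ2]
  have hM : π (μ * x₁) = π x := by simp [hμ1, hπ]
  refine ⟨μ * x₁, ⟨hM ▸ hσ, ?_, fun w hw => ?_⟩, hM⟩
  · rw [(show Commute μ x₁ from h.central μ hμ1 x₁).mul_pow, ← hμ, pow_succ, pow_two, hμ3, one_mul,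
      hμ3]
  · have hc := h.commute_of_isThreeCycle h8 (x := μ * x₁) (y := y⁻¹ * w) (hM ▸ hσ) (by
      rw [hM] at hw ⊢
      rw [← hτσ] at hw
      simp only [map_mul, map_inv]
      calc π x * ((π y)⁻¹ * π w) = (π y)⁻¹ * (π y * π x * (π y)⁻¹) * π w := by group
        _ = _ := by rw [← hw]; group)
    calc w * (μ * x₁) * w⁻¹ = y * (y⁻¹ * w * (μ * x₁)) * w⁻¹ := by group
      _ = y * (μ * x₁) * y⁻¹ := by rw [← hc]; group
      _ = _ := hy'

lemma eq_of_isNormalized {M M' : E} (hM : IsNormalized π M) (hM' : IsNormalized π M')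
    (hπ : π M = π M') : M = M' := by
  obtain ⟨z, hz, rfl⟩ := exists_mul_eq hπ
  obtain ⟨τ, hτ, hτσ⟩ := exists_inverting h8 hM'.1
  obtain ⟨y, rfl⟩ := h.exists_lift τ hτ
  have h1 := hM'.2.2 y hτσ
  have h2 := hM.2.2 y (by rw [hπ, hτσ])
  rw [← mul_assoc, ← h.central z hz, mul_assoc, mul_assoc, ← mul_assoc y, h1, mul_inv_rev,
    h.central z hz] at h2
  have h3 := hM.2.1
  rw [(show Commute z M' from h.central z hz M').mul_pow, hM'.2.1, mul_one] at h3
  rw [eq_one_of_pow (mul_left_cancel h2) h3, one_mul]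

lemma lift₃_spec {σ : Perm α} (hσ : σ.IsThreeCycle) :
    IsNormalized π (lift₃ π σ) ∧ π (lift₃ π σ) = σ := by
  have := h.exists_isNormalized h8 hσ
  rw [lift₃, dif_pos this]
  exact this.choose_spec

lemma map_lift₃ {σ : Perm α} (hσ : σ.IsThreeCycle) : π (lift₃ π σ) = σ := (h.lift₃_spec h8 hσ).2

lemma eq_lift₃ {M : E} (hM : IsNormalized π M) {σ : Perm α} (hσ : π M = σ) : M = lift₃ π σ := by
  subst hσ
  exact h.eq_of_isNormalized h8 hM (h.lift₃_spec h8 hM.1).1 (h.lift₃_spec h8 hM.1).2.symm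

lemma conj_lift₃ {σ : Perm α} (hσ : σ.IsThreeCycle) (y : E) :
    y * lift₃ π σ * y⁻¹ = lift₃ π (π y * σ * (π y)⁻¹) :=
  h.eq_lift₃ h8 ((h.lift₃_spec h8 hσ).1.conj y) (by simp [h.map_lift₃ h8 hσ])

lemma inv_lift₃ {σ : Perm α} (hσ : σ.IsThreeCycle) : (lift₃ π σ)⁻¹ = lift₃ π σ⁻¹ :=
  h.eq_lift₃ h8 (h.lift₃_spec h8 hσ).1.inv (by simp [h.map_lift₃ h8 hσ])

lemma map_lift₃_tri {a b d : α} (hl : [a, b, d].Nodup) : π (lift₃ π (tri a b d)) = tri a b d := by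
  simp only [List.nodup_cons, List.mem_cons, List.not_mem_nil, or_false, not_or] at hl
  exact h.map_lift₃ h8 (isThreeCycle_tri hl.1.1 hl.1.2 hl.2.1)

lemma conj_lift₃_tri {a b d : α} (hl : [a, b, d].Nodup) (y : E) :
    y * lift₃ π (tri a b d) * y⁻¹ = lift₃ π (tri (π y a) (π y b) (π y d)) := by
  simp only [List.nodup_cons, List.mem_cons, List.not_mem_nil, or_false, not_or] at hl
  rw [h.conj_lift₃ h8 (isThreeCycle_tri hl.1.1 hl.1.2 hl.2.1), tri_conj]

lemma inv_lift₃_tri {a b d : α} (hl : [a, b, d].Nodup) :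
    (lift₃ π (tri a b d))⁻¹ = lift₃ π (tri d b a) := by
  simp only [List.nodup_cons, List.mem_cons, List.not_mem_nil, or_false, not_or] at hl
  rw [h.inv_lift₃ h8 (isThreeCycle_tri hl.1.1 hl.1.2 hl.2.1), tri_inv]

/-- The ratio of the two natural lifts of a three-cycle written as a product of three-cycles. -/
lemma exists_ratio : ∃ ε : E, π ε = 1 ∧ ε * ε = 1 ∧ ∀ z j a b : α, [z, j, a, b].Nodup →
    lift₃ π (tri z j a) * lift₃ π (tri j b a) = ε * lift₃ π (tri z j b) := by
  have hcard : Nat.card α = Fintype.card α := Nat.card_eq_fintype_card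
  have htrans : MulAction.IsMultiplyPretransitive (alternatingGroup α) α 4 := by
    have := alternatingGroup.isMultiplyPretransitive α
    exact MulAction.isMultiplyPretransitive_of_le (n := Nat.card α - 2) (by omega) (by omega)
  rw [MulAction.isMultiplyPretransitive_iff] at htrans
  have hnd : ∀ f : Fin 4 ↪ α, [f 0, f 1, f 2, f 3].Nodup := fun f => by
    simp [f.injective.eq_iff]
  obtain ⟨f⟩ : Nonempty (Fin 4 ↪ α) :=
    Function.Embedding.nonempty_of_card_le (by rw [Fintype.card_fin]; omega)
  obtain ⟨ε, hε, hf⟩ := exists_mul_eq (π := π)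
    (x := lift₃ π (tri (f 0) (f 1) (f 2)) * lift₃ π (tri (f 1) (f 3) (f 2)))
    (y := lift₃ π (tri (f 0) (f 1) (f 3))) (by
      have := hnd f
      rw [map_mul, h.map_lift₃_tri h8, h.map_lift₃_tri h8, h.map_lift₃_tri h8]
      · generalize f 0 = z, f 1 = j, f 2 = a, f 3 = b at this
        simp only [List.nodup_cons, List.mem_cons, List.not_mem_nil, or_false, not_or] at this
        ext t
        simp only [tri, Perm.mul_apply, swap_apply_def]
        grind
      all_goals simp [f.injective.eq_iff])
  have hall : ∀ z j a b : α, [z, j, a, b].Nodup →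
      lift₃ π (tri z j a) * lift₃ π (tri j b a) = ε * lift₃ π (tri z j b) := by
    intro z j a b hl
    obtain ⟨⟨σ, hσ⟩, hg⟩ := htrans f ⟨![z, j, a, b], by
      rw [← List.nodup_ofFn]; simpa [List.ofFn_succ] using hl⟩
    obtain ⟨y, rfl⟩ := h.exists_lift σ hσ
    have hy : ∀ i, π y (f i) = ![z, j, a, b] i := fun i => DFunLike.congr_fun hg i
    have hy0 := hy 0
    have hy1 := hy 1
    have hy2 := hy 2
    have hy3 := hy 3
    simp only [Matrix.cons_val] at hy0 hy1 hy2 hy3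
    have := congrArg (fun x => y * x * y⁻¹) hf
    rw [← mul_assoc y ε, ← h.central ε hε y, ← conj_mul, mul_assoc ε, mul_assoc ε,
      h.conj_lift₃_tri h8, h.conj_lift₃_tri h8, h.conj_lift₃_tri h8, hy0, hy1, hy2, hy3] at this
    · exact this
    all_goals simp [f.injective.eq_iff]
  refine ⟨ε, hε, ?_, hall⟩
  have h1 := hall _ _ _ _ (hnd f)
  have h2 := hall (f 3) (f 1) (f 2) (f 0) (by simp [f.injective.eq_iff])
  have h3 := congrArg (·⁻¹) h1
  simp only [mul_inv_rev] at h3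
  rw [h.inv_lift₃_tri h8, h.inv_lift₃_tri h8, h.inv_lift₃_tri h8, tri_rotate (a := f 2),
    tri_rotate (a := f 2), h2, ← h.central ε⁻¹ (by simp [hε])] at h3
  · have := mul_right_cancel h3
    nth_rw 1 [this]
    simp
  all_goals simp [f.injective.eq_iff]

end IsAltExtension
end Normalized
end AltSpin

namespace AltSpin

open Equiv Equiv.Perm

section Splitting

variable {α : Type*} [Fintype α] [DecidableEq α] {E : Type*} [Group E] {π : E →* Perm α}

/-- The normalized lifts of the three-cycles supported in `S`. -/
def gens (π : E →* Perm α) (S : Finset α) : Set E :=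
  {x | IsNormalized π x ∧ ∀ y ∉ S, π x y = y}

/-- The subgroup generated by the normalized lifts of the three-cycles supported in `S`. -/
def genSubgroup (π : E →* Perm α) (S : Finset α) : Subgroup E := Subgroup.closure (gens π S)

lemma apply_eq_of_mem_genSubgroup {S : Finset α} {x : E} (hx : x ∈ genSubgroup π S) :
    ∀ y ∉ S, π x y = y := by
  intro y hy
  induction hx using Subgroup.closure_induction_left with
  | one => simp
  | mul_left x hx z _ ih => rw [map_mul, Perm.mul_apply, ih, hx.2 y hy]
  | inv_mul_cancel x hx z _ ih =>
    rw [map_mul, Perm.mul_apply, ih, map_inv, Perm.inv_eq_iff_eq, hx.2 y hy]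

namespace IsAltExtension

variable (h : IsAltExtension π) (h8 : 8 ≤ Fintype.card α)
include h h8

lemma lift₃_tri_mem_gens {S : Finset α} {a b d : α} (hl : [a, b, d].Nodup)
    (ha : a ∈ S) (hb : b ∈ S) (hd : d ∈ S) : lift₃ π (tri a b d) ∈ gens π S := by
  refine ⟨(h.lift₃_spec h8 (isThreeCycle_tri ?_ ?_ ?_)).1, fun y hy => ?_⟩
  iterate 3 simp only [List.nodup_cons, List.mem_cons, List.not_mem_nil, or_false, not_or] at hl; tauto
  rw [h.map_lift₃_tri h8 hl]
  simp only [tri, Perm.mul_apply, swap_apply_def]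
  grind

lemma exists_eq_lift₃_tri {S : Finset α} {z : α} {M : E} (hM : M ∈ gens π (insert z S))
    (hz : π M z ≠ z) :
    ∃ u ∈ S, ∃ v ∈ S, [z, u, v].Nodup ∧ M = lift₃ π (tri z u v) := by
  obtain ⟨h1, h2, h3, h4⟩ := eq_tri hM.1.1 hz
  have hu : π M z ∈ insert z S := by
    by_contra hcon
    exact h4 (hM.2 _ hcon).symm
  have hv : π M (π M z) ∈ insert z S := by
    by_contra hcon
    exact h4.symm ((π M).injective (hM.2 _ hcon))
  exact ⟨_, (Finset.mem_insert.1 hu).resolve_left h2.symm, _,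
    (Finset.mem_insert.1 hv).resolve_left h3.symm, by simp [h2, h3, h4], h.eq_lift₃ h8 hM.1 h1⟩

variable (hrel : ∀ z j a b : α, [z, j, a, b].Nodup →
    lift₃ π (tri z j a) * lift₃ π (tri j b a) = lift₃ π (tri z j b))
include hrel

lemma mem_genSubgroup_insert {S : Finset α} {z : α} {x : E}
    (hx : x ∈ genSubgroup π (insert z S)) :
    x ∈ genSubgroup π S ∨ ∃ M ∈ gens π (insert z S), π M z ≠ z ∧ ∃ y ∈ genSubgroup π S,
      x = M * y := by
  have right : ∀ j ∈ S, ∀ w ∈ S, [z, j, w].Nodup → ∀ y ∈ genSubgroup π S,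
      lift₃ π (tri z j w) * y ∈ genSubgroup π S ∨
      ∃ M ∈ gens π (insert z S), π M z ≠ z ∧ ∃ y' ∈ genSubgroup π S,
        lift₃ π (tri z j w) * y = M * y' := by
    intro j hj w hw hl y hy
    refine Or.inr ⟨_, h.lift₃_tri_mem_gens h8 hl (Finset.mem_insert_self _ _)
      (Finset.mem_insert_of_mem hj) (Finset.mem_insert_of_mem hw), ?_, y, hy, rfl⟩
    rw [h.map_lift₃_tri h8 hl]
    simp only [List.nodup_cons, List.mem_cons, List.not_mem_nil, or_false, not_or] at hl
    simp only [tri, Perm.mul_apply, swap_apply_def]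
    grind
  have mem : ∀ a ∈ S, ∀ b ∈ S, ∀ d ∈ S, [a, b, d].Nodup →
      lift₃ π (tri a b d) ∈ genSubgroup π S := fun a ha b hb d hd hl =>
    Subgroup.subset_closure (h.lift₃_tri_mem_gens h8 hl ha hb hd)
  have step : ∀ M₀ ∈ gens π (insert z S), ∀ y, (y ∈ genSubgroup π S ∨
      ∃ M ∈ gens π (insert z S), π M z ≠ z ∧ ∃ y' ∈ genSubgroup π S, y = M * y') →
      M₀ * y ∈ genSubgroup π S ∨ ∃ M ∈ gens π (insert z S), π M z ≠ z ∧
        ∃ y' ∈ genSubgroup π S, M₀ * y = M * y' := by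
    intro M₀ hM₀ y hy
    by_cases hM₀z : π M₀ z = z
    · have hM₀S : M₀ ∈ genSubgroup π S := by
        refine Subgroup.subset_closure ⟨hM₀.1, fun y hy => ?_⟩
        by_cases hyz : y = z
        · rw [hyz, hM₀z]
        · exact hM₀.2 y (by simp [hyz, hy])
      rcases hy with hy | ⟨M, hM, hMz, y', hy', rfl⟩
      · exact Or.inl (mul_mem hM₀S hy)
      · have hinv : (π M₀)⁻¹ z = z := by rw [Perm.inv_eq_iff_eq, hM₀z]
        refine Or.inr ⟨M₀ * M * M₀⁻¹, ⟨hM.1.conj _, fun y hy => ?_⟩, ?_, M₀ * y',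
          mul_mem hM₀S hy', by group⟩
        · have : (π M₀)⁻¹ y = y := by rw [Perm.inv_eq_iff_eq, hM₀.2 y hy]
          simp only [map_mul, map_inv, Perm.mul_apply, this, hM.2 y hy, hM₀.2 y hy]
        · simp only [map_mul, map_inv, Perm.mul_apply, hinv]
          nth_rw 2 [← hM₀z]
          exact (π M₀).injective.ne hMz
    · obtain ⟨u, hu, v, hv, huv, hM₀'⟩ := h.exists_eq_lift₃_tri h8 hM₀ hM₀z
      rcases hy with hy | ⟨M, hM, hMz, y', hy', rfl⟩
      · exact Or.inr ⟨M₀, hM₀, hM₀z, y, hy, rfl⟩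
      obtain ⟨j, hj, w, hw, hjw, hM'⟩ := h.exists_eq_lift₃_tri h8 hM hMz
      have nodup₃ : ∀ {a b d : α}, [a, b, d].Nodup ↔ a ≠ b ∧ a ≠ d ∧ b ≠ d := by
        intro a b d; simp [and_assoc]
      have nodup₄ : ∀ {a b d e : α}, [a, b, d, e].Nodup ↔
          a ≠ b ∧ a ≠ d ∧ a ≠ e ∧ b ≠ d ∧ b ≠ e ∧ d ≠ e := by
        intro a b d e; simp [and_assoc]
      obtain ⟨hzu, hzv, huv'⟩ := nodup₃.1 huv
      obtain ⟨hzj, hzw, hjw'⟩ := nodup₃.1 hjw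
      have hinv : M₀⁻¹ = lift₃ π (tri z v u) := by
        rw [hM₀', h.inv_lift₃_tri h8 huv, tri_rotate huv'.symm hzv.symm hzu.symm,
          tri_rotate hzu.symm huv' hzv]
      have hM₀3 : M₀ * M₀ = M₀⁻¹ := by
        rw [eq_inv_iff_mul_eq_one, ← hM₀.1.2.1, pow_succ, pow_two]
      subst hM'
      by_cases hjv : j = v
      · subst hjv
        by_cases hwu : w = u
        · subst hwu
          rw [← hinv, mul_inv_cancel_left]
          exact Or.inl hy'
        · rw [← hrel z j u w (nodup₄.2 ⟨hzj, hzu, hzw, huv'.symm, hjw', Ne.symm hwu⟩), ← hinv,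
            mul_assoc, mul_inv_cancel_left]
          exact Or.inl (mul_mem (mem _ hj _ hw _ hu (nodup₃.2 ⟨hjw', huv'.symm, hwu⟩)) hy')
      by_cases hju : j = u
      · subst hju
        by_cases hwv : w = v
        · subst hwv
          rw [← hM₀', ← mul_assoc, hM₀3, hinv]
          exact right _ hv _ hu (nodup₃.2 ⟨hzv, hzu, huv'.symm⟩) _ hy'
        · rw [← hrel z j v w (nodup₄.2 ⟨hzj, hzv, hzw, huv', hjw', Ne.symm hwv⟩), ← hM₀',
            ← mul_assoc, ← mul_assoc, hM₀3, hinv, mul_assoc]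
          exact right _ hv _ hu (nodup₃.2 ⟨hzv, hzu, huv'.symm⟩) _
            (mul_mem (mem _ hu _ hw _ hv (nodup₃.2 ⟨hjw', huv', hwv⟩)) hy')
      have hmul : M₀ * lift₃ π (tri z j u) = lift₃ π (tri z j v) := by
        rw [hM₀', ← tri_rotate hzv.symm huv'.symm hzu,
          hrel v z u j (nodup₄.2 ⟨hzv.symm, huv'.symm, Ne.symm hjv, hzu, hzj, Ne.symm hju⟩),
          tri_rotate hzv.symm (Ne.symm hjv) hzj]
      by_cases hwu : w = u
      · subst hwu
        rw [← mul_assoc, hmul]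
        exact right _ hj _ hv (nodup₃.2 ⟨hzj, hzv, hjv⟩) _ hy'
      · rw [← hrel z j u w (nodup₄.2 ⟨hzj, hzu, hzw, hju, hjw', Ne.symm hwu⟩), ← mul_assoc,
          ← mul_assoc, hmul, mul_assoc]
        exact right _ hj _ hv (nodup₃.2 ⟨hzj, hzv, hjv⟩) _
          (mul_mem (mem _ hj _ hw _ hu (nodup₃.2 ⟨hjw', hju, hwu⟩)) hy')
  rw [genSubgroup] at hx
  induction hx using Subgroup.closure_induction_left with
  | one => exact Or.inl (one_mem _)
  | mul_left x hx y _ ih => exact step x hx y ih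
  | inv_mul_cancel x hx y _ ih =>
    exact step x⁻¹ ⟨hx.1.inv, fun y hy => by rw [map_inv, Perm.inv_eq_iff_eq, hx.2 y hy]⟩ y ih

lemma eq_one_of_mem_genSubgroup (S : Finset α) : ∀ {x : E}, x ∈ genSubgroup π S → π x = 1 →
    x = 1 := by
  induction S using Finset.induction_on with
  | empty =>
    intro x hx _
    have : gens π (∅ : Finset α) = ∅ := by
      ext M
      simp only [Set.mem_empty_iff_false, iff_false]
      exact fun hM => hM.1.1.ne_one (Equiv.ext fun y => hM.2 y (by simp))
    simpa [genSubgroup, this] using hx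
  | insert z S hz ih =>
    intro x hx hx1
    rcases h.mem_genSubgroup_insert h8 hrel hx with hx | ⟨M, _, hM, y, hy, rfl⟩
    · exact ih hx hx1
    · have := congrArg (· z) hx1
      simp only [map_mul, Perm.mul_apply, apply_eq_of_mem_genSubgroup hy z hz,
        Perm.one_apply] at this
      exact absurd this hM

/-- If the ratio is trivial then the extension splits. -/
lemma exists_section : ∃ s : alternatingGroup α →* E, ∀ σ, π (s σ) = σ := by
  let f : genSubgroup π Finset.univ →* alternatingGroup α :=
    (π.comp (Subgroup.subtype _)).codRestrict _ fun x => h.sign_map x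
  have hf : Function.Bijective f := by
    constructor
    · rw [injective_iff_map_eq_one]
      intro x hx
      exact Subtype.ext (h.eq_one_of_mem_genSubgroup h8 hrel _ x.2 (congrArg Subtype.val hx))
    · rintro ⟨σ, hσ⟩
      have : σ ∈ (genSubgroup π Finset.univ).map π := by
        rw [← closure_three_cycles_eq_alternating] at hσ
        refine (Subgroup.closure_le _).2 (fun τ hτ => ?_) hσ
        exact ⟨lift₃ π τ, Subgroup.subset_closure ⟨(h.lift₃_spec h8 hτ).1, by simp⟩,
          h.map_lift₃ h8 hτ⟩
      obtain ⟨x, hx, rfl⟩ := this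
      exact ⟨⟨x, hx⟩, rfl⟩
  let e := MulEquiv.ofBijective f hf
  refine ⟨(Subgroup.subtype _).comp e.symm.toMonoidHom, fun σ => ?_⟩
  exact congrArg Subtype.val (e.apply_symm_apply σ)

end IsAltExtension
end Splitting
end AltSpin

namespace AltSpin

open Equiv Equiv.Perm

section Anticommutation

variable {α : Type*} [Fintype α] [DecidableEq α] {E : Type*} [Group E] {π : E →* Perm α}

namespace IsAltExtension

variable (h : IsAltExtension π) (h8 : 8 ≤ Fintype.card α) {ε : E} (hε : π ε = 1)
  (hε2 : ε * ε = 1) (hrel : ∀ z j a b : α, [z, j, a, b].Nodup →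
    lift₃ π (tri z j a) * lift₃ π (tri j b a) = ε * lift₃ π (tri z j b))
include h

lemma mul_eq_of_map_eq {x y x' y' c : E} (hc : π c = 1) (hx : π x = π x') (hy : π y = π y')
    (hxy : x' * y' = c * (y' * x')) : x * y = c * (y * x) := by
  obtain ⟨z, hz, rfl⟩ := exists_mul_eq hx
  obtain ⟨w, hw, rfl⟩ := exists_mul_eq hy
  calc z * x' * (w * y') = z * w * (x' * y') := by
        rw [mul_assoc, ← mul_assoc x', ← h.central w hw x']; group
    _ = z * w * c * (y' * x') := by rw [hxy]; group
    _ = c * (w * z * (y' * x')) := by rw [h.central z hz w, ← h.central c hc]; group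
    _ = c * (w * y' * (z * x')) := by rw [mul_assoc w z, ← mul_assoc z, h.central z hz y']; group

include h8 hε hε2 hrel

lemma lift_klein_mul {z j a b : α} (hl : [z, j, a, b].Nodup) {u v : E}
    (hu : π u = swap z a * swap j b) (hv : π v = swap z j * swap a b) :
    u * v = ε * (v * u) := by
  have hl' := hl
  simp only [List.nodup_cons, List.mem_cons, List.not_mem_nil, or_false, not_or] at hl'
  obtain ⟨⟨hzj, hza, hzb⟩, ⟨hja, hjb⟩, hab, -, -⟩ := hl'
  have hX := h.lift₃_spec h8 (isThreeCycle_tri hzj hza hja)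
  have hY := h.lift₃_spec h8 (isThreeCycle_tri hzj hzb hjb)
  have hXY : lift₃ π (tri z j a) * lift₃ π (tri z j b) * (lift₃ π (tri z j a))⁻¹ =
      lift₃ π (tri j a b) := by
    rw [h.conj_lift₃_tri h8 (by simp [hzj, hzb, hjb]), hX.2]
    congr 1
    congr 1 <;> simp only [tri, Perm.mul_apply, swap_apply_def] <;> grind
  have hXYX : lift₃ π (tri z j a) * lift₃ π (tri z j b) * (lift₃ π (tri z j a))⁻¹ *
      (lift₃ π (tri z j a))⁻¹ = ε * (lift₃ π (tri z j b))⁻¹ := by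
    rw [hXY, h.inv_lift₃_tri h8 (by simp [hzj, hza, hja]),
      h.inv_lift₃_tri h8 (by simp [hzj, hzb, hjb]), ← hrel b j a z (by grind),
      tri_rotate hja hjb hab, tri_rotate hab (Ne.symm hja) (Ne.symm hjb),
      tri_rotate (Ne.symm hja) (Ne.symm hza) (Ne.symm hzj)]
  generalize lift₃ π (tri z j a) = X at *
  generalize lift₃ π (tri z j b) = Y at *
  have hX2 : X * X = X⁻¹ := by rw [eq_inv_iff_mul_eq_one, ← hX.1.2.1, pow_succ, pow_two]
  have hY2 : Y * Y = Y⁻¹ := by rw [eq_inv_iff_mul_eq_one, ← hY.1.2.1, pow_succ, pow_two]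
  have hX2' : X⁻¹ * X⁻¹ = X := by rw [← mul_inv_rev, hX2, inv_inv]
  rw [mul_assoc, hX2'] at hXYX
  refine h.mul_eq_of_map_eq hε (x' := X * Y) (y' := X * (X * Y) * X⁻¹) ?_ ?_ ?_
  · rw [hu, map_mul, hX.2, hY.2]
    ext t
    simp only [tri, Perm.mul_apply, swap_apply_def]
    grind
  · have h1 : π (X * Y) = swap z a * swap j b := by
      rw [map_mul, hX.2, hY.2]
      ext t
      simp only [tri, Perm.mul_apply, swap_apply_def]
      grind
    rw [hv, map_mul, map_mul π X (X * Y), map_inv, h1, ← conj_mul, ← swap_apply_apply,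
      ← swap_apply_apply, hX.2, swap_comm z j]
    congr 1 <;> congr 1 <;> simp only [tri, Perm.mul_apply, swap_apply_def] <;> grind
  · have h1 : X * Y = ε * (Y⁻¹ * X⁻¹) := by
      rw [← mul_assoc, ← hXYX]; group
    calc X * Y * (X * (X * Y) * X⁻¹) = X * Y * (X * X) * Y * X⁻¹ := by group
      _ = ε * (Y⁻¹ * X⁻¹) * X⁻¹ * Y * X⁻¹ := by rw [hX2, h1]
      _ = ε * (Y⁻¹ * (X⁻¹ * X⁻¹) * Y * X⁻¹) := by group
      _ = ε * (Y⁻¹ * (X * Y) * X⁻¹) := by rw [hX2']; group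
      _ = ε * (ε * Y⁻¹ * (Y⁻¹ * X⁻¹) * X⁻¹) := by
        rw [h1, ← mul_assoc Y⁻¹, h.central ε hε Y⁻¹]
      _ = ε * ε * (Y * Y)⁻¹ * (X⁻¹ * X⁻¹) := by group
      _ = Y * X := by rw [hX2', hY2, hε2]; group
      _ = X⁻¹ * (X * Y * X) := by group
      _ = ε * (X⁻¹ * (Y * Y)) := by
        rw [hXYX, hY2, ← mul_assoc, ← h.central ε hε, mul_assoc]
      _ = ε * (X * X * Y * Y) := by rw [hX2]; group
      _ = _ := by group

lemma lift_double_swap_mul {a b p q r s : α} (hl : [a, b, p, q, r, s].Nodup) {u v : E}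
    (hu : π u = swap a b * swap r s) (hv : π v = swap a b * swap p q) :
    u * v = ε * (v * u) := by
  have hl' := hl
  simp only [List.nodup_cons, List.mem_cons, List.not_mem_nil, or_false, not_or] at hl'
  obtain ⟨w, hw⟩ := h.exists_lift (swap a r * swap b s) (by
    rw [map_mul, sign_swap (by tauto), sign_swap (by tauto)]; rfl)
  have huw := h.lift_klein_mul h8 hε hε2 hrel (z := a) (j := r) (a := b) (b := s)
    (by simp; tauto) hu hw
  have h1 : π (w * v * (w * v)) = π u := by
    rw [map_mul, map_mul, hu, hv, hw]
    have hW : swap a r * swap b s * (swap a r * swap b s) = 1 := by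
      ext t
      simp only [Perm.mul_apply, swap_apply_def, Perm.one_apply]
      grind
    have hconj : swap a r * swap b s * (swap a b * swap p q) * (swap a r * swap b s)⁻¹ =
        swap r s * swap p q := by
      rw [← conj_mul, ← swap_apply_apply, ← swap_apply_apply]
      congr 1 <;> congr 1 <;> simp only [Perm.mul_apply, swap_apply_def] <;> grind
    have hcomm : swap p q * swap a b = swap a b * swap p q :=
      (disjoint_swap_swap (by simp; tauto)).commute
    have hcomm' : swap r s * swap a b = swap a b * swap r s :=
      (disjoint_swap_swap (by simp; tauto)).commute
    generalize swap a r * swap b s = W at *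
    rw [← hcomm']
    calc W * (swap a b * swap p q) * (W * (swap a b * swap p q)) =
        W * (swap a b * swap p q) * W⁻¹ * (W * W) * (swap a b * swap p q) := by group
      _ = swap r s * (swap p q * swap a b) * swap p q := by rw [hW, hconj]; group
      _ = swap r s * swap a b * (swap p q * swap p q) := by rw [hcomm]; group
      _ = _ := by rw [swap_mul_self, mul_one]
  obtain ⟨ζ, hζ, h2⟩ := exists_mul_eq h1.symm
  have h3 : u * (w * v) = w * v * u := by
    rw [h2, mul_assoc, ← mul_assoc (w * v) ζ, ← h.central ζ hζ (w * v)]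
    group
  have h4 : w * (ε * (u * v)) = w * (v * u) := by
    calc w * (ε * (u * v)) = ε * (w * u) * v := by
          rw [← mul_assoc w ε, ← h.central ε hε]; group
      _ = _ := by rw [← huw, mul_assoc, h3]; group
  have h5 := mul_left_cancel h4
  rw [← h5, ← mul_assoc, hε2, one_mul]

end IsAltExtension
end Anticommutation
end AltSpin

namespace AltSpin

open Equiv Equiv.Perm

section Spin

variable {α : Type*} [Fintype α] [DecidableEq α] {E : Type*} [Group E]

/-- A central extension of the alternating group with a central involution `ε` such that lifts of
suitable commuting double transpositions commute up to `ε`. -/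
structure IsSpinExtension (π : E →* Perm α) (ε : E) : Prop extends IsAltExtension π where
  card_le : 8 ≤ Fintype.card α
  map_eps : π ε = 1
  eps_mul_eps : ε * ε = 1
  klein : ∀ z j a b : α, [z, j, a, b].Nodup → ∀ u v : E, π u = swap z a * swap j b →
    π v = swap z j * swap a b → u * v = ε * (v * u)
  double : ∀ a b p q r s : α, [a, b, p, q, r, s].Nodup → ∀ u v : E, π u = swap a b * swap r s →
    π v = swap a b * swap p q → u * v = ε * (v * u)

/-- A central extension of the alternating group either splits or is a spin extension. -/
theorem IsAltExtension.exists_section_or_isSpinExtension {π : E →* Perm α}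
    (h : IsAltExtension π) (h8 : 8 ≤ Fintype.card α) :
    (∃ s : alternatingGroup α →* E, ∀ σ, π (s σ) = σ) ∨ ∃ ε ≠ 1, IsSpinExtension π ε := by
  obtain ⟨ε, hε, hε2, hrel⟩ := h.exists_ratio h8
  by_cases h1 : ε = 1
  · subst h1
    exact Or.inl (h.exists_section h8 (by simpa using hrel))
  · exact Or.inr ⟨ε, h1, h, h8, hε, hε2, fun _ _ _ _ hl _ _ => h.lift_klein_mul h8 hε hε2 hrel hl,
      fun _ _ _ _ _ _ hl _ _ => h.lift_double_swap_mul h8 hε hε2 hrel hl⟩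

/-- Permutations supported in `B` are products of transpositions supported in `B`. -/
lemma support_induction (B : Finset α) {P : Perm α → Prop} (one : P 1)
    (mul : ∀ σ τ, P σ → P τ → P (σ * τ)) (swap : ∀ a ∈ B, ∀ b ∈ B, a ≠ b → P (swap a b))
    {σ : Perm α} (hσ : ∀ x ∉ B, σ x = x) : P σ := by
  have hB : ∀ x, σ x ≠ x → x ∈ B := fun x hx => by_contra fun h => hx (hσ x h)
  have hB' : ∀ x, σ x ∈ B ↔ x ∈ B := by
    intro x
    by_cases h : σ x = x
    · rw [h]
    · exact iff_of_true (hB _ fun h' => h (σ.injective h')) (hB _ h)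
  rw [← ofSubtype_subtypePerm hB' hB]
  generalize σ.subtypePerm hB' = τ
  induction τ using swap_induction_on with
  | one => simpa using one
  | swap_mul f a b hab ih =>
    rw [map_mul, ofSubtype_swap_eq]
    exact mul _ _ (swap _ a.2 _ b.2 (Subtype.coe_injective.ne hab)) ih

/-- The even permutation attached to a permutation fixing `a₀` and `a₁`. -/
def evenize (a₀ a₁ : α) (σ : Perm α) : Perm α := (if sign σ = 1 then 1 else swap a₀ a₁) * σ

lemma evenize_of_sign_eq_one (a₀ a₁ : α) {σ : Perm α} (hσ : sign σ = 1) :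
    evenize a₀ a₁ σ = σ := by
  simp [evenize, hσ]

lemma evenize_swap (a₀ a₁ : α) {p q : α} (hpq : p ≠ q) :
    evenize a₀ a₁ (swap p q) = swap a₀ a₁ * swap p q := by
  simp [evenize, sign_swap hpq]

lemma sign_evenize {a₀ a₁ : α} (h01 : a₀ ≠ a₁) (σ : Perm α) : sign (evenize a₀ a₁ σ) = 1 := by
  rcases Int.units_eq_one_or (sign σ) with hσ | hσ <;> simp [evenize, hσ, sign_swap h01]

omit [Fintype α] in
lemma swap_mul_comm_of_apply_eq {a₀ a₁ : α} {σ : Perm α} (h0 : σ a₀ = a₀) (h1 : σ a₁ = a₁) :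
    σ * swap a₀ a₁ = swap a₀ a₁ * σ := by
  rw [← mul_inv_eq_iff_eq_mul, ← swap_apply_apply, h0, h1]

lemma evenize_mul {a₀ a₁ : α} {σ τ : Perm α} (h0 : σ a₀ = a₀) (h1 : σ a₁ = a₁) :
    evenize a₀ a₁ (σ * τ) = evenize a₀ a₁ σ * evenize a₀ a₁ τ := by
  have hc := swap_mul_comm_of_apply_eq h0 h1
  have hne : (-1 : ℤˣ) ≠ 1 := by decide
  rcases Int.units_eq_one_or (sign σ) with hσ | hσ <;>
    rcases Int.units_eq_one_or (sign τ) with hτ | hτ <;>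
    simp only [evenize, map_mul, hσ, hτ, one_mul, mul_one, neg_mul_neg, if_true, if_neg hne]
  · rw [← mul_assoc, ← hc, mul_assoc]
  · rw [mul_assoc]
  · rw [mul_assoc, ← mul_assoc σ, hc, mul_assoc, swap_mul_self_mul]

/-- The central element by which lifts of evenized permutations of given signs and disjoint supports
commute. -/
def commFactor (ε : E) (s t : ℤˣ) : E := if s = -1 ∧ t = -1 then ε else 1

namespace IsSpinExtension

variable {π : E →* Perm α} {ε : E} (h : IsSpinExtension π ε)
include h

lemma commFactor_mul (s s' t : ℤˣ) :
    commFactor ε (s * s') t = commFactor ε s t * commFactor ε s' t := by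
  rcases Int.units_eq_one_or s with rfl | rfl <;>
    rcases Int.units_eq_one_or s' with rfl | rfl <;>
    rcases Int.units_eq_one_or t with rfl | rfl <;> simp [commFactor, h.eps_mul_eps]

lemma map_commFactor (s t : ℤˣ) : π (commFactor ε s t) = 1 := by
  rw [commFactor]; split_ifs <;> simp [h.map_eps]

lemma commFactor_mul_self (s t : ℤˣ) : commFactor ε s t * commFactor ε s t = 1 := by
  rw [commFactor]; split_ifs <;> simp [h.eps_mul_eps]

lemma commFactor_mul_mul_self (s t : ℤˣ) (x : E) :
    commFactor ε s t * (commFactor ε s t * x) = x := by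
  rw [← mul_assoc, h.commFactor_mul_self, one_mul]

/-- Lifts of evenized permutations with disjoint supports commute up to a power of `ε`. -/
lemma evenize_commute {a₀ a₁ : α} (h01 : a₀ ≠ a₁) {B C : Finset α} (hBC : Disjoint B C)
    (hB0 : a₀ ∉ B) (hB1 : a₁ ∉ B) (hC0 : a₀ ∉ C) (hC1 : a₁ ∉ C) {σ τ : Perm α}
    (hσ : ∀ x ∉ B, σ x = x) (hτ : ∀ x ∉ C, τ x = x) {x y : E} (hx : π x = evenize a₀ a₁ σ)
    (hy : π y = evenize a₀ a₁ τ) : x * y = commFactor ε (sign σ) (sign τ) * (y * x) := by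
  let R : Perm α → Perm α → Prop := fun σ τ => (σ a₀ = a₀ ∧ σ a₁ = a₁) ∧
    ∀ x y, π x = evenize a₀ a₁ σ → π y = evenize a₀ a₁ τ →
      x * y = commFactor ε (sign σ) (sign τ) * (y * x)
  have R_one : ∀ τ, R 1 τ := fun τ => ⟨by simp, fun x y hx _ => by
    rw [evenize_of_sign_eq_one _ _ (map_one _)] at hx
    simp [commFactor, h.central x hx]⟩
  have R_mul : ∀ τ σ σ', R σ τ → R σ' τ → R (σ * σ') τ := by
    rintro τ σ σ' ⟨⟨h1, h2⟩, h3⟩ ⟨⟨h1', h2'⟩, h3'⟩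
    refine ⟨⟨by simp [h1, h1'], by simp [h2, h2']⟩, fun x y hx hy => ?_⟩
    obtain ⟨w, hw⟩ := h.exists_lift _ (sign_evenize h01 σ')
    have hv : π (x * w⁻¹) = evenize a₀ a₁ σ := by
      rw [map_mul, map_inv, hx, hw, evenize_mul h1 h2, mul_inv_cancel_right]
    calc x * y = x * w⁻¹ * (w * y) := by group
      _ = commFactor ε (sign σ') (sign τ) * (x * w⁻¹ * y) * w := by
        rw [h3' _ _ hw hy, ← mul_assoc (x * w⁻¹), ← h.central _ (h.map_commFactor _ _)]; group
      _ = commFactor ε (sign σ') (sign τ) * commFactor ε (sign σ) (sign τ) * (y * x) := by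
        rw [h3 _ _ hv hy]; group
      _ = _ := by
        rw [map_mul, h.commFactor_mul, h.central _ (h.map_commFactor (sign σ') _)]
  have R_symm : ∀ σ τ, τ a₀ = a₀ ∧ τ a₁ = a₁ → R σ τ → R τ σ := by
    rintro σ τ hτ ⟨-, hR⟩
    refine ⟨hτ, fun x y hx hy => ?_⟩
    have hcomm : commFactor ε (sign τ) (sign σ) = commFactor ε (sign σ) (sign τ) := by
      simp only [commFactor, and_comm]
    rw [hR y x hy hx, hcomm, h.commFactor_mul_mul_self]
  have R_swap : ∀ p ∈ B, ∀ q ∈ B, p ≠ q → ∀ r ∈ C, ∀ s ∈ C, r ≠ s → R (swap r s) (swap p q) := by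
    intro p hp q hq hpq r hr s hs hrs
    have hne : ∀ x ∈ B, x ≠ a₀ ∧ x ≠ a₁ := fun x hx =>
      ⟨fun h' => hB0 (h' ▸ hx), fun h' => hB1 (h' ▸ hx)⟩
    have hne' : ∀ x ∈ C, x ≠ a₀ ∧ x ≠ a₁ := fun x hx =>
      ⟨fun h' => hC0 (h' ▸ hx), fun h' => hC1 (h' ▸ hx)⟩
    have hne'' : ∀ x ∈ B, ∀ y ∈ C, x ≠ y := fun x hx y hy => Finset.disjoint_iff_ne.1 hBC x hx y hy
    have hp' := hne p hp
    have hq' := hne q hq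
    have hr' := hne' r hr
    have hs' := hne' s hs
    have hpr := hne'' p hp r hr
    have hps := hne'' p hp s hs
    have hqr := hne'' q hq r hr
    have hqs := hne'' q hq s hs
    refine ⟨⟨swap_apply_of_ne_of_ne hr'.1.symm hs'.1.symm,
      swap_apply_of_ne_of_ne hr'.2.symm hs'.2.symm⟩, fun x y hx hy => ?_⟩
    rw [evenize_swap _ _ hrs] at hx
    rw [evenize_swap _ _ hpq] at hy
    rw [h.double a₀ a₁ p q r s (by simp [h01, hpq, hrs, hpr, hps, hqr, hqs, hp'.1.symm, hp'.2.symm,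
      hq'.1.symm, hq'.2.symm, hr'.1.symm, hr'.2.symm, hs'.1.symm, hs'.2.symm]) x y hx hy,
      sign_swap hrs, sign_swap hpq, commFactor, if_pos ⟨rfl, rfl⟩]
  have step : ∀ p ∈ B, ∀ q ∈ B, p ≠ q → R τ (swap p q) := fun p hp q hq hpq =>
    support_induction (P := fun τ => R τ (swap p q)) C (R_one _) (R_mul _)
      (fun r hr s hs => R_swap p hp q hq hpq r hr s hs) hτ
  exact (support_induction (P := fun σ => R σ τ) B (R_one _) (R_mul _)
    (fun p hp q hq hpq => R_symm _ _ ⟨swap_apply_of_ne_of_ne (fun h' => hB0 (h' ▸ hp))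
      (fun h' => hB0 (h' ▸ hq)), swap_apply_of_ne_of_ne (fun h' => hB1 (h' ▸ hp))
      (fun h' => hB1 (h' ▸ hq))⟩ (step p hp q hq hpq)) hσ).2 x y hx hy

end IsSpinExtension

end Spin
end AltSpin

namespace AltSpin

section Clifford

variable {k 𝒜 : Type*} [Field k] [Ring 𝒜] [Algebra k 𝒜]

/-- Two elements of a ring anticommute. -/
def Anticommute (a b : 𝒜) : Prop := a * b = -(b * a)

omit [Field k] [Algebra k 𝒜] in
lemma Anticommute.symm {a b : 𝒜} (h : Anticommute a b) : Anticommute b a := by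
  rw [Anticommute, show a * b = -(b * a) from h, neg_neg]

lemma Anticommute.sub_left {a b e : 𝒜} (ha : Anticommute a e) (hb : Anticommute b e) :
    Anticommute (a - b) e := by
  unfold Anticommute at *
  rw [sub_mul, mul_sub, ha, hb]; abel

/-- An element of a `k`-algebra is a nonzero scalar. -/
def IsScalar (k : Type*) {𝒜 : Type*} [Field k] [Ring 𝒜] [Algebra k 𝒜] (a : 𝒜) : Prop :=
  ∃ c : k, c ≠ 0 ∧ a = algebraMap k 𝒜 c

lemma IsScalar.commute {a : 𝒜} (ha : IsScalar k a) (x : 𝒜) : a * x = x * a := by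
  obtain ⟨c, -, rfl⟩ := ha
  exact Algebra.commutes c x

lemma IsScalar.mul {a b : 𝒜} (ha : IsScalar k a) (hb : IsScalar k b) : IsScalar k (a * b) := by
  obtain ⟨c, hc, rfl⟩ := ha
  obtain ⟨d, hd, rfl⟩ := hb
  exact ⟨c * d, mul_ne_zero hc hd, (map_mul _ _ _).symm⟩

lemma IsScalar.neg {a : 𝒜} (ha : IsScalar k a) : IsScalar k (-a) := by
  obtain ⟨c, hc, rfl⟩ := ha
  exact ⟨-c, neg_ne_zero.2 hc, (map_neg _ _).symm⟩

lemma IsScalar.add_self {a : 𝒜} (ha : IsScalar k a) (h2 : (2 : k) ≠ 0) : IsScalar k (a + a) := by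
  obtain ⟨c, hc, rfl⟩ := ha
  exact ⟨2 * c, mul_ne_zero h2 hc, by rw [two_mul, map_add]⟩

/-- A list of pairwise anticommuting elements whose squares are nonzero scalars. -/
def IsCliffordList (k : Type*) {𝒜 : Type*} [Field k] [Ring 𝒜] [Algebra k 𝒜] (l : List 𝒜) : Prop :=
  (∀ F ∈ l, IsScalar k (F * F)) ∧ l.Pairwise Anticommute

lemma prod_mul_of_anticommute {L : List 𝒜} {e : 𝒜} (hL : ∀ d ∈ L, Anticommute d e) :
    L.prod * e = (-1 : ℤ) ^ L.length • (e * L.prod) := by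
  induction L with
  | nil => simp
  | cons d L ih =>
    rw [List.prod_cons, mul_assoc, ih fun x hx => hL x (List.mem_cons_of_mem _ hx), mul_smul_comm,
      ← mul_assoc, hL d List.mem_cons_self, List.length_cons, pow_succ]
    simp [mul_assoc]

lemma isScalar_prod_mul_prod {L : List 𝒜} (hL : IsCliffordList k L) :
    IsScalar k (L.prod * L.prod) := by
  induction L with
  | nil => exact ⟨1, one_ne_zero, by simp⟩
  | cons d L ih =>
    obtain ⟨h1, h2⟩ := hL
    rw [List.pairwise_cons] at h2
    have := prod_mul_of_anticommute (L := L) (e := d) fun x hx => (h2.1 x hx).symm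
    rw [List.prod_cons, mul_assoc, ← mul_assoc L.prod, this]
    have hs := (h1 d List.mem_cons_self).mul
      (ih ⟨fun F hF => h1 F (List.mem_cons_of_mem _ hF), h2.2⟩)
    rcases neg_one_pow_eq_or ℤ L.length with h | h
    · simpa [h, mul_assoc] using hs
    · simpa [h, mul_assoc] using hs.neg

lemma prod_map_mul_of_mem {l : List 𝒜} {b d : 𝒜 → 𝒜}
    (hp : l.Pairwise fun F G => Anticommute (d G) F ∧ Anticommute (d F) (b G))
    (hs : ∀ F ∈ l, d F * F = -(b F * d F)) {e : 𝒜} (he : e ∈ l) :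
    (l.map d).prod * e = (-1 : ℤ) ^ l.length • (b e * (l.map d).prod) := by
  induction l with
  | nil => simp at he
  | cons c l ih =>
    rw [List.pairwise_cons] at hp
    rw [List.map_cons, List.prod_cons, mul_assoc, List.length_cons, pow_succ]
    rcases List.mem_cons.1 he with rfl | he
    · rw [prod_mul_of_anticommute (fun x hx => by
        obtain ⟨G, hG, rfl⟩ := List.mem_map.1 hx
        exact (hp.1 G hG).1), mul_smul_comm, ← mul_assoc, hs _ List.mem_cons_self]
      simp [mul_assoc]
    · rw [ih hp.2 (fun F hF => hs F (List.mem_cons_of_mem _ hF)) he, mul_smul_comm, ← mul_assoc,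
        (hp.1 e he).2]
      simp [mul_assoc]

/-- Two conjugate and mutually anticommuting Clifford lists of odd length can be merged, with one
additional element. -/
lemma IsCliffordList.double {l : List 𝒜} (hl : IsCliffordList k l) (hodd : Odd l.length)
    (h2 : (2 : k) ≠ 0) {W W' : 𝒜} (hW : W * W' = 1) (hW' : W' * W = 1) (hWW : IsScalar k (W * W))
    (hcross : ∀ F ∈ l, ∀ G ∈ l, Anticommute F (W * G * W')) :
    IsCliffordList k ((W * (l.map fun F => F - W * F * W').prod) ::
      (l ++ l.map fun F => W * F * W')) := by
  obtain ⟨b, hb⟩ : ∃ b : 𝒜 → 𝒜, b = fun F => W * F * W' := ⟨_, rfl⟩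
  obtain ⟨d, hd⟩ : ∃ d : 𝒜 → 𝒜, d = fun F => F - b F := ⟨_, rfl⟩
  have hb' : ∀ F, W * F * W' = b F := fun F => by rw [hb]
  have hd' : ∀ F, F - b F = d F := fun F => by rw [hd]
  simp only [hb', hd'] at hcross ⊢
  have b_mul : ∀ x y, b x * b y = b (x * y) := fun x y => by
    simp only [← hb', mul_assoc]
    rw [← mul_assoc W' W, hW', one_mul]
  have W_mul : ∀ x, W * x = b x * W := fun x => by
    rw [← hb', mul_assoc, hW', mul_one]
  have bb : ∀ x, b (b x) = x := fun x => by
    simp only [← hb', mul_assoc]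
    rw [← mul_assoc W W, hWW.commute, mul_assoc, mul_assoc, ← mul_assoc W' W, hW', one_mul,
      hW', mul_one]
  have b_neg : ∀ x, b (-x) = -b x := fun x => by simp [← hb']
  have b_anti : ∀ {x y}, Anticommute x y → Anticommute (b x) (b y) := fun hxy => by
    rw [Anticommute, b_mul, b_mul, hxy, b_neg]
  have b_scalar : ∀ {x}, IsScalar k x → b x = x := fun hx => by
    rw [← hb', ← hx.commute, mul_assoc, hW, mul_one]
  have b_sub : ∀ x y, b (x - y) = b x - b y := fun x y => by simp only [← hb', mul_sub, sub_mul]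
  have b_d : ∀ x, b (d x) = -d x := fun x => by
    rw [← hd', b_sub, bb, neg_sub]
  have b_sq : ∀ F ∈ l, b F * b F = F * F := fun F hF => by
    rw [b_mul, b_scalar (hl.1 F hF)]
  have d_self : ∀ F ∈ l, d F * F = -(b F * d F) := fun F hF => by
    rw [← hd', sub_mul, mul_sub, b_sq F hF]; abel
  have d_sq : ∀ F ∈ l, d F * d F = F * F + F * F := fun F hF => by
    rw [← hd', sub_mul, mul_sub, mul_sub, b_sq F hF, hcross F hF F hF]; abel
  have hlen := hodd.neg_one_pow (α := ℤ)
  have pair : l.Pairwise fun F G => Anticommute (d G) F ∧ Anticommute (d F) (b G) := by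
    refine hl.2.imp_of_mem fun {F G} hF hG hFG => ?_
    simp only [← hd']
    exact ⟨hFG.symm.sub_left (hcross F hF G hG).symm, (hcross F hF G hG).sub_left (b_anti hFG)⟩
  have pair_d : (l.map d).Pairwise Anticommute := by
    rw [List.pairwise_map]
    refine (pair.and hl.2).imp_of_mem fun {F G} hF hG h => ?_
    rw [← hd' G]
    have h1 := h.1.2
    have : Anticommute (d F) G := by
      rw [← hd']
      refine h.2.sub_left ?_
      exact (hcross G hG F hF).symm
    exact (this.symm.sub_left h1.symm).symm
  have hD : ∀ e ∈ l, (l.map d).prod * e = -(b e * (l.map d).prod) := fun e he => by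
    rw [prod_map_mul_of_mem pair d_self he, hlen, neg_one_smul]
  have hDW : W * (l.map d).prod = -((l.map d).prod * W) := by
    rw [prod_mul_of_anticommute (e := W), List.length_map, hlen, neg_one_smul, neg_neg]
    intro x hx
    obtain ⟨F, hF, rfl⟩ := List.mem_map.1 hx
    rw [Anticommute, W_mul, b_d, neg_mul, neg_neg]
  have hbD : b (l.map d).prod = -(l.map d).prod := by
    rw [← hb', hDW, neg_mul, mul_assoc, hW, mul_one]
  have hD' : ∀ e ∈ l, (l.map d).prod * b e = -(e * (l.map d).prod) := fun e he => by
    have := congrArg b (hD e he)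
    rw [b_neg, ← b_mul, ← b_mul, bb, hbD, neg_mul, neg_inj] at this
    rw [this, mul_neg]
  have hDD : IsScalar k ((l.map d).prod * (l.map d).prod) := by
    refine isScalar_prod_mul_prod ⟨fun x hx => ?_, pair_d⟩
    obtain ⟨F, hF, rfl⟩ := List.mem_map.1 hx
    rw [d_sq F hF]
    exact (hl.1 F hF).add_self h2
  refine ⟨?_, ?_⟩
  · intro F hF
    simp only [List.mem_cons, List.mem_append, List.mem_map] at hF
    rcases hF with rfl | hF | ⟨F, hF, rfl⟩
    · nth_rw 1 [hDW]
      rw [neg_mul, mul_assoc, ← mul_assoc W, hWW.commute, ← mul_assoc]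
      exact (hDD.mul hWW).neg
    · exact hl.1 F hF
    · rw [b_sq F hF]
      exact hl.1 F hF
  · rw [List.pairwise_cons, List.pairwise_append]
    refine ⟨?_, hl.2, ?_, ?_⟩
    · intro F hF
      simp only [List.mem_append, List.mem_map] at hF
      rcases hF with hF | ⟨F, hF, rfl⟩
      · rw [Anticommute, mul_assoc, hD F hF, mul_neg, ← mul_assoc, W_mul, bb, mul_assoc]
      · rw [Anticommute, mul_assoc, hD' F hF, mul_neg, ← mul_assoc, W_mul, mul_assoc]
    · rw [List.pairwise_map]
      exact hl.2.imp b_anti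
    · intro F hF x hx
      obtain ⟨G, hG, rfl⟩ := List.mem_map.1 hx
      exact hcross F hF G hG

end Clifford
end AltSpin

namespace AltSpin

open Equiv Equiv.Perm

section Graded

/-- Two disjoint finite sets of the same cardinality are swapped by an involution. -/
lemma exists_involution {α : Type*} [Fintype α] [DecidableEq α] (n : ℕ) : ∀ B C : Finset α,
    Disjoint B C → B.card = n → C.card = n → ∃ ω : Perm α, ω * ω = 1 ∧
      (∀ y ∉ B ∪ C, ω y = y) ∧ (∀ y ∈ B, ω y ∈ C) ∧ sign ω = (-1) ^ n := by
  induction n with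
  | zero =>
    intro B C _ hB _
    rw [Finset.card_eq_zero] at hB
    subst hB
    exact ⟨1, by simp⟩
  | succ n ih =>
    intro B C hBC hB hC
    obtain ⟨b, B, hb, rfl, hB'⟩ := Finset.card_eq_succ.1 hB
    obtain ⟨c, C, hc, rfl, hC'⟩ := Finset.card_eq_succ.1 hC
    simp only [Finset.disjoint_insert_left, Finset.disjoint_insert_right, Finset.mem_insert,
      not_or] at hBC
    obtain ⟨⟨hcb, hcB⟩, hbC, hBC⟩ := hBC
    obtain ⟨ω, h1, h2, h3, h4⟩ := ih B C hBC hB' hC'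
    have hωb : ω b = b := h2 b (by simp [hb, hbC])
    have hωc : ω c = c := h2 c (by simp [hc, hcB])
    refine ⟨swap b c * ω, ?_, fun y hy => ?_, fun y hy => ?_, ?_⟩
    · rw [mul_assoc, ← mul_assoc ω, swap_mul_comm_of_apply_eq hωb hωc, mul_assoc, h1, mul_one,
        swap_mul_self]
    · simp only [Finset.mem_union, Finset.mem_insert, not_or] at hy
      rw [mul_apply, h2 y (by simp [hy]), swap_apply_of_ne_of_ne hy.1.1 hy.2.1]
    · rcases Finset.mem_insert.1 hy with rfl | hy
      · simp [hωb]
      · have hy' := h3 y hy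
        rw [mul_apply, swap_apply_of_ne_of_ne (ne_of_mem_of_not_mem hy' hbC)
          (ne_of_mem_of_not_mem hy' hc)]
        exact Finset.mem_insert_of_mem hy'
    · rw [map_mul, sign_swap (Ne.symm hcb), h4, pow_succ']

variable {α : Type*} [Fintype α] [DecidableEq α] {E : Type*} [Group E]
  {k 𝒜 : Type*} [Field k] [Ring 𝒜] [Algebra k 𝒜]

/-- A representation of a spin extension, in which the kernel acts by scalars and the distinguished
involution acts as `-1`, in characteristic different from two. -/
structure IsSpinRep (k : Type*) {𝒜 : Type*} [Field k] [Ring 𝒜] [Algebra k 𝒜] (π : E →* Perm α)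
    (ε : E) (ρ : E →* 𝒜) : Prop extends IsSpinExtension π ε where
  isScalar : ∀ z, π z = 1 → IsScalar k (ρ z)
  rho_eps : ρ ε = -1
  two_ne_zero : (2 : k) ≠ 0

/-- `x` lifts the evenization of a permutation of sign `s` supported in `B`. -/
def IsLift (π : E →* Perm α) (a₀ a₁ : α) (B : Finset α) (s : ℤˣ) (x : E) : Prop :=
  ∃ σ : Perm α, (∀ y ∉ B, σ y = y) ∧ sign σ = s ∧ π x = evenize a₀ a₁ σ

lemma IsLift.mono {π : E →* Perm α} {a₀ a₁ : α} {B C : Finset α} (hBC : B ⊆ C) {s : ℤˣ} {x : E}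
    (hx : IsLift π a₀ a₁ B s x) : IsLift π a₀ a₁ C s x :=
  let ⟨σ, h1, h2⟩ := hx
  ⟨σ, fun y hy => h1 y fun h => hy (hBC h), h2⟩

lemma IsLift.mul {π : E →* Perm α} {a₀ a₁ : α} {B : Finset α} (h0 : a₀ ∉ B) (h1 : a₁ ∉ B)
    {s t : ℤˣ} {x y : E} (hx : IsLift π a₀ a₁ B s x) (hy : IsLift π a₀ a₁ B t y) :
    IsLift π a₀ a₁ B (s * t) (x * y) := by
  obtain ⟨σ, hσ, rfl, hxσ⟩ := hx
  obtain ⟨τ, hτ, rfl, hyτ⟩ := hy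
  refine ⟨σ * τ, fun y hy => ?_, map_mul _ _ _, ?_⟩
  · rw [mul_apply, hτ y hy, hσ y hy]
  · rw [map_mul, hxσ, hyτ, evenize_mul (hσ _ h0) (hσ _ h1)]

lemma IsLift.conj {π : E →* Perm α} {a₀ a₁ : α} {B C : Finset α} {s : ℤˣ} {x w : E}
    (h0 : π w a₀ = a₀) (h1 : π w a₁ = a₁) (hw : ∀ y ∈ B, π w y ∈ C)
    (hx : IsLift π a₀ a₁ B s x) : IsLift π a₀ a₁ C s (w * x * w⁻¹) := by
  obtain ⟨σ, hσ, rfl, hxσ⟩ := hx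
  have hs : sign (π w * σ * (π w)⁻¹) = sign σ := by
    rw [map_mul, map_mul, map_inv, mul_right_comm, mul_inv_cancel, one_mul]
  refine ⟨π w * σ * (π w)⁻¹, fun y hy => ?_, hs, ?_⟩
  · rw [mul_apply, mul_apply, hσ, ← mul_apply, mul_inv_cancel, one_apply]
    intro h
    exact hy (by simpa using hw _ h)
  · have hc := swap_mul_comm_of_apply_eq h0 h1
    rw [map_mul, map_mul, map_inv, hxσ, evenize, evenize, hs]
    split_ifs
    · simp
    · simp only [← mul_assoc]; rw [hc]

/-- The span of the operators attached to permutations of sign `s` supported in `B`. -/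
def gradedPart (k : Type*) {𝒜 : Type*} [Field k] [Ring 𝒜] [Algebra k 𝒜] (π : E →* Perm α)
    (ρ : E →* 𝒜) (a₀ a₁ : α) (B : Finset α) (s : ℤˣ) : Submodule k 𝒜 :=
  Submodule.span k (ρ '' {x | IsLift π a₀ a₁ B s x})

section

variable {π : E →* Perm α} {ρ : E →* 𝒜} {a₀ a₁ : α} {B C : Finset α}

lemma mem_gradedPart {s : ℤˣ} {x : E} (hx : IsLift π a₀ a₁ B s x) :
    ρ x ∈ gradedPart k π ρ a₀ a₁ B s :=
  Submodule.subset_span ⟨x, hx, rfl⟩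

lemma one_mem_gradedPart : (1 : 𝒜) ∈ gradedPart k π ρ a₀ a₁ B 1 := by
  rw [← map_one ρ]
  exact mem_gradedPart ⟨1, by simp [evenize]⟩

lemma gradedPart_mono (hBC : B ⊆ C) (s : ℤˣ) :
    gradedPart k π ρ a₀ a₁ B s ≤ gradedPart k π ρ a₀ a₁ C s :=
  Submodule.span_mono (Set.image_mono fun _ hx => IsLift.mono hBC hx)

lemma mul_mem_gradedPart (h0 : a₀ ∉ B) (h1 : a₁ ∉ B) {s t : ℤˣ} {f g : 𝒜}
    (hf : f ∈ gradedPart k π ρ a₀ a₁ B s) (hg : g ∈ gradedPart k π ρ a₀ a₁ B t) :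
    f * g ∈ gradedPart k π ρ a₀ a₁ B (s * t) := by
  have := Submodule.mul_mem_mul hf hg
  rw [gradedPart, gradedPart, Submodule.span_mul_span] at this
  refine Submodule.span_mono ?_ this
  rintro _ ⟨_, ⟨x, hx, rfl⟩, _, ⟨y, hy, rfl⟩, rfl⟩
  exact ⟨x * y, IsLift.mul h0 h1 hx hy, map_mul _ _ _⟩

lemma prod_mem_gradedPart (h0 : a₀ ∉ B) (h1 : a₁ ∉ B) {l : List 𝒜} {s : ℤˣ}
    (hl : ∀ F ∈ l, F ∈ gradedPart k π ρ a₀ a₁ B s) :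
    l.prod ∈ gradedPart k π ρ a₀ a₁ B (s ^ l.length) := by
  induction l with
  | nil => simpa using one_mem_gradedPart
  | cons F l ih =>
    rw [List.prod_cons, List.length_cons, pow_succ']
    exact mul_mem_gradedPart h0 h1 (hl F List.mem_cons_self)
      (ih fun G hG => hl G (List.mem_cons_of_mem _ hG))

lemma conj_mem_gradedPart {w : E} (h0 : π w a₀ = a₀) (h1 : π w a₁ = a₁)
    (hw : ∀ y ∈ B, π w y ∈ C) {s : ℤˣ} {f : 𝒜} (hf : f ∈ gradedPart k π ρ a₀ a₁ B s) :
    ρ w * f * ρ w⁻¹ ∈ gradedPart k π ρ a₀ a₁ C s := by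
  induction hf using Submodule.span_induction with
  | mem f hf =>
    obtain ⟨x, hx, rfl⟩ := hf
    rw [← map_mul, ← map_mul]
    exact mem_gradedPart (IsLift.conj h0 h1 hw hx)
  | zero => simp
  | add f g _ _ hf hg => rw [mul_add, add_mul]; exact add_mem hf hg
  | smul c f _ hf => rw [mul_smul_comm, smul_mul_assoc]; exact Submodule.smul_mem _ _ hf

lemma gradedPart_induction₂ {s t : ℤˣ} {c : 𝒜}
    (hlift : ∀ x y, IsLift π a₀ a₁ B s x → IsLift π a₀ a₁ C t y → ρ x * ρ y = c * (ρ y * ρ x))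
    {f g : 𝒜} (hf : f ∈ gradedPart k π ρ a₀ a₁ B s) (hg : g ∈ gradedPart k π ρ a₀ a₁ C t) :
    f * g = c * (g * f) := by
  induction hf using Submodule.span_induction with
  | mem f hf =>
    obtain ⟨x, hx, rfl⟩ := hf
    induction hg using Submodule.span_induction with
    | mem g hg =>
      obtain ⟨y, hy, rfl⟩ := hg
      exact hlift x y hx hy
    | zero => simp
    | add f g _ _ hf hg => rw [mul_add, hf, hg, add_mul, mul_add]
    | smul d f _ hf => rw [mul_smul_comm, hf, smul_mul_assoc, mul_smul_comm]
  | zero => simp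
  | add f g _ _ hf hg => rw [add_mul, hf, hg, mul_add, mul_add]
  | smul d f _ hf => rw [smul_mul_assoc, hf, mul_smul_comm, mul_smul_comm]

end

namespace IsSpinRep

variable {π : E →* Perm α} {ε : E} {ρ : E →* 𝒜} (h : IsSpinRep k π ε ρ)
include h

lemma anticommute_of_disjoint {a₀ a₁ : α} (h01 : a₀ ≠ a₁) {B C : Finset α} (hBC : Disjoint B C)
    (hB0 : a₀ ∉ B) (hB1 : a₁ ∉ B) (hC0 : a₀ ∉ C) (hC1 : a₁ ∉ C) {f g : 𝒜}
    (hf : f ∈ gradedPart k π ρ a₀ a₁ B (-1)) (hg : g ∈ gradedPart k π ρ a₀ a₁ C (-1)) :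
    Anticommute f g := by
  rw [Anticommute, ← neg_one_mul]
  refine gradedPart_induction₂ ?_ hf hg
  rintro x y ⟨σ, hσ, hσs, hx⟩ ⟨τ, hτ, hτs, hy⟩
  rw [← map_mul, h.evenize_commute h01 hBC hB0 hB1 hC0 hC1 hσ hτ hx hy, hσs, hτs, commFactor,
    if_pos ⟨rfl, rfl⟩, map_mul, h.rho_eps, map_mul]

end IsSpinRep

/-- There is a Clifford list of length `M` consisting of odd operators supported in `B`. -/
def HasCliffordList (k : Type*) {𝒜 : Type*} [Field k] [Ring 𝒜] [Algebra k 𝒜] (π : E →* Perm α)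
    (ρ : E →* 𝒜) (a₀ a₁ : α) (B : Finset α) (M : ℕ) : Prop :=
  ∃ l : List 𝒜, l.length = M ∧ (∀ F ∈ l, F ∈ gradedPart k π ρ a₀ a₁ B (-1)) ∧ IsCliffordList k l

namespace IsSpinRep

variable {π : E →* Perm α} {ε : E} {ρ : E →* 𝒜} (h : IsSpinRep k π ε ρ) {a₀ a₁ : α}

lemma hasCliffordList_zero (B : Finset α) : HasCliffordList k π ρ a₀ a₁ B 0 :=
  ⟨[], rfl, by simp, by simp, List.Pairwise.nil⟩

include h

lemma isScalar_mul_self {p q : α} (h0p : a₀ ≠ p) (h0q : a₀ ≠ q) (h1p : a₁ ≠ p)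
    (h1q : a₁ ≠ q) {x : E} (hx : π x = swap a₀ a₁ * swap p q) : IsScalar k (ρ x * ρ x) := by
  rw [← map_mul]
  refine h.isScalar _ ?_
  rw [map_mul, hx, mul_assoc, ← mul_assoc (swap p q), swap_mul_comm_of_apply_eq
    (swap_apply_of_ne_of_ne h0p h0q) (swap_apply_of_ne_of_ne h1p h1q), mul_assoc, swap_mul_self,
    mul_one, swap_mul_self]

lemma hasCliffordList_pair (h01 : a₀ ≠ a₁) {B : Finset α} (h0 : a₀ ∉ B) (h1 : a₁ ∉ B)
    (hB : B.card = 2) : HasCliffordList k π ρ a₀ a₁ B 1 := by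
  obtain ⟨p, q, hpq, rfl⟩ := Finset.card_eq_two.1 hB
  simp only [Finset.mem_insert, Finset.mem_singleton, not_or] at h0 h1
  obtain ⟨x, hx⟩ := h.exists_lift _ (sign_evenize h01 (swap p q))
  refine ⟨[ρ x], rfl, ?_, ?_, List.pairwise_singleton _ _⟩
  · simp only [List.mem_singleton, forall_eq]
    refine mem_gradedPart ⟨swap p q, fun y hy => ?_, sign_swap hpq, hx⟩
    simp only [Finset.mem_insert, Finset.mem_singleton, not_or] at hy
    exact swap_apply_of_ne_of_ne hy.1 hy.2
  · simp only [List.mem_singleton, forall_eq]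
    rw [evenize_swap _ _ hpq] at hx
    exact h.isScalar_mul_self h0.1 h0.2 h1.1 h1.2 hx

lemma hasCliffordList_union (h01 : a₀ ≠ a₁) {B C : Finset α} (hBC : Disjoint B C) (hB0 : a₀ ∉ B)
    (hB1 : a₁ ∉ B) (hC0 : a₀ ∉ C) (hC1 : a₁ ∉ C) {M N : ℕ} (hB : HasCliffordList k π ρ a₀ a₁ B M)
    (hC : HasCliffordList k π ρ a₀ a₁ C N) : HasCliffordList k π ρ a₀ a₁ (B ∪ C) (M + N) := by
  obtain ⟨l, rfl, hl, hl'⟩ := hB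
  obtain ⟨m, rfl, hm, hm'⟩ := hC
  refine ⟨l ++ m, List.length_append, ?_, ?_, ?_⟩
  · intro F hF
    rcases List.mem_append.1 hF with hF | hF
    · exact gradedPart_mono Finset.subset_union_left _ (hl F hF)
    · exact gradedPart_mono Finset.subset_union_right _ (hm F hF)
  · intro F hF
    rcases List.mem_append.1 hF with hF | hF
    · exact hl'.1 F hF
    · exact hm'.1 F hF
  · exact List.pairwise_append.2 ⟨hl'.2, hm'.2, fun F hF G hG =>
      h.anticommute_of_disjoint h01 hBC hB0 hB1 hC0 hC1 (hl F hF) (hm G hG)⟩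

lemma hasCliffordList_double (h01 : a₀ ≠ a₁) {B C : Finset α} (hBC : Disjoint B C) (hB0 : a₀ ∉ B)
    (hB1 : a₁ ∉ B) (hC0 : a₀ ∉ C) (hC1 : a₁ ∉ C) (hcard : B.card = C.card) (heven : Even B.card)
    {M : ℕ} (hM : Odd M) (hB : HasCliffordList k π ρ a₀ a₁ B M) :
    HasCliffordList k π ρ a₀ a₁ (B ∪ C) (2 * M + 1) := by
  obtain ⟨l, rfl, hl, hl'⟩ := hB
  obtain ⟨ω, hω2, hω, hωB, hωs⟩ := exists_involution _ B C hBC rfl hcard.symm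
  rw [heven.neg_one_pow] at hωs
  obtain ⟨w, hw⟩ := h.exists_lift ω hωs
  have h0 : a₀ ∉ B ∪ C := by simp [hB0, hC0]
  have h1 : a₁ ∉ B ∪ C := by simp [hB1, hC1]
  have hw0 : π w a₀ = a₀ := by rw [hw, hω _ h0]
  have hw1 : π w a₁ = a₁ := by rw [hw, hω _ h1]
  have hwC : ∀ F ∈ l, ρ w * F * ρ w⁻¹ ∈ gradedPart k π ρ a₀ a₁ C (-1) := fun F hF =>
    conj_mem_gradedPart hw0 hw1 (fun y hy => by rw [hw]; exact hωB y hy) (hl F hF)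
  have hlB : ∀ F ∈ l, F ∈ gradedPart k π ρ a₀ a₁ (B ∪ C) (-1) := fun F hF =>
    gradedPart_mono Finset.subset_union_left _ (hl F hF)
  have hlC : ∀ F ∈ l, ρ w * F * ρ w⁻¹ ∈ gradedPart k π ρ a₀ a₁ (B ∪ C) (-1) := fun F hF =>
    gradedPart_mono Finset.subset_union_right _ (hwC F hF)
  refine ⟨_, ?_, ?_, hl'.double hM h.two_ne_zero (W := ρ w) (W' := ρ w⁻¹) (by simp [← map_mul])
    (by simp [← map_mul]) ?_ ?_⟩
  · simp only [List.length_cons, List.length_append, List.length_map]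
    ring
  · intro F hF
    simp only [List.mem_cons, List.mem_append, List.mem_map] at hF
    rcases hF with rfl | hF | ⟨F, hF, rfl⟩
    · have hW : ρ w ∈ gradedPart k π ρ a₀ a₁ (B ∪ C) 1 :=
        mem_gradedPart ⟨ω, hω, hωs, by rw [hw, evenize_of_sign_eq_one _ _ hωs]⟩
      have := mul_mem_gradedPart h0 h1 hW (prod_mem_gradedPart h0 h1 (s := -1)
        (l := l.map fun F => F - ρ w * F * ρ w⁻¹) fun F hF => by
          obtain ⟨G, hG, rfl⟩ := List.mem_map.1 hF
          exact sub_mem (hlB G hG) (hlC G hG))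
      rwa [List.length_map, hM.neg_one_pow, one_mul] at this
    · exact hlB F hF
    · exact hlC F hF
  · rw [← map_mul]
    exact h.isScalar _ (by rw [map_mul, hw, hω2])
  · exact fun F hF G hG =>
      h.anticommute_of_disjoint h01 hBC hB0 hB1 hC0 hC1 (hl F hF) (hwC G hG)

lemma hasCliffordList_two_pow (h01 : a₀ ≠ a₁) (j : ℕ) : ∀ B : Finset α, a₀ ∉ B → a₁ ∉ B →
    B.card = 2 ^ (j + 1) → HasCliffordList k π ρ a₀ a₁ B (2 ^ (j + 1) - 1) := by
  induction j with
  | zero => exact fun B h0 h1 hB => h.hasCliffordList_pair h01 h0 h1 hB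
  | succ j ih =>
    intro B h0 h1 hB
    obtain ⟨C, hCB, hC⟩ := Finset.exists_subset_card_eq (s := B) (n := 2 ^ (j + 1))
      (by rw [hB]; exact Nat.pow_le_pow_right two_pos (Nat.le_succ _))
    have hD : (B \ C).card = 2 ^ (j + 1) := by
      rw [Finset.card_sdiff_of_subset hCB, hB, hC, pow_succ _ (j + 1)]; omega
    have hpos : 0 < 2 ^ j := by positivity
    have := h.hasCliffordList_double h01 (Finset.disjoint_sdiff (s := C) (t := B))
      (fun h => h0 (hCB h)) (fun h => h1 (hCB h)) (by simp [h0]) (by simp [h1])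
      (hC.trans hD.symm) (by rw [hC, pow_succ]; exact even_two.mul_left _)
      (by rw [pow_succ]; exact ⟨2 ^ j - 1, by omega⟩)
      (ih C (fun h => h0 (hCB h)) (fun h => h1 (hCB h)) hC)
    rw [Finset.union_sdiff_of_subset hCB] at this
    convert this using 1
    rw [pow_succ _ (j + 1), pow_succ]
    omega

/-- Splitting off a block whose cardinality is a power of two. -/
lemma hasCliffordList_add (h01 : a₀ ≠ a₁) (j : ℕ) {B : Finset α} (h0 : a₀ ∉ B) (h1 : a₁ ∉ B)
    (hB : 2 ^ (j + 1) ≤ B.card) {M : ℕ} (hrest : ∀ C : Finset α, a₀ ∉ C → a₁ ∉ C →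
      C.card = B.card - 2 ^ (j + 1) → HasCliffordList k π ρ a₀ a₁ C M) :
    HasCliffordList k π ρ a₀ a₁ B (2 ^ (j + 1) - 1 + M) := by
  obtain ⟨C, hCB, hC⟩ := Finset.exists_subset_card_eq hB
  have := h.hasCliffordList_union h01 (Finset.disjoint_sdiff (s := C) (t := B))
    (fun h => h0 (hCB h)) (fun h => h1 (hCB h)) (by simp [h0]) (by simp [h1])
    (h.hasCliffordList_two_pow h01 j C (fun h => h0 (hCB h)) (fun h => h1 (hCB h)) hC)
    (hrest (B \ C) (by simp [h0]) (by simp [h1]) (by rw [Finset.card_sdiff_of_subset hCB, hC]))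
  rwa [Finset.union_sdiff_of_subset hCB] at this

lemma hasCliffordList (h01 : a₀ ≠ a₁) (N : ℕ) : ∀ B : Finset α, a₀ ∉ B → a₁ ∉ B → B.card = N →
    HasCliffordList k π ρ a₀ a₁ B
      (15 * (N / 16) + 7 * (N / 8 % 2) + 3 * (N / 4 % 2) + N / 2 % 2) := by
  induction N using Nat.strong_induction_on with
  | _ N ih =>
    intro B h0 h1 hB
    have step : ∀ j, 2 ^ (j + 1) ≤ N → _ := fun j hj =>
      h.hasCliffordList_add h01 j h0 h1 (hj.trans_eq hB.symm) fun C hC0 hC1 hC =>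
        ih (N - 2 ^ (j + 1)) (Nat.sub_lt_self (by positivity) hj) C hC0 hC1 (hB ▸ hC)
    by_cases h16 : 16 ≤ N
    · convert step 3 h16 using 1; omega
    by_cases h8 : 8 ≤ N
    · convert step 2 h8 using 1; omega
    by_cases h4 : 4 ≤ N
    · convert step 1 h4 using 1; omega
    by_cases h2 : 2 ≤ N
    · convert step 0 h2 using 1; omega
    · convert hasCliffordList_zero B using 1; omega

end IsSpinRep

end Graded
end AltSpin

namespace AltSpin

open Equiv Equiv.Perm Module

section Dimension

variable {k V : Type*} [Field k] [IsAlgClosed k] [AddCommGroup V] [Module k V]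
  [FiniteDimensional k V]

omit [IsAlgClosed k] [FiniteDimensional k V] in
lemma IsScalar.ker_eq_bot {F : End k V} (hF : IsScalar k (F * F)) : LinearMap.ker F = ⊥ := by
  obtain ⟨c, hc, hF⟩ := hF
  refine LinearMap.ker_eq_bot'.2 fun v hv => ?_
  have := LinearMap.congr_fun hF v
  rw [End.mul_apply, hv, map_zero, algebraMap_end_apply] at this
  exact (smul_eq_zero.1 this.symm).resolve_left hc

omit [IsAlgClosed k] in
lemma finrank_le_of_map_mem {F : End k V} (hF : IsScalar k (F * F)) {S T : Submodule k V}
    (hST : ∀ v ∈ S, F v ∈ T) : finrank k S ≤ finrank k T := by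
  rw [(S.equivMapOfInjective F (LinearMap.ker_eq_bot.1 hF.ker_eq_bot)).finrank_eq]
  exact Submodule.finrank_mono (Submodule.map_le_iff_le_comap.2 hST)

/-- A pair of anticommuting operators with nonzero scalar squares halves an invariant subspace. -/
lemma exists_half (h2 : (2 : k) ≠ 0) {F G : End k V} (hF : IsScalar k (F * F))
    (hG : IsScalar k (G * G)) (hFG : Anticommute F G) {S : Submodule k V}
    (hFS : ∀ v ∈ S, F v ∈ S) (hGS : ∀ v ∈ S, G v ∈ S) :
    ∃ T ≤ S, 2 * finrank k T = finrank k S ∧ ∀ u : End k V, u * (F * G) = F * G * u →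
      (∀ v ∈ S, u v ∈ S) → ∀ v ∈ T, u v ∈ T := by
  have hP : IsScalar k (F * G * (F * G)) := by
    have : F * G * (F * G) = -(F * F * (G * G)) := by
      rw [mul_assoc, ← mul_assoc G, hFG.symm]; simp [mul_assoc]
    rw [this]
    exact (hF.mul hG).neg
  obtain ⟨c, hc, hPc⟩ := hP
  obtain ⟨μ, rfl⟩ := IsAlgClosed.exists_eq_mul_self c
  have hμ : μ ≠ 0 := left_ne_zero_of_mul hc
  have hPP : ∀ v, F (G (F (G v))) = (μ * μ) • v := fun v => LinearMap.congr_fun hPc v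
  have hFP : ∀ v, F (G (F v)) = -F (F (G v)) := fun v => by
    have := LinearMap.congr_fun hFG.symm v
    simp only [End.mul_apply, LinearMap.neg_apply] at this
    rw [this, map_neg]
  obtain ⟨T, hT⟩ : ∃ T : k → Submodule k V, T = fun ν =>
    S ⊓ LinearMap.ker (F * G - algebraMap k (End k V) ν) := ⟨_, rfl⟩
  have mem_T : ∀ ν v, v ∈ T ν ↔ v ∈ S ∧ F (G v) = ν • v := fun ν v => by
    rw [hT]; simp [sub_eq_zero, algebraMap_end_apply]
  have swap_T : ∀ ν, ∀ v ∈ T ν, F v ∈ T (-ν) := fun ν v hv => by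
    rw [mem_T] at hv ⊢
    exact ⟨hFS v hv.1, by rw [hFP, hv.2, map_smul, neg_smul]⟩
  have hle : ∀ ν, T ν ≤ S := fun ν v hv => ((mem_T ν v).1 hv).1
  have hinf : T μ ⊓ T (-μ) = ⊥ := by
    rw [Submodule.eq_bot_iff]
    rintro v ⟨hv, hv'⟩
    have h1 := ((mem_T _ v).1 hv).2
    rw [((mem_T _ v).1 hv').2, neg_smul, neg_eq_iff_add_eq_zero, ← two_smul k, smul_smul] at h1
    exact (smul_eq_zero.1 h1).resolve_left (mul_ne_zero h2 hμ)
  have hsup : T μ ⊔ T (-μ) = S := by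
    refine le_antisymm (sup_le (hle _) (hle _)) fun v hv => ?_
    rw [Submodule.mem_sup]
    have hFG' : F (G v) ∈ S := hFS _ (hGS _ hv)
    have key : ∀ ν, ν * ν = μ * μ → ν ≠ 0 → (2 * ν)⁻¹ • (F (G v) + ν • v) ∈ T ν := by
      intro ν hν _
      rw [mem_T]
      refine ⟨S.smul_mem _ (S.add_mem hFG' (S.smul_mem _ hv)), ?_⟩
      rw [map_smul, map_smul, map_add, map_add, hPP, map_smul, map_smul, ← hν]
      module
    refine ⟨_, key μ rfl hμ, _, key (-μ) (neg_mul_neg _ _) (neg_ne_zero.2 hμ), ?_⟩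
    rw [smul_add, smul_add, smul_smul, smul_smul, mul_neg, inv_neg, neg_smul, neg_mul_neg]
    have : (2 * μ)⁻¹ * μ + (2 * μ)⁻¹ * μ = 1 := by field_simp; norm_num
    calc _ = ((2 * μ)⁻¹ * μ + (2 * μ)⁻¹ * μ) • v := by rw [add_smul]; abel
      _ = v := by rw [this, one_smul]
  have hdim := Submodule.finrank_sup_add_finrank_inf_eq (T μ) (T (-μ))
  rw [hsup, hinf, finrank_bot] at hdim
  have h1 := finrank_le_of_map_mem hF (swap_T μ)
  have h2 := finrank_le_of_map_mem hF (swap_T (-μ))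
  rw [neg_neg] at h2
  refine ⟨T μ, hle μ, by omega, fun u hu huS v hv => ?_⟩
  rw [mem_T] at hv ⊢
  have hu' : F (G (u v)) = u (F (G v)) := (LinearMap.congr_fun hu v).symm
  exact ⟨huS v hv.1, by rw [hu', hv.2, map_smul]⟩

lemma Anticommute.commute_mul {A : Type*} [Ring A] {x F G : A} (hF : Anticommute x F)
    (hG : Anticommute x G) : x * (F * G) = F * G * x := by
  rw [← mul_assoc, hF, neg_mul, mul_assoc, hG, mul_neg, neg_neg, mul_assoc]

lemma IsCliffordList.exists_submodule (h2 : (2 : k) ≠ 0) (j : ℕ) : ∀ (l : List (End k V))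
    (S : Submodule k V), l.length = 2 * j → IsCliffordList k l →
    (∀ F ∈ l, ∀ v ∈ S, F v ∈ S) → ∃ T ≤ S, 2 ^ j * finrank k T = finrank k S ∧
      ∀ u : End k V, (∀ F ∈ l, ∀ G ∈ l, u * (F * G) = F * G * u) → (∀ v ∈ S, u v ∈ S) →
        ∀ v ∈ T, u v ∈ T := by
  induction j with
  | zero => exact fun l S _ _ _ => ⟨S, le_rfl, by simp, fun u _ hu => hu⟩
  | succ j ih =>
    rintro (_ | ⟨F, _ | ⟨G, l⟩⟩) S hlen hl hS
    · simp at hlen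
    · simp at hlen; omega
    obtain ⟨hsq, hp⟩ := hl
    rw [List.pairwise_cons, List.pairwise_cons] at hp
    have hF : F ∈ F :: G :: l := by simp
    have hG : G ∈ F :: G :: l := by simp
    have hl' : ∀ x ∈ l, x ∈ F :: G :: l := fun x hx => by simp [hx]
    obtain ⟨T, hTS, hT, huT⟩ := exists_half h2 (hsq F hF) (hsq G hG) (hp.1 G (by simp))
      (hS F hF) (hS G hG)
    obtain ⟨T', hTT, hT', huT'⟩ := ih l T (by simp at hlen; omega)
      ⟨fun x hx => hsq x (hl' x hx), hp.2.2⟩ fun x hx => huT x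
        (Anticommute.commute_mul (hp.1 x (by simp [hx])).symm (hp.2.1 x hx).symm) (hS x (hl' x hx))
    refine ⟨T', hTT.trans hTS, by rw [← hT, ← hT', pow_succ']; ring, fun u hu huS => ?_⟩
    exact huT' u (fun x hx y hy => hu x (hl' x hx) y (hl' y hy)) (huT u (hu F hF G hG) huS)

end Dimension

section Bound

variable {α : Type*} [Fintype α] [DecidableEq α] {E : Type*} [Group E]
  {k V : Type*} [Field k] [AddCommGroup V] [Module k V]
  {π : E →* Perm α} {ε : E} {ρ : E →* End k V}

omit [Fintype α] [DecidableEq α] [Group E] in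
lemma pow_le_of_mul_eq [FiniteDimensional k V] [Nontrivial V] {a b : ℕ}
    (hab : a * b = finrank k V) : a ≤ finrank k V := by
  have : 0 < finrank k V := finrank_pos
  rw [← hab] at this ⊢
  exact Nat.le_mul_of_pos_right _ (Nat.pos_of_mul_pos_left this)

lemma HasCliffordList.two_pow_le [IsAlgClosed k] [FiniteDimensional k V] [Nontrivial V]
    (h2 : (2 : k) ≠ 0) {a₀ a₁ : α} {B : Finset α} {M : ℕ}
    (hB : HasCliffordList k π ρ a₀ a₁ B M) : 2 ^ (M / 2) ≤ finrank k V := by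
  obtain ⟨l, rfl, -, hl⟩ := hB
  obtain ⟨T, -, hT, -⟩ := IsCliffordList.exists_submodule h2 (l.length / 2)
    (l.take (2 * (l.length / 2))) ⊤ (by rw [List.length_take]; omega)
    ⟨fun F hF => hl.1 F (List.mem_of_mem_take hF), hl.2.sublist (List.take_sublist _ _)⟩ (by simp)
  exact pow_le_of_mul_eq (hT.trans (finrank_top k V))

lemma mul_le_of_mod_four_lt_two {N : ℕ} (hN : N % 4 < 2) : 15 * N ≤
    32 * ((15 * (N / 16) + 7 * (N / 8 % 2) + 3 * (N / 4 % 2) + N / 2 % 2) / 2) + 51 := by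
  obtain ⟨q, r, hr, rfl⟩ : ∃ q r, r < 16 ∧ N = 16 * q + r := ⟨N / 16, N % 16, by omega, by omega⟩
  interval_cases r <;> omega

namespace IsSpinRep

variable (h : IsSpinRep k π ε ρ)
include h

lemma commute_of_fixed {B : Finset α} {w : E} (hw : ∀ y ∈ B, π w y = y) {f : End k V}
    {a₀ a₁ : α} (hf : f ∈ gradedPart k π ρ a₀ a₁ B 1) : ρ w * f = f * ρ w := by
  have lift : ∀ σ : Perm α, (∀ y ∉ B, σ y = y) → sign σ = 1 → ∀ x, π x = σ → x * w = w * x := by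
    intro σ hσ hs
    refine (even_induction (P := fun σ => sign σ = 1 ∧ ∀ x, π x = σ → x * w = w * x) B
      ⟨map_one _, fun x hx => h.central x hx w⟩ ?_ ?_ hσ hs).2
    · rintro σ τ ⟨hσ, hσ'⟩ ⟨hτ, hτ'⟩
      refine ⟨by rw [map_mul, hσ, hτ, one_mul], fun x hx => ?_⟩
      obtain ⟨y, hy⟩ := h.exists_lift τ hτ
      calc x * w = x * y⁻¹ * (y * w) := by group
        _ = x * y⁻¹ * w * y := by rw [hτ' y hy]; group
        _ = w * x := by rw [hσ' (x * y⁻¹) (by simp [hx, hy])]; group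
    · refine fun a ha b hb c hc hab hac hbc =>
        ⟨(isThreeCycle_tri hab hac hbc).sign, fun x hx => ?_⟩
      refine h.commute_of_isThreeCycle h.card_le (by rw [hx]; exact isThreeCycle_tri hab hac hbc) ?_
      rw [hx, ← mul_inv_eq_iff_eq_mul.1 ((tri_conj (π w) a b c).trans
        (by rw [hw a ha, hw b hb, hw c hc]))]
  induction hf using Submodule.span_induction with
  | mem f hf =>
    obtain ⟨x, ⟨σ, hσ, hs, hx⟩, rfl⟩ := hf
    rw [evenize_of_sign_eq_one _ _ hs] at hx
    rw [← map_mul, ← map_mul, lift σ hσ hs x hx]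
  | zero => simp
  | add f g _ _ hf hg => rw [mul_add, add_mul, hf, hg]
  | smul c f _ hf => rw [mul_smul_comm, smul_mul_assoc, hf]

lemma two_pow_succ_le [IsAlgClosed k] [FiniteDimensional k V] [Nontrivial V] {a₀ a₁ c d : α}
    (hl : [a₀, a₁, c, d].Nodup) {B : Finset α} (hB0 : a₀ ∉ B) (hB1 : a₁ ∉ B) (hBc : c ∉ B)
    (hBd : d ∉ B) {M : ℕ} (hB : HasCliffordList k π ρ a₀ a₁ B M) :
    2 ^ (M / 2 + 1) ≤ finrank k V := by
  have hl' := hl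
  simp only [List.nodup_cons, List.mem_cons, List.not_mem_nil, or_false, not_or] at hl'
  obtain ⟨⟨h01, h0c, h0d⟩, ⟨h1c, h1d⟩, hcd, -⟩ := hl'
  have hdisj : Disjoint B {c, d} := by simp [hBc, hBd]
  have h0' : a₀ ∉ ({c, d} : Finset α) := by simp [h0c, h0d]
  have h1' : a₁ ∉ ({c, d} : Finset α) := by simp [h1c, h1d]
  rcases Nat.even_or_odd M with hM | hM
  · obtain ⟨l, rfl, hlB, hlC⟩ := hB
    obtain ⟨v, hv⟩ := h.exists_lift (swap a₀ a₁ * swap c d) (by simp [sign_swap h01, sign_swap hcd])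
    obtain ⟨w, hw⟩ := h.exists_lift (swap a₀ c * swap a₁ d) (by simp [sign_swap h0c, sign_swap h1d])
    have hvw : Anticommute (ρ w) (ρ v) := by
      rw [Anticommute, ← map_mul, h.klein a₀ a₁ c d hl w v hw hv, map_mul, h.rho_eps, map_mul,
        neg_one_mul]
    have hvv := h.isScalar_mul_self h0c h0d h1c h1d hv
    have hww := h.isScalar_mul_self h01 h0d (Ne.symm h1c) hcd hw
    have hvT : ρ v ∈ gradedPart k π ρ a₀ a₁ {c, d} (-1) := by
      refine mem_gradedPart ⟨swap c d, fun y hy => ?_, sign_swap hcd,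
        by rw [hv, evenize_swap _ _ hcd]⟩
      simp only [Finset.mem_insert, Finset.mem_singleton, not_or] at hy
      exact swap_apply_of_ne_of_ne hy.1 hy.2
    have hv_anti : ∀ F ∈ l, Anticommute (ρ v) F := fun F hF =>
      (h.anticommute_of_disjoint h01 hdisj hB0 hB1 h0' h1' (hlB F hF) hvT).symm
    have hmul : ∀ F ∈ l, ∀ G ∈ l, F * G ∈ gradedPart k π ρ a₀ a₁ B 1 := fun F hF G hG => by
      have := mul_mem_gradedPart hB0 hB1 (hlB F hF) (hlB G hG)
      rwa [neg_mul_neg, one_mul] at this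
    have hwB : ∀ y ∈ B, π w y = y := fun y hy => by
      rw [hw, mul_apply, swap_apply_of_ne_of_ne (ne_of_mem_of_not_mem hy hB1)
        (ne_of_mem_of_not_mem hy hBd), swap_apply_of_ne_of_ne (ne_of_mem_of_not_mem hy hB0)
        (ne_of_mem_of_not_mem hy hBc)]
    obtain ⟨T, -, hT, huT⟩ := IsCliffordList.exists_submodule h.two_ne_zero (l.length / 2) l ⊤
      (Nat.two_mul_div_two_of_even hM).symm hlC (by simp)
    obtain ⟨T', -, hT', -⟩ := exists_half h.two_ne_zero hww hvv hvw
      (huT (ρ w) (fun F hF G hG => h.commute_of_fixed hwB (hmul F hF G hG)) (by simp))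
      (huT (ρ v) (fun F hF G hG => Anticommute.commute_mul (hv_anti F hF) (hv_anti G hG)) (by simp))
    refine pow_le_of_mul_eq (b := finrank k T') ?_
    rw [pow_succ, mul_assoc, hT', hT, finrank_top k V]
  · have := (h.hasCliffordList_union h01 hdisj hB0 hB1 h0' h1' hB (h.hasCliffordList_pair h01 h0' h1'
      (Finset.card_pair hcd))).two_pow_le h.two_ne_zero
    rwa [show (M + 1) / 2 = M / 2 + 1 by obtain ⟨t, rfl⟩ := hM; omega] at this

/-- The dimension of a spin representation is bounded below by a power of two. -/
theorem exists_two_pow_le [IsAlgClosed k] [FiniteDimensional k V] [Nontrivial V] :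
    ∃ K, 2 ^ K ≤ finrank k V ∧ 15 * Fintype.card α ≤ 81 + 32 * K := by
  have h8 := h.card_le
  obtain ⟨s, -, hs⟩ := Finset.exists_subset_card_eq (s := (Finset.univ : Finset α)) (n := 4)
    (by rw [Finset.card_univ]; omega)
  obtain ⟨a₀, a₁, c, d, h01, h0c, h0d, h1c, h1d, hcd, rfl⟩ := Finset.card_eq_four.1 hs
  by_cases hmod : Fintype.card α % 4 < 2
  · refine ⟨_, h.two_pow_succ_le (a₀ := a₀) (a₁ := a₁) (c := c) (d := d)
      (by simp [h01, h0c, h0d, h1c, h1d, hcd]) (B := {a₀, a₁, c, d}ᶜ) (by simp) (by simp) (by simp)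
      (by simp) (h.hasCliffordList h01 _ _ (by simp) (by simp) rfl), ?_⟩
    rw [Finset.card_compl, hs]
    have := mul_le_of_mod_four_lt_two (N := Fintype.card α - 4) (by omega)
    omega
  · refine ⟨_, (h.hasCliffordList h01 _ ({a₀, a₁}ᶜ) (by simp) (by simp) rfl).two_pow_le
      h.two_ne_zero, ?_⟩
    rw [Finset.card_compl, Finset.card_pair h01]
    have := mul_le_of_mod_four_lt_two (N := Fintype.card α - 2) (by omega)
    omega

end IsSpinRep

end Bound

end AltSpin

namespace AltSpin

open Equiv Equiv.Perm Module Matrix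

section Pullback

variable {k : Type*} [Field k] {m n : ℕ}
  (φ : alternatingGroup (Fin m) →* (GL (Fin n) k ⧸ Subgroup.center (GL (Fin n) k)))

/-- The central extension of the alternating group by the scalars attached to a projective
representation. -/
def pullback : Subgroup (GL (Fin n) k × alternatingGroup (Fin m)) :=
  ((QuotientGroup.mk' (Subgroup.center (GL (Fin n) k))).comp (MonoidHom.fst _ _)).eqLocus
    (φ.comp (MonoidHom.snd _ _))

/-- The projection of the pullback to the permutation group. -/
def pullbackPerm : pullback φ →* Perm (Fin m) :=
  (alternatingGroup (Fin m)).subtype.comp ((MonoidHom.snd _ _).comp (pullback φ).subtype)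

/-- The projection of the pullback to the general linear group. -/
def pullbackGL : pullback φ →* GL (Fin n) k := (MonoidHom.fst _ _).comp (pullback φ).subtype

/-- The linear representation of the pullback. -/
def pullbackEnd : pullback φ →* End k (Fin n → k) :=
  (toLinAlgEquiv' : _ ≃ₐ[k] End k (Fin n → k)).toAlgHom.toMonoidHom.comp
    ((Units.coeHom _).comp (pullbackGL φ))

variable {φ}

lemma mk_pullbackGL (x : pullback φ) {σ : alternatingGroup (Fin m)} (hσ : pullbackPerm φ x = σ) :
    (QuotientGroup.mk' (Subgroup.center (GL (Fin n) k))) (pullbackGL φ x) = φ σ := by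
  have := x.2
  rw [← Subtype.coe_injective hσ]
  exact this

lemma exists_pullback (σ : alternatingGroup (Fin m)) (g : GL (Fin n) k)
    (hg : (QuotientGroup.mk' (Subgroup.center (GL (Fin n) k))) g = φ σ) :
    ∃ x : pullback φ, pullbackPerm φ x = σ ∧ pullbackGL φ x = g :=
  ⟨⟨(g, σ), hg⟩, rfl, rfl⟩

lemma pullback_ext {x y : pullback φ} (h1 : pullbackPerm φ x = pullbackPerm φ y)
    (h2 : pullbackGL φ x = pullbackGL φ y) : x = y :=
  Subtype.ext (Prod.ext h2 (Subtype.coe_injective h1))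

lemma pullbackGL_of_map_eq_one {z : pullback φ} (hz : pullbackPerm φ z = 1) :
    ∃ c : kˣ, pullbackGL φ z = GeneralLinearGroup.scalar (Fin n) c := by
  have h := mk_pullbackGL z (σ := 1) hz
  rw [map_one, QuotientGroup.mk'_apply, QuotientGroup.eq_one_iff,
    GeneralLinearGroup.center_eq_range_scalar] at h
  obtain ⟨c, hc⟩ := h
  exact ⟨c, hc.symm⟩

lemma exists_scalar (c : kˣ) : ∃ z : pullback φ, pullbackPerm φ z = 1 ∧
    pullbackGL φ z = GeneralLinearGroup.scalar (Fin n) c := by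
  refine exists_pullback 1 _ ?_
  rw [map_one, QuotientGroup.mk'_apply, QuotientGroup.eq_one_iff,
    GeneralLinearGroup.center_eq_range_scalar]
  exact ⟨c, rfl⟩

lemma isAltExtension_pullbackPerm [IsAlgClosed k] : IsAltExtension (pullbackPerm φ) where
  sign_map x := mem_alternatingGroup.1 x.1.2.2
  exists_lift σ hσ := by
    obtain ⟨g, hg⟩ := QuotientGroup.mk'_surjective (Subgroup.center (GL (Fin n) k))
      (φ ⟨σ, mem_alternatingGroup.2 hσ⟩)
    obtain ⟨x, hx, -⟩ := exists_pullback _ g hg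
    exact ⟨x, hx⟩
  central z hz x := by
    obtain ⟨c, hc⟩ := pullbackGL_of_map_eq_one hz
    refine pullback_ext (by simp [hz]) ?_
    have hmem : GeneralLinearGroup.scalar (Fin n) c ∈ Subgroup.center (GL (Fin n) k) := by
      rw [GeneralLinearGroup.center_eq_range_scalar]
      exact ⟨c, rfl⟩
    rw [map_mul, map_mul, hc, Subgroup.mem_center_iff.1 hmem]
  exists_root z hz := by
    obtain ⟨c, hc⟩ := pullbackGL_of_map_eq_one hz
    obtain ⟨d, hd⟩ := IsAlgClosed.exists_eq_mul_self (c : k)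
    have hd0 : d ≠ 0 := fun h => c.ne_zero (by rw [hd, h, zero_mul])
    obtain ⟨y, hy, hyd⟩ := exists_scalar (φ := φ) (Units.mk0 d hd0)
    refine ⟨y, hy, pullback_ext (by simp [hy, hz]) ?_⟩
    rw [map_mul, hyd, hc, ← map_mul]
    congr 1
    exact Units.ext hd.symm

lemma pullbackEnd_of_eq_scalar {z : pullback φ} {c : kˣ}
    (hz : pullbackGL φ z = GeneralLinearGroup.scalar (Fin n) c) :
    pullbackEnd φ z = algebraMap k _ (c : k) := by
  have : pullbackEnd φ z = (toLinAlgEquiv' : _ ≃ₐ[k] End k (Fin n → k))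
      (pullbackGL φ z : Matrix (Fin n) (Fin n) k) := rfl
  rw [this, hz]
  exact AlgEquiv.commutes _ _

lemma isSpinRep_pullbackEnd [NeZero n] {ε : pullback φ} (hε : ε ≠ 1)
    (h : IsSpinExtension (pullbackPerm φ) ε) :
    IsSpinRep k (pullbackPerm φ) ε (pullbackEnd φ) := by
  obtain ⟨c, hc⟩ := pullbackGL_of_map_eq_one h.map_eps
  have hc1 : (c : k) ≠ 1 := fun h1 => hε <| pullback_ext (by rw [h.map_eps, map_one]) <| by
    rw [hc, show c = 1 from Units.ext h1, map_one, map_one]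
  have hcc : (c : k) * c = 1 := by
    have h1 := congrArg (pullbackGL φ) h.eps_mul_eps
    rw [map_mul, hc, ← map_mul, map_one] at h1
    have h2 := congrArg (fun g : GL (Fin n) k => (g : Matrix (Fin n) (Fin n) k) 0 0) h1
    simpa [GeneralLinearGroup.scalar] using h2
  have hcn : (c : k) = -1 := (mul_self_eq_one_iff.1 hcc).resolve_left hc1
  refine ⟨h, fun z hz => ?_, ?_, fun h2 => hc1 ?_⟩
  · obtain ⟨d, hd⟩ := pullbackGL_of_map_eq_one hz
    exact ⟨d, d.ne_zero, pullbackEnd_of_eq_scalar hd⟩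
  · rw [pullbackEnd_of_eq_scalar hc, hcn, map_neg, map_one]
  · rw [hcn, neg_eq_iff_add_eq_zero, one_add_one_eq_two, h2]

lemma exists_lift_of_section (s : alternatingGroup (Fin m) →* pullback φ)
    (hs : ∀ σ, pullbackPerm φ (s σ) = σ) : ∃ ψ : alternatingGroup (Fin m) →* GL (Fin n) k,
      (QuotientGroup.mk' (Subgroup.center (GL (Fin n) k))).comp ψ = φ :=
  ⟨(pullbackGL φ).comp s, MonoidHom.ext fun σ => mk_pullbackGL _ (hs σ)⟩

/-- A projective representation of an alternating group that does not lift has large degree. -/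
theorem le_of_not_lift [IsAlgClosed k] [NeZero n] (hm : 8 ≤ m)
    (hφ : ¬ ∃ ψ : alternatingGroup (Fin m) →* GL (Fin n) k,
      (QuotientGroup.mk' (Subgroup.center (GL (Fin n) k))).comp ψ = φ) :
    ∃ K, 2 ^ K ≤ n ∧ 15 * m ≤ 81 + 32 * K := by
  rcases (isAltExtension_pullbackPerm (φ := φ)).exists_section_or_isSpinExtension
    (by rwa [Fintype.card_fin]) with ⟨s, hs⟩ | ⟨ε, hε, h⟩
  · exact (hφ (exists_lift_of_section s hs)).elim
  · simpa using (isSpinRep_pullbackEnd hε h).exists_two_pow_le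

end Pullback

end AltSpin

/-- **Lower bound for degrees of genuinely projective representations of alternating
groups (via Wagner).** Let `k` be algebraically closed, `m > 7`, and
`φ : Alt_m → PGL_n(k)` a faithful irreducible projective representation that does not
lift to a linear representation. Then `m ≤ (81 + 32·log₂ n)/15`. Here `PGL_n(k)` is the
quotient of `GL_n(k)` by its center, irreducibility means the preimage of `φ(Alt_m)` in
`GL_n(k)` acts irreducibly on `k^n`, and lifting means factoring through the canonical
projection. -/
theorem stmt6 {k : Type*} [Field k] [IsAlgClosed k] {m n : ℕ} (hm : 7 < m)
    (φ : alternatingGroup (Fin m) →*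
      (Matrix.GeneralLinearGroup (Fin n) k ⧸
        Subgroup.center (Matrix.GeneralLinearGroup (Fin n) k)))
    (hinj : Function.Injective φ)
    (hne : (⊥ : Submodule k (Fin n → k)) ≠ ⊤)
    (hirr : ∀ W : Submodule k (Fin n → k),
      (∀ g ∈ Subgroup.comap
          (QuotientGroup.mk' (Subgroup.center (Matrix.GeneralLinearGroup (Fin n) k)))
          φ.range,
        ∀ v ∈ W, Matrix.mulVec (g : Matrix (Fin n) (Fin n) k) v ∈ W) →
      W = ⊥ ∨ W = ⊤)
    (hnolift : ¬ ∃ ψ : alternatingGroup (Fin m) →* Matrix.GeneralLinearGroup (Fin n) k,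
      (QuotientGroup.mk'
          (Subgroup.center (Matrix.GeneralLinearGroup (Fin n) k))).comp ψ = φ) :
    (m : ℝ) ≤ (81 + 32 * Real.logb 2 n) / 15 := by
  have hn : n ≠ 0 := by
    rintro rfl
    exact hne (Subsingleton.elim _ _)
  have : NeZero n := ⟨hn⟩
  obtain ⟨K, hK, hmK⟩ := AltSpin.le_of_not_lift hm hnolift
  have hlog : (K : ℝ) ≤ Real.logb 2 n := by
    rw [Real.le_logb_iff_rpow_le one_lt_two (by positivity), Real.rpow_natCast]
    exact_mod_cast hK
  have hmK' : (15 * m : ℝ) ≤ 81 + 32 * K := by exact_mod_cast hmK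
  linarith
end
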